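/- Fix integers k ≥ 1 and s > k+1. For every real ε > 0 there exists M > 0 such that the following holds: if P is a finite set of points in ℝ² and C is a k-intersecting family of simple curves such that (P,C) does not contain a complete s-point (k+1)-configuration, and moreover |P|^(k+1) ≥ M·|C|, |C| ≥ M, and |C|² ≥ M·|P|, then I(P,C) < ε · |P|^((k+1)/(2k+1)) · |C|^((2k)/(2k+1)). -/

import Mathlib

open scoped Classical

/-- A simple curve: the image of an injective continuous map from [0,1] into ℝ². -/
def IsSimpleCurve (γ : Set (ℝ × ℝ)) : Prop :=
  ∃ f : Set.Icc (0:ℝ) 1 → ℝ × ℝ, Continuous f ∧ Function.Injective f ∧ γ = Set.range f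

/-- A k-intersecting family of simple curves: every member is a simple curve and
any two distinct members intersect in at most k points. -/
def KIntersecting (C : Finset (Set (ℝ × ℝ))) (k : ℕ) : Prop :=
  (∀ γ ∈ C, IsSimpleCurve γ) ∧
  ∀ γ ∈ C, ∀ γ' ∈ C, γ ≠ γ' → (γ ∩ γ').Finite ∧ (γ ∩ γ').ncard ≤ k

/-- The number of incidences between a finite point set P and a finite family of curves C. -/
noncomputable def incidences (P : Finset (ℝ × ℝ)) (C : Finset (Set (ℝ × ℝ))) : ℕ :=
  ∑ γ ∈ C, (P.filter (fun p => p ∈ γ)).card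

/-- (P,C) contains a complete s-point (k+1)-configuration: there are s points of P and an
injective assignment of a distinct curve of C to each (k+1)-element subset, containing it. -/
def ContainsConfig (P : Finset (ℝ × ℝ)) (C : Finset (Set (ℝ × ℝ))) (s k : ℕ) : Prop :=
  ∃ S : Finset (ℝ × ℝ), S ⊆ P ∧ S.card = s ∧
    ∃ φ : Finset (ℝ × ℝ) → Set (ℝ × ℝ),
      Set.InjOn φ ↑(S.powersetCard (k+1)) ∧
      ∀ T ∈ S.powersetCard (k+1), φ T ∈ C ∧ (↑T : Set (ℝ × ℝ)) ⊆ φ T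

section
lemma exists_log_lift (F : ℝ × ℝ → ℂ) (hF : Continuous F) (h0 : ∀ p, F p ≠ 0) :
    ∃ L : ℝ × ℝ → ℂ, Continuous L ∧ ∀ p, Complex.exp (L p) = F p := by
  obtain ⟨G, ⟨-, hG⟩, -⟩ := Complex.isCoveringMapOn_exp.existsUnique_continuousMap_lifts
    (⟨F, hF⟩ : C(ℝ × ℝ, ℂ)) (a₀ := (0, 0)) (e₀ := Complex.log (F (0, 0)))
    (by simpa using Complex.exp_log (h0 (0,0))) (by intro a; simpa using h0 a)
  exact ⟨G, G.continuous, fun p => congrFun hG p⟩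

lemma log_change_eq (L L' : ℝ → ℂ) (hL : Continuous L) (hL' : Continuous L')
    (h : ∀ t, Complex.exp (L t) = Complex.exp (L' t)) : L 1 - L 0 = L' 1 - L' 0 := by
  have key := Complex.isCoveringMap_exp.eq_of_comp_eq (g₁ := fun t : ℝ => L t - L' t)
    (g₂ := fun _ : ℝ => L 0 - L' 0) (by fun_prop) (by fun_prop)
    (by
      funext t
      simp only [Function.comp_apply, Subtype.mk.injEq]
      rw [Complex.exp_sub, Complex.exp_sub, h, h, div_self (Complex.exp_ne_zero _),
        div_self (Complex.exp_ne_zero _)]) 0 rfl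
  have := congrFun key 1
  linear_combination this

/-- Topological non-planarity of `K₅`. -/
theorem no_K5 (p : Fin 5 → ℂ) (γ : Fin 5 → Fin 5 → ℝ → ℂ)
    (hc : ∀ i j, i < j → Continuous (γ i j))
    (h0 : ∀ i j, i < j → γ i j 0 = p i) (h1 : ∀ i j, i < j → γ i j 1 = p j)
    (hd : ∀ a b c d, a < b → c < d → a ≠ c → a ≠ d → b ≠ c → b ≠ d → ∀ s t, γ a b s ≠ γ c d t) :
    False := by
  have hav : ∀ x c d : Fin 5, c < d → x ≠ c → x ≠ d → ∀ t, γ c d t - p x ≠ 0 := by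
    intro x c d hcd hxc hxd t
    rw [sub_ne_zero]
    obtain ⟨y, hyx, hyc, hyd⟩ : ∃ y : Fin 5, y ≠ x ∧ y ≠ c ∧ y ≠ d := by
      clear * -; revert x c d; decide
    rcases lt_or_gt_of_ne hyx with h | h
    · rw [← h1 y x h]; exact (hd y x c d h hcd hyc hyd hxc hxd 1 t).symm
    · rw [← h0 x y h]; exact (hd x y c d h hcd hxc hxd hyc hyd 0 t).symm
  have hne : ∀ x y : Fin 5, x ≠ y → p y - p x ≠ 0 := by
    intro x y hxy
    obtain ⟨z, hzx, hzy⟩ : ∃ z : Fin 5, z ≠ x ∧ z ≠ y := by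
      clear * -; revert x y; decide
    rcases lt_or_gt_of_ne hzy with h | h
    · rw [← h1 z y h]; exact hav x z y h hzx.symm hxy 1
    · rw [← h0 y z h]; exact hav x y z h hxy hzx.symm 0
  set θ : Fin 5 → Fin 5 → ℂ := fun x y =>
    if x < y then Complex.log (p y - p x) else Complex.log (p x - p y) + Real.pi * Complex.I with hθ
  have hexp : ∀ x y, x ≠ y → Complex.exp (θ x y) = p y - p x := by
    intro x y hxy
    simp only [hθ]
    split_ifs with h
    · exact Complex.exp_log (hne x y hxy)
    · rw [Complex.exp_add, Complex.exp_log (hne y x hxy.symm), Complex.exp_pi_mul_I]; ring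
  have hn : ∀ x c d : Fin 5, ∃ n : ℤ, c < d → x ≠ c → x ≠ d → ∀ L : ℝ → ℂ, Continuous L →
      (∀ t, Complex.exp (L t) = γ c d t - p x) →
      L 1 - L 0 = θ x d - θ x c + n * (2 * Real.pi * Complex.I) := by
    intro x c d
    by_cases hh : c < d ∧ x ≠ c ∧ x ≠ d
    swap
    · exact ⟨0, fun a b c => absurd ⟨a, b, c⟩ hh⟩
    obtain ⟨hcd, hxc, hxd⟩ := hh
    have hcc := hc c d hcd
    obtain ⟨M, hM, hM'⟩ := exists_log_lift (fun q => γ c d q.1 - p x) (by fun_prop)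
      (fun q => hav x c d hcd hxc hxd q.1)
    have e1 : Complex.exp (M (1, 0)) = Complex.exp (θ x d) := by
      rw [hM', hexp x d hxd, h1 c d hcd]
    have e0 : Complex.exp (M (0, 0)) = Complex.exp (θ x c) := by
      rw [hM', hexp x c hxc, h0 c d hcd]
    obtain ⟨n1, hn1⟩ := Complex.exp_eq_exp_iff_exists_int.1 e1
    obtain ⟨n0, hn0⟩ := Complex.exp_eq_exp_iff_exists_int.1 e0
    refine ⟨n1 - n0, fun _ _ _ L hL hL' => ?_⟩
    rw [log_change_eq L (fun t => M (t, 0)) hL (by fun_prop) (fun t => by rw [hL', hM'])]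
    simp only [hn1, hn0]; push_cast; ring
  choose n hn using hn
  set κ : Fin 5 → Fin 5 → ℤ := fun x y => if x < y then -1 else 1 with hκ
  have hθκ : ∀ x y, x ≠ y → θ x y - θ y x = κ x y * (Real.pi * Complex.I) := by
    intro x y hxy
    simp only [hθ, hκ]
    rcases lt_or_gt_of_ne hxy with h | h
    · simp [h, not_lt.2 h.le]
    · simp [h, not_lt.2 h.le]
  have main : ∀ a b c d, a < b → c < d → a ≠ c → a ≠ d → b ≠ c → b ≠ d →
      2 * (n a c d + n d a b - n c a b - n b c d) + κ a d - κ a c + κ d b + κ b c = 0 := by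
    intro a b c d hab hcd hac had hbc hbd
    have hc1 := hc a b hab
    have hc2 := hc c d hcd
    obtain ⟨M, hM, hM'⟩ := exists_log_lift (fun q => γ c d q.2 - γ a b q.1) (by fun_prop)
      (fun q => sub_ne_zero.2 (hd a b c d hab hcd hac had hbc hbd q.1 q.2).symm)
    have E1 := hn a c d hcd hac had (fun t => M (0, t)) (by fun_prop)
      (fun t => by rw [hM']; simp only [h0 a b hab])
    have E2 := hn b c d hcd hbc hbd (fun t => M (1, t)) (by fun_prop)
      (fun t => by rw [hM']; simp only [h1 a b hab])
    have E3 := hn c a b hab hac.symm hbc.symm (fun t => M (t, 0) + Real.pi * Complex.I) (by fun_prop)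
      (fun t => by rw [Complex.exp_add, hM', Complex.exp_pi_mul_I]; simp only [h0 c d hcd]; ring)
    have E4 := hn d a b hab had.symm hbd.symm (fun t => M (t, 1) + Real.pi * Complex.I) (by fun_prop)
      (fun t => by rw [Complex.exp_add, hM', Complex.exp_pi_mul_I]; simp only [h1 c d hcd]; ring)
    have k1 := hθκ a d had
    have k2 := hθκ a c hac
    have k3 := hθκ d b hbd.symm
    have k4 := hθκ b c hbc
    have hpi : (Real.pi * Complex.I : ℂ) ≠ 0 := by
      simp [Real.pi_ne_zero]
    have : (((2 * (n a c d + n d a b - n c a b - n b c d) + κ a d - κ a c + κ d b + κ b c : ℤ)) : ℂ)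
        * (Real.pi * Complex.I) = 0 := by
      push_cast
      linear_combination (-1:ℂ) * E1 + E2 + E3 - E4 - k1 + k2 - k3 - k4
    have := (mul_eq_zero.1 this).resolve_right hpi
    exact_mod_cast this
  have q1 := main 0 1 2 3 (by decide) (by decide) (by decide) (by decide) (by decide) (by decide)
  have q2 := main 0 1 2 4 (by decide) (by decide) (by decide) (by decide) (by decide) (by decide)
  have q3 := main 0 1 3 4 (by decide) (by decide) (by decide) (by decide) (by decide) (by decide)
  have q4 := main 0 2 1 3 (by decide) (by decide) (by decide) (by decide) (by decide) (by decide)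
  have q5 := main 0 2 1 4 (by decide) (by decide) (by decide) (by decide) (by decide) (by decide)
  have q6 := main 0 2 3 4 (by decide) (by decide) (by decide) (by decide) (by decide) (by decide)
  have q7 := main 0 3 1 2 (by decide) (by decide) (by decide) (by decide) (by decide) (by decide)
  have q8 := main 0 3 1 4 (by decide) (by decide) (by decide) (by decide) (by decide) (by decide)
  have q9 := main 0 3 2 4 (by decide) (by decide) (by decide) (by decide) (by decide) (by decide)
  have r1 := main 0 4 1 2 (by decide) (by decide) (by decide) (by decide) (by decide) (by decide)
  have r2 := main 0 4 1 3 (by decide) (by decide) (by decide) (by decide) (by decide) (by decide)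
  have r3 := main 0 4 2 3 (by decide) (by decide) (by decide) (by decide) (by decide) (by decide)
  have r4 := main 1 2 3 4 (by decide) (by decide) (by decide) (by decide) (by decide) (by decide)
  have r5 := main 1 3 2 4 (by decide) (by decide) (by decide) (by decide) (by decide) (by decide)
  have r6 := main 1 4 2 3 (by decide) (by decide) (by decide) (by decide) (by decide) (by decide)
  have kl : ∀ x y : Fin 5, x < y → κ x y = -1 := fun x y h => by simp [hκ, h]
  have kg : ∀ x y : Fin 5, y < x → κ x y = 1 := fun x y h => by simp [hκ, not_lt.2 h.le]
  clear_value κ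
  clear main hn hθκ hexp
  have k01 := kl 0 1 (by decide)
  have k02 := kl 0 2 (by decide)
  have k03 := kl 0 3 (by decide)
  have k04 := kl 0 4 (by decide)
  have k12 := kl 1 2 (by decide)
  have k13 := kl 1 3 (by decide)
  have k14 := kl 1 4 (by decide)
  have k23 := kl 2 3 (by decide)
  have k24 := kl 2 4 (by decide)
  have k34 := kl 3 4 (by decide)
  have k10 := kg 1 0 (by decide)
  have k20 := kg 2 0 (by decide)
  have k30 := kg 3 0 (by decide)
  have k40 := kg 4 0 (by decide)
  have k21 := kg 2 1 (by decide)
  have k31 := kg 3 1 (by decide)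
  have k41 := kg 4 1 (by decide)
  have k32 := kg 3 2 (by decide)
  have k42 := kg 4 2 (by decide)
  have k43 := kg 4 3 (by decide)
  simp only [k01,k02,k03,k04,k12,k13,k14,k23,k24,k34,k10,k20,k30,k40,k21,k31,k41,k32,k42,k43] at *
  omega

end

section
/-- A finite vertex set is connected for the relation `adj`. -/
def Conn {α : Type*} (adj : α → α → Prop) (S : Finset α) : Prop :=
  S.Nonempty ∧ ∀ T ⊆ S, T.Nonempty → (∀ u ∈ T, ∀ v ∈ S, adj u v → v ∈ T) → T = S

/-- There is no `K₅` minor. -/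
def NoK5 {α : Type*} (adj : α → α → Prop) : Prop :=
  ∀ B : Fin 5 → Finset α, (∀ i, Conn adj (B i)) → (∀ i j, i ≠ j → Disjoint (B i) (B j)) →
    (∀ i j, i ≠ j → ∃ u ∈ B i, ∃ v ∈ B j, adj u v) → False

section Separator

lemma sum_biUnion_le_nat {ι α : Type*} {s : Finset ι} {t : ι → Finset α} {f : α → ℕ} :
    ∑ x ∈ s.biUnion t, f x ≤ ∑ i ∈ s, ∑ x ∈ t i, f x := by
  induction s using Finset.induction_on with
  | empty => simp
  | insert a s ha ih =>
    rw [Finset.biUnion_insert, Finset.sum_insert ha]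
    have := Finset.sum_union_inter (s₁ := t a) (s₂ := s.biUnion t) (f := f)
    omega

variable {α : Type*} {adj : α → α → Prop}

lemma conn_singleton (v : α) : Conn adj {v} := by
  refine ⟨Finset.singleton_nonempty v, fun T hT hne _ => ?_⟩
  rcases Finset.subset_singleton_iff.1 hT with h | h
  · simp [h] at hne
  · exact h

lemma Conn.subset_of_closed {S T : Finset α} (hS : Conn adj S)
    (h : ∃ x ∈ S, x ∈ T) (hcl : ∀ u ∈ T, u ∈ S → ∀ v ∈ S, adj u v → v ∈ T) : S ⊆ T := by
  have := hS.2 (S ∩ T) Finset.inter_subset_left (by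
    obtain ⟨x, hx, hx'⟩ := h; exact ⟨x, Finset.mem_inter.2 ⟨hx, hx'⟩⟩) (by
    intro u hu v hv huv
    rw [Finset.mem_inter] at hu ⊢
    exact ⟨hv, hcl u hu.2 hu.1 v hv huv⟩)
  rw [← this]; exact Finset.inter_subset_right

lemma conn_biUnion {𝒦 : Finset (Finset α)} (hne : 𝒦.Nonempty) (h : ∀ K ∈ 𝒦, Conn adj K)
    (hinter : ∀ K ∈ 𝒦, ∀ K' ∈ 𝒦, ∃ x ∈ K, x ∈ K') : Conn adj (𝒦.biUnion id) := by
  constructor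
  · obtain ⟨K, hK⟩ := hne
    obtain ⟨x, hx⟩ := (h K hK).1
    exact ⟨x, Finset.mem_biUnion.2 ⟨K, hK, hx⟩⟩
  · intro T hT hTne hcl
    refine Finset.Subset.antisymm hT ?_
    have hK : ∀ K ∈ 𝒦, (∃ x ∈ K, x ∈ T) → K ⊆ T := by
      intro K hK hx
      refine (h K hK).subset_of_closed hx fun u hu _ v hv huv => hcl u hu v ?_ huv
      exact Finset.mem_biUnion.2 ⟨K, hK, hv⟩
    obtain ⟨x, hx⟩ := hTne
    obtain ⟨K, hK1, hxK⟩ := Finset.mem_biUnion.1 (hT hx)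
    have hKT := hK K hK1 ⟨x, hxK, hx⟩
    intro y hy
    obtain ⟨K', hK', hyK'⟩ := Finset.mem_biUnion.1 hy
    obtain ⟨z, hz, hz'⟩ := hinter K hK1 K' hK'
    exact hK K' hK' ⟨z, hz', hKT hz⟩ hyK'

lemma Conn.insert_adj (hsymm : ∀ u v, adj u v → adj v u) {S : Finset α} (hS : Conn adj S) {u v : α}
    (hu : u ∈ S) (huv : adj u v) : Conn adj (insert v S) := by
  refine ⟨⟨v, Finset.mem_insert_self _ _⟩, fun T hT hTne hcl => Finset.Subset.antisymm hT ?_⟩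
  have h1 : (∃ x ∈ S, x ∈ T) → S ⊆ T := fun hx => hS.subset_of_closed hx
    fun u hu _ v hv huv => hcl u hu v (Finset.mem_insert_of_mem hv) huv
  have h2 : S ⊆ T := by
    obtain ⟨x, hx⟩ := hTne
    rcases Finset.mem_insert.1 (hT hx) with rfl | h
    · exact h1 ⟨u, hu, hcl x hx u (Finset.mem_insert_of_mem hu) (hsymm _ _ huv)⟩
    · exact h1 ⟨x, h, hx⟩
  exact Finset.insert_subset (hcl u (h2 hu) v (Finset.mem_insert_self _ _) huv) h2

/-- layering lemma -/
lemma layer (hsymm : ∀ u v, adj u v → adj v u) (c : α → ℕ) {B A : Finset α} (hB : Conn adj B)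
    (hAB : A ⊆ B) (hA : A.Nonempty) (τ : ℕ) (hτ : 1 ≤ τ) :
    ∃ I Z : Finset α, I ⊆ B ∧ Z ⊆ B ∧ A ⊆ I ∪ Z ∧
      (∀ u ∈ I, ∀ v ∈ B, adj u v → v ∈ I ∪ Z) ∧
      τ * ∑ v ∈ Z, c v ≤ ∑ v ∈ B, c v ^ 2 ∧
      (∀ v ∈ I, ∃ K ⊆ B, Conn adj K ∧ v ∈ K ∧ (∃ a ∈ K, a ∈ A) ∧ ∑ x ∈ K, c x ≤ τ) := by
  set good : α → ℕ → Prop := fun v m => ∃ K ⊆ B, Conn adj K ∧ v ∈ K ∧ (∃ a ∈ K, a ∈ A) ∧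
    ∑ x ∈ K, c x ≤ m with hgood
  have hex : ∀ v, ∃ m, v ∈ B → good v m := by
    intro v
    refine ⟨∑ x ∈ B, c x, fun hv => ⟨B, subset_rfl, hB, hv, ?_, le_rfl⟩⟩
    obtain ⟨a, ha⟩ := hA
    exact ⟨a, hAB ha, ha⟩
  set d : α → ℕ := fun v => Nat.find (hex v) with hd
  have hdg : ∀ v ∈ B, good v (d v) := fun v hv => Nat.find_spec (hex v) hv
  have hdle : ∀ v m, good v m → d v ≤ m := fun v m h => Nat.find_min' (hex v) (fun _ => h)
  set Z : ℕ → Finset α := fun t => B.filter (fun v => t ≤ d v ∧ d v < t + c v) with hZ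
  have hsum : ∑ t ∈ Finset.Icc 1 τ, ∑ v ∈ Z t, c v ≤ ∑ v ∈ B, c v ^ 2 := by
    simp only [hZ, Finset.sum_filter]
    rw [Finset.sum_comm]
    refine Finset.sum_le_sum fun v hv => ?_
    rw [← Finset.sum_filter, Finset.sum_const, smul_eq_mul, sq]
    refine Nat.mul_le_mul_right _ ?_
    calc _ ≤ (Finset.Ioc (d v - c v) (d v)).card := by
          refine Finset.card_le_card fun t ht => ?_
          simp only [Finset.mem_filter, Finset.mem_Icc, Finset.mem_Ioc] at ht ⊢
          omega
      _ ≤ c v := by rw [Nat.card_Ioc]; omega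
  obtain ⟨t, ht, htle⟩ : ∃ t ∈ Finset.Icc 1 τ, τ * ∑ v ∈ Z t, c v ≤ ∑ v ∈ B, c v ^ 2 := by
    by_contra hcon
    push Not at hcon
    have : ∑ t ∈ Finset.Icc 1 τ, ∑ v ∈ B, c v ^ 2 < ∑ t ∈ Finset.Icc 1 τ, τ * ∑ v ∈ Z t, c v :=
      Finset.sum_lt_sum_of_nonempty ⟨1, by simp [hτ]⟩ hcon
    rw [← Finset.mul_sum, Finset.sum_const, Nat.card_Icc, smul_eq_mul] at this
    have h2 := Nat.mul_le_mul_left τ hsum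
    simp only [Nat.add_sub_cancel] at this
    omega
  rw [Finset.mem_Icc] at ht
  refine ⟨B.filter (fun v => d v < t), Z t, Finset.filter_subset _ _, Finset.filter_subset _ _,
    ?_, ?_, htle, ?_⟩
  · intro a ha
    have : d a ≤ c a := hdle a _ ⟨{a}, by simpa using hAB ha, conn_singleton a, by simp,
      ⟨a, by simp, ha⟩, by simp⟩
    have hb := hAB ha
    simp only [hZ, Finset.mem_union, Finset.mem_filter, hb, true_and]
    omega
  · intro u hu v hv huv
    rw [Finset.mem_filter] at hu
    have : d v ≤ d u + c v := by
      obtain ⟨K, hKB, hK, huK, ⟨a, haK, ha⟩, hle⟩ := hdg u hu.1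
      refine hdle v _ ⟨insert v K, Finset.insert_subset hv hKB, hK.insert_adj hsymm huK huv,
        Finset.mem_insert_self _ _, ⟨a, Finset.mem_insert_of_mem haK, ha⟩, ?_⟩
      by_cases hvK : v ∈ K
      · rw [Finset.insert_eq_of_mem hvK]; omega
      · rw [Finset.sum_insert hvK]; omega
    simp only [hZ, Finset.mem_union, Finset.mem_filter, hv, true_and]
    omega
  · intro v hv
    rw [Finset.mem_filter] at hv
    obtain ⟨K, hKB, hK, huK, hA, hle⟩ := hdg v hv.1
    exact ⟨K, hKB, hK, huK, hA, by omega⟩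

/-- Alon, Seymour and Thomas type separator theorem with vertex costs. -/
theorem separator (hsymm : ∀ u v, adj u v → adj v u) (hK5 : NoK5 adj) (c : α → ℕ) (w : α → ℝ)
    (hw : ∀ v, 0 ≤ w v) (S : Finset α) :
    ∃ X ⊆ S, ∑ v ∈ X, c v ≤ 25 * (Nat.sqrt (∑ v ∈ S, c v ^ 2) + 1) ∧
      ∀ K ⊆ S \ X, Conn adj K → 2 * ∑ v ∈ K, w v ≤ ∑ v ∈ S, w v := by
  set τ := Nat.sqrt (∑ v ∈ S, c v ^ 2) + 1 with hτ
  have hτ2 : ∑ v ∈ S, c v ^ 2 ≤ τ * τ := by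
    have := Nat.sqrt_lt'.1 (Nat.lt_succ_self (Nat.sqrt (∑ v ∈ S, c v ^ 2)))
    rw [sq] at this
    exact this.le
  by_contra hcon
  push Not at hcon
  have hmono : ∀ {A B : Finset α}, A ⊆ B → ∑ v ∈ A, c v ≤ ∑ v ∈ B, c v := fun h =>
    Finset.sum_le_sum_of_subset h
  -- the big component
  set fam : Finset α → Finset (Finset α) := fun X =>
    (S \ X).powerset.filter (fun K => Conn adj K ∧ ∑ v ∈ S, w v < 2 * ∑ v ∈ K, w v) with hfam
  set β : Finset α → Finset α := fun X => (fam X).biUnion id with hβ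
  have heavy_int : ∀ K K' : Finset α, K ⊆ S → K' ⊆ S → ∑ v ∈ S, w v < 2 * ∑ v ∈ K, w v →
      ∑ v ∈ S, w v < 2 * ∑ v ∈ K', w v → ∃ x ∈ K, x ∈ K' := by
    intro K K' h1 h2 h3 h4
    by_contra hne
    have hdis : Disjoint K K' := Finset.disjoint_left.2 fun x hx hx' => hne ⟨x, hx, hx'⟩
    have := Finset.sum_union hdis (f := w)
    have h5 : ∑ v ∈ K ∪ K', w v ≤ ∑ v ∈ S, w v :=
      Finset.sum_le_sum_of_subset_of_nonneg (Finset.union_subset h1 h2) fun i _ _ => hw i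
    linarith
  have memfam : ∀ X K, K ∈ fam X ↔ K ⊆ S \ X ∧ Conn adj K ∧ ∑ v ∈ S, w v < 2 * ∑ v ∈ K, w v := by
    intro X K; simp only [hfam, Finset.mem_filter, Finset.mem_powerset]
  have βsub : ∀ X, β X ⊆ S \ X := fun X => Finset.biUnion_subset.2 fun K hK => ((memfam X K).1 hK).1
  have heavy_sub : ∀ X K, K ⊆ S \ X → Conn adj K → ∑ v ∈ S, w v < 2 * ∑ v ∈ K, w v → K ⊆ β X :=
    fun X K h1 h2 h3 => Finset.subset_biUnion_of_mem id ((memfam X K).2 ⟨h1, h2, h3⟩)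
  have βconn : ∀ X ⊆ S, ∑ v ∈ X, c v ≤ 25 * τ → Conn adj (β X) := by
    intro X hX hc
    obtain ⟨K, h1, h2, h3⟩ := hcon X hX hc
    refine conn_biUnion ⟨K, (memfam X K).2 ⟨h1, h2, h3⟩⟩ (fun K hK => ((memfam X K).1 hK).2.1) ?_
    intro K hK K' hK'
    have a := (memfam X K).1 hK
    have b := (memfam X K').1 hK'
    exact heavy_int K K' (a.1.trans Finset.sdiff_subset) (b.1.trans Finset.sdiff_subset) a.2.2 b.2.2
  have βheavy : ∀ X ⊆ S, ∑ v ∈ X, c v ≤ 25 * τ → ∑ v ∈ S, w v < 2 * ∑ v ∈ β X, w v := by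
    intro X hX hc
    obtain ⟨K, h1, h2, h3⟩ := hcon X hX hc
    have : ∑ v ∈ K, w v ≤ ∑ v ∈ β X, w v :=
      Finset.sum_le_sum_of_subset_of_nonneg (heavy_sub X K h1 h2 h3) fun i _ _ => hw i
    linarith
  have βadj : ∀ X ⊆ S, ∑ v ∈ X, c v ≤ 25 * τ → ∀ u ∈ β X, ∀ v ∈ S, v ∉ X → adj u v → v ∈ β X := by
    intro X hX hc u hu v hv hvX huv
    have h1 := (βconn X hX hc).insert_adj hsymm hu huv
    refine heavy_sub X (insert v (β X)) (Finset.insert_subset (by simp [hv, hvX]) (βsub X)) h1 ?_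
      (Finset.mem_insert_self _ _)
    have : ∑ v ∈ β X, w v ≤ ∑ x ∈ insert v (β X), w x :=
      Finset.sum_le_sum_of_subset_of_nonneg (Finset.subset_insert _ _) fun i _ _ => hw i
    linarith [βheavy X hX hc]
  have βmono : ∀ X X', X ⊆ S → X' ⊆ S → ∑ v ∈ X', c v ≤ 25 * τ → X ⊆ X' → β X' ⊆ β X := by
    intro X X' hX hX' hc hXX
    exact heavy_sub X (β X') ((βsub X').trans (Finset.sdiff_subset_sdiff subset_rfl hXX))
      (βconn X' hX' hc) (βheavy X' hX' hc)
  have main : ∀ N : ℕ, ∀ (𝒞 : Finset (Finset α)) (X : Finset α),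
      5 * (β X).card + 𝒞.card = N →
      (∀ C ∈ 𝒞, C ⊆ S ∧ Conn adj C ∧ ∑ v ∈ X ∩ C, c v ≤ 5 * τ ∧ Disjoint C (β X)) →
      (∀ C ∈ 𝒞, ∀ D ∈ 𝒞, C ≠ D → Disjoint C D ∧ ∃ u ∈ C, ∃ v ∈ D, adj u v) →
      X ⊆ 𝒞.biUnion id → False := by
    intro N
    induction N using Nat.strong_induction_on with
    | _ N ih =>
    intro 𝒞 X hN hC hCD hX
    have hcard : 𝒞.card ≤ 4 := by
      by_contra hlt
      obtain ⟨𝒟, h𝒟, h5⟩ := Finset.exists_subset_card_eq (show 5 ≤ 𝒞.card by omega)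
      set e := (Finset.equivFinOfCardEq h5).symm
      refine hK5 (fun i => (e i).1) (fun i => (hC _ (h𝒟 (e i).2)).2.1) ?_ ?_
      · intro i j hij
        exact (hCD _ (h𝒟 (e i).2) _ (h𝒟 (e j).2) (fun h => hij (e.injective (Subtype.ext h)))).1
      · intro i j hij
        exact (hCD _ (h𝒟 (e i).2) _ (h𝒟 (e j).2) (fun h => hij (e.injective (Subtype.ext h)))).2
    have hXS : X ⊆ S := hX.trans (Finset.biUnion_subset.2 fun C hC' => (hC C hC').1)
    have hXc : ∑ v ∈ X, c v ≤ 20 * τ := by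
      have h1 : X ⊆ 𝒞.biUnion (fun C => X ∩ C) := by
        intro x hx
        obtain ⟨C, hC', hxC⟩ := Finset.mem_biUnion.1 (hX hx)
        exact Finset.mem_biUnion.2 ⟨C, hC', Finset.mem_inter.2 ⟨hx, hxC⟩⟩
      calc ∑ v ∈ X, c v ≤ ∑ v ∈ 𝒞.biUnion (fun C => X ∩ C), c v := hmono h1
        _ ≤ ∑ C ∈ 𝒞, ∑ v ∈ X ∩ C, c v := sum_biUnion_le_nat
        _ ≤ ∑ C ∈ 𝒞, 5 * τ := Finset.sum_le_sum fun C hC' => (hC C hC').2.2.1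
        _ = 𝒞.card * (5 * τ) := by simp
        _ ≤ 4 * (5 * τ) := Nat.mul_le_mul_right _ hcard
        _ = 20 * τ := by ring
    have hXc' : ∑ v ∈ X, c v ≤ 25 * τ := by omega
    set B := β X with hBdef
    have hBconn := βconn X hXS hXc'
    have hBS : B ⊆ S := (βsub X).trans Finset.sdiff_subset
    have hBX : ∀ v ∈ B, v ∉ X := fun v hv => (Finset.mem_sdiff.1 (βsub X hv)).2
    set A : Finset α → Finset α := fun C => B.filter (fun v => ∃ u ∈ C, adj u v) with hA
    by_cases hcase1 : ∃ C ∈ 𝒞, A C = ∅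
    · obtain ⟨C, hC', hAC⟩ := hcase1
      have hX'S : X \ C ⊆ S := Finset.sdiff_subset.trans hXS
      have hX'c : ∑ v ∈ X \ C, c v ≤ 25 * τ := (hmono Finset.sdiff_subset).trans hXc'
      have hsub1 : B ⊆ β (X \ C) := βmono _ _ hX'S hXS hXc' Finset.sdiff_subset
      have hsub2 : β (X \ C) ⊆ B := by
        refine (βconn _ hX'S hX'c).subset_of_closed ?_ ?_
        · obtain ⟨x, hx⟩ := hBconn.1
          exact ⟨x, hsub1 hx, hx⟩
        · intro u hu _ v hv huv
          have hv' := Finset.mem_sdiff.1 (βsub _ hv)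
          by_cases hvX : v ∈ X
          · exfalso
            have hvC : v ∈ C := by
              by_contra h; exact hv'.2 (Finset.mem_sdiff.2 ⟨hvX, h⟩)
            have : u ∈ A C := Finset.mem_filter.2 ⟨hu, v, hvC, hsymm _ _ huv⟩
            rw [hAC] at this; simp at this
          · exact βadj X hXS hXc' u hu v hv'.1 hvX huv
      have hEq : β (X \ C) = B := Finset.Subset.antisymm hsub2 hsub1
      have hcpos : 0 < 𝒞.card := Finset.card_pos.2 ⟨C, hC'⟩
      refine ih _ ?_ (𝒞.erase C) (X \ C) rfl ?_ ?_ ?_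
      · rw [hEq, Finset.card_erase_of_mem hC']; omega
      · intro D hD
        have hD' := hC D (Finset.mem_of_mem_erase hD)
        refine ⟨hD'.1, hD'.2.1, (hmono ?_).trans hD'.2.2.1, by rw [hEq]; exact hD'.2.2.2⟩
        exact Finset.inter_subset_inter Finset.sdiff_subset subset_rfl
      · intro D hD E hE
        exact hCD D (Finset.mem_of_mem_erase hD) E (Finset.mem_of_mem_erase hE)
      · intro x hx
        rw [Finset.mem_sdiff] at hx
        obtain ⟨D, hD, hxD⟩ := Finset.mem_biUnion.1 (hX hx.1)
        refine Finset.mem_biUnion.2 ⟨D, Finset.mem_erase.2 ⟨?_, hD⟩, hxD⟩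
        rintro rfl; exact hx.2 hxD
    · have hAne : ∀ C ∈ 𝒞, (A C).Nonempty := fun C hC' => by
        rw [Finset.nonempty_iff_ne_empty]; exact fun h => hcase1 ⟨C, hC', h⟩
      by_cases hcase2 : ∃ v ∈ B, ∀ C ∈ 𝒞, ∃ K ⊆ B, Conn adj K ∧ v ∈ K ∧ (∃ a ∈ K, a ∈ A C) ∧
          ∑ x ∈ K, c x ≤ τ
      · obtain ⟨v, hvB, hv⟩ := hcase2
        choose! K hKB hKc hvK hKA hKs using hv
        set fm : Finset (Finset α) := insert {v} (𝒞.image K) with hfm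
        have hfmem : ∀ L ∈ fm, L ⊆ B ∧ Conn adj L ∧ v ∈ L := by
          intro L hL
          rcases Finset.mem_insert.1 hL with rfl | hL
          · exact ⟨by simpa using hvB, conn_singleton v, by simp⟩
          · obtain ⟨C, hC', rfl⟩ := Finset.mem_image.1 hL
            exact ⟨hKB C hC', hKc C hC', hvK C hC'⟩
        set T := fm.biUnion id with hT
        have hTconn : Conn adj T := conn_biUnion ⟨{v}, Finset.mem_insert_self _ _⟩
          (fun L hL => (hfmem L hL).2.1)
          (fun L hL L' hL' => ⟨v, (hfmem L hL).2.2, (hfmem L' hL').2.2⟩)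
        have hTB : T ⊆ B := Finset.biUnion_subset.2 fun L hL => (hfmem L hL).1
        have hvT : v ∈ T := Finset.mem_biUnion.2 ⟨{v}, Finset.mem_insert_self _ _, by simp⟩
        have hKT : ∀ C ∈ 𝒞, K C ⊆ T := fun C hC' => Finset.subset_biUnion_of_mem id
          (Finset.mem_insert_of_mem (Finset.mem_image_of_mem _ hC'))
        have hcv : c v ≤ τ := by
          have h1 : c v ^ 2 ≤ ∑ v ∈ S, c v ^ 2 :=
            Finset.single_le_sum (f := fun v => c v ^ 2) (fun _ _ => Nat.zero_le _) (hBS hvB)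
          nlinarith
        have hTc : ∑ x ∈ T, c x ≤ 5 * τ := by
          have h1 : T ⊆ insert v (𝒞.biUnion K) := by
            intro x hx
            obtain ⟨L, hL, hxL⟩ := Finset.mem_biUnion.1 hx
            rcases Finset.mem_insert.1 hL with rfl | hL
            · simp only [id, Finset.mem_singleton] at hxL; simp [hxL]
            · obtain ⟨C, hC', rfl⟩ := Finset.mem_image.1 hL
              exact Finset.mem_insert_of_mem (Finset.mem_biUnion.2 ⟨C, hC', hxL⟩)
          have h2 : ∑ x ∈ 𝒞.biUnion K, c x ≤ 4 * τ := by
            calc _ ≤ ∑ C ∈ 𝒞, ∑ x ∈ K C, c x := sum_biUnion_le_nat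
              _ ≤ ∑ C ∈ 𝒞, τ := Finset.sum_le_sum fun C hC' => hKs C hC'
              _ = 𝒞.card * τ := by simp
              _ ≤ 4 * τ := Nat.mul_le_mul_right _ hcard
          have h3 : ∑ x ∈ insert v (𝒞.biUnion K), c x ≤ c v + ∑ x ∈ 𝒞.biUnion K, c x := by
            by_cases h : v ∈ 𝒞.biUnion K
            · rw [Finset.insert_eq_of_mem h]; omega
            · rw [Finset.sum_insert h]
          have := hmono h1
          omega
        have hTC : ∀ C ∈ 𝒞, Disjoint C T := fun C hC' => (hC C hC').2.2.2.mono_right hTB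
        have hX'S : X ∪ T ⊆ S := Finset.union_subset hXS (hTB.trans hBS)
        have hX'c : ∑ x ∈ X ∪ T, c x ≤ 25 * τ := by
          have := Finset.sum_union_inter (s₁ := X) (s₂ := T) (f := c)
          omega
        have hβsub : β (X ∪ T) ⊆ B.erase v := by
          intro x hx
          refine Finset.mem_erase.2 ⟨?_, βmono _ _ hXS hX'S hX'c Finset.subset_union_left hx⟩
          rintro rfl
          exact (Finset.mem_sdiff.1 (βsub _ hx)).2 (Finset.mem_union_right _ hvT)
        have hβcard : (β (X ∪ T)).card + 1 ≤ B.card := by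
          have := Finset.card_le_card hβsub
          rw [Finset.card_erase_of_mem hvB] at this
          have : 0 < B.card := Finset.card_pos.2 ⟨v, hvB⟩
          omega
        refine ih _ ?_ (insert T 𝒞) (X ∪ T) rfl ?_ ?_ ?_
        · have := Finset.card_insert_le T 𝒞
          omega
        · intro D hD
          rcases Finset.mem_insert.1 hD with rfl | hD
          · refine ⟨hTB.trans hBS, hTconn, (hmono Finset.inter_subset_right).trans hTc, ?_⟩
            refine Finset.disjoint_left.2 fun x hx hx' => ?_
            exact (Finset.mem_sdiff.1 (βsub _ hx')).2 (Finset.mem_union_right _ hx)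
          · have hD' := hC D hD
            refine ⟨hD'.1, hD'.2.1, ?_, ?_⟩
            · have : (X ∪ T) ∩ D = X ∩ D := by
                rw [Finset.union_inter_distrib_right,
                  Finset.disjoint_iff_inter_eq_empty.1 (hTC D hD).symm, Finset.union_empty]
              rw [this]; exact hD'.2.2.1
            · exact hD'.2.2.2.mono_right (hβsub.trans (Finset.erase_subset _ _))
        · have hTD : ∀ D ∈ 𝒞, ∃ u ∈ D, ∃ v ∈ T, adj u v := by
            intro D hD
            obtain ⟨a, haK, ha⟩ := hKA D hD
            obtain ⟨-, u, hu, hua⟩ := Finset.mem_filter.1 ha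
            exact ⟨u, hu, a, hKT D hD haK, hua⟩
          intro D hD E hE hne
          rcases Finset.mem_insert.1 hD with hD | hD
          · rcases Finset.mem_insert.1 hE with hE | hE
            · exact absurd (hD.trans hE.symm) hne
            · subst hD
              obtain ⟨u, hu, v, hv, h⟩ := hTD E hE
              exact ⟨(hTC E hE).symm, v, hv, u, hu, hsymm _ _ h⟩
          · rcases Finset.mem_insert.1 hE with hE | hE
            · subst hE
              exact ⟨hTC D hD, hTD D hD⟩
            · exact hCD D hD E hE hne
        · rw [Finset.biUnion_insert]
          exact Finset.union_subset (hX.trans Finset.subset_union_right) Finset.subset_union_left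
      · push Not at hcase2
        have hlay : ∀ C ∈ 𝒞, _ := fun C hC' =>
          layer hsymm c hBconn (Finset.filter_subset (fun v => ∃ u ∈ C, adj u v) B)
            (hAne C hC') τ (by omega)
        choose! I Zf hIB hZB hAIZ hIZ hZc hIw using hlay
        set Z := 𝒞.biUnion Zf with hZ
        have hZsub : Z ⊆ B := Finset.biUnion_subset.2 hZB
        have hZcost : ∑ x ∈ Z, c x ≤ 4 * τ := by
          have h1 : ∀ C ∈ 𝒞, ∑ x ∈ Zf C, c x ≤ τ := by
            intro C hC'
            have h2 := hZc C hC'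
            have h3 : ∑ v ∈ B, c v ^ 2 ≤ ∑ v ∈ S, c v ^ 2 := Finset.sum_le_sum_of_subset hBS
            have h4 : τ * ∑ v ∈ Zf C, c v ≤ τ * τ := h2.trans (h3.trans hτ2)
            exact Nat.le_of_mul_le_mul_left h4 (by omega)
          calc _ ≤ ∑ C ∈ 𝒞, ∑ x ∈ Zf C, c x := sum_biUnion_le_nat
            _ ≤ ∑ C ∈ 𝒞, τ := Finset.sum_le_sum h1
            _ = 𝒞.card * τ := by simp
            _ ≤ 4 * τ := Nat.mul_le_mul_right _ hcard
        have hXZS : X ∪ Z ⊆ S := Finset.union_subset hXS (hZsub.trans hBS)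
        have hXZc : ∑ x ∈ X ∪ Z, c x ≤ 25 * τ := by
          have := Finset.sum_union_inter (s₁ := X) (s₂ := Z) (f := c)
          omega
        set B' := β (X ∪ Z) with hB'
        have hB'conn := βconn _ hXZS hXZc
        have hB'B : B' ⊆ B := βmono _ _ hXS hXZS hXZc Finset.subset_union_left
        have hB'Z : ∀ x ∈ B', x ∉ Z := fun x hx hxZ =>
          (Finset.mem_sdiff.1 (βsub _ hx)).2 (Finset.mem_union_right _ hxZ)
        obtain ⟨v, hv⟩ := hB'conn.1
        obtain ⟨C, hC', hCv⟩ := hcase2 v (hB'B hv)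
        have hvI : v ∉ I C := by
          intro hvI
          obtain ⟨K, h1, h2, h3, ⟨a, h4, h4'⟩, h5⟩ := hIw C hC' v hvI
          exact absurd h5 (not_le.2 (hCv K h1 h2 h3 ⟨a, h4, h4'⟩))
        have hB'I : ∀ x ∈ B', x ∉ I C := by
          intro x hx hxI
          have : B' ⊆ I C := by
            refine hB'conn.subset_of_closed ⟨x, hx, hxI⟩ fun u hu hu' y hy huy => ?_
            rcases Finset.mem_union.1 (hIZ C hC' u hu y (hB'B hy) huy) with h | h
            · exact h
            · exact absurd (Finset.mem_biUnion.2 ⟨C, hC', h⟩) (hB'Z y hy)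
          exact hvI (this hv)
        have hB'A : ∀ x ∈ B', x ∉ A C := by
          intro x hx hxA
          rcases Finset.mem_union.1 (hAIZ C hC' hxA) with h | h
          · exact hB'I x hx h
          · exact hB'Z x hx (Finset.mem_biUnion.2 ⟨C, hC', h⟩)
        obtain ⟨hCS, hCconn, hCc, hCB⟩ := hC C hC'
        set fm := (C ∪ (B \ B')).powerset.filter (fun K => Conn adj K ∧ C ⊆ K) with hfm
        set C1 := fm.biUnion id with hC1
        have hfmem : ∀ K, K ∈ fm ↔ K ⊆ C ∪ (B \ B') ∧ Conn adj K ∧ C ⊆ K := by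
          intro K; simp only [hfm, Finset.mem_filter, Finset.mem_powerset]
        have hCfm : C ∈ fm := (hfmem C).2 ⟨Finset.subset_union_left, hCconn, subset_rfl⟩
        have hCC1 : C ⊆ C1 := Finset.subset_biUnion_of_mem id hCfm
        have hC1conn : Conn adj C1 := by
          refine conn_biUnion ⟨C, hCfm⟩ (fun K hK => ((hfmem K).1 hK).2.1) fun K hK K' hK' => ?_
          obtain ⟨x, hx⟩ := hCconn.1
          exact ⟨x, ((hfmem K).1 hK).2.2 hx, ((hfmem K').1 hK').2.2 hx⟩
        have hC1sub : C1 ⊆ C ∪ (B \ B') := Finset.biUnion_subset.2 fun K hK => ((hfmem K).1 hK).1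
        have hC1adj : ∀ u ∈ C1, ∀ y ∈ B \ B', adj u y → y ∈ C1 := by
          intro u hu y hy huy
          have : insert y C1 ∈ fm := (hfmem _).2 ⟨Finset.insert_subset
            (Finset.mem_union_right _ hy) hC1sub, hC1conn.insert_adj hsymm hu huy,
            hCC1.trans (Finset.subset_insert _ _)⟩
          exact Finset.mem_biUnion.2 ⟨_, this, Finset.mem_insert_self _ _⟩
        have hC1B' : ∀ x ∈ B', x ∉ C1 := by
          intro x hx hx1
          rcases Finset.mem_union.1 (hC1sub hx1) with h | h
          · exact Finset.disjoint_left.1 hCB h (hB'B hx)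
          · exact (Finset.mem_sdiff.1 h).2 hx
        set X1 := (X \ C) ∪ (Z ∩ C1) with hX1
        have hX1S : X1 ⊆ S := Finset.union_subset (Finset.sdiff_subset.trans hXS)
          (Finset.inter_subset_left.trans (hZsub.trans hBS))
        have hX1c : ∑ x ∈ X1, c x ≤ 25 * τ := by
          refine (hmono (B := X ∪ Z) ?_).trans hXZc
          exact Finset.union_subset_union Finset.sdiff_subset Finset.inter_subset_left
        have hB'sub : B' ⊆ β X1 := by
          refine heavy_sub X1 B' ?_ hB'conn (βheavy _ hXZS hXZc)
          intro x hx
          refine Finset.mem_sdiff.2 ⟨hBS (hB'B hx), fun hx1 => ?_⟩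
          rcases Finset.mem_union.1 hx1 with h | h
          · exact hBX x (hB'B hx) (Finset.mem_sdiff.1 h).1
          · exact hB'Z x hx (Finset.mem_inter.1 h).1
        have hβX1 : β X1 ⊆ B \ C1 := by
          refine (βconn X1 hX1S hX1c).subset_of_closed
            ⟨v, hB'sub hv, Finset.mem_sdiff.2 ⟨hB'B hv, hC1B' v hv⟩⟩ ?_
          intro u hu _ y hy huy
          obtain ⟨huB, huC1⟩ := Finset.mem_sdiff.1 hu
          obtain ⟨hyS, hyX1⟩ := Finset.mem_sdiff.1 (βsub _ hy)
          have hyB : y ∈ B := by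
            by_cases hyX : y ∈ X
            · exfalso
              have hyC : y ∈ C := by
                by_contra h
                exact hyX1 (Finset.mem_union_left _ (Finset.mem_sdiff.2 ⟨hyX, h⟩))
              have huA : u ∈ A C := Finset.mem_filter.2 ⟨huB, y, hyC, hsymm _ _ huy⟩
              have huB' : u ∉ B' := fun h => hB'A u h huA
              exact huC1 (hC1adj y (hCC1 hyC) u (Finset.mem_sdiff.2 ⟨huB, huB'⟩) (hsymm _ _ huy))
            · exact βadj X hXS hXc' u huB y hyS hyX huy
          refine Finset.mem_sdiff.2 ⟨hyB, fun hyC1 => ?_⟩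
          by_cases huB' : u ∈ B'
          · have hyB' : y ∉ B' := fun h => hC1B' y h hyC1
            have hyZ : y ∈ Z := by
              by_contra h
              refine hyB' (βadj _ hXZS hXZc u huB' y hyS ?_ huy)
              intro h'
              rcases Finset.mem_union.1 h' with h' | h'
              · exact hBX y hyB h'
              · exact h h'
            exact hyX1 (Finset.mem_union_right _ (Finset.mem_inter.2 ⟨hyZ, hyC1⟩))
          · exact huC1 (hC1adj y hyC1 u (Finset.mem_sdiff.2 ⟨huB, huB'⟩) (hsymm _ _ huy))
        obtain ⟨a, ha⟩ := hAne C hC'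
        obtain ⟨haB, u, huC, hua⟩ := Finset.mem_filter.1 ha
        have haB' : a ∉ B' := fun h => hB'A a h ha
        have haC1 : a ∈ C1 := hC1adj u (hCC1 huC) a (Finset.mem_sdiff.2 ⟨haB, haB'⟩) hua
        have hβcard : (β X1).card + 1 ≤ B.card := by
          have h1 : β X1 ⊆ B.erase a := fun x hx => by
            have := Finset.mem_sdiff.1 (hβX1 hx)
            refine Finset.mem_erase.2 ⟨?_, this.1⟩
            rintro rfl; exact this.2 haC1
          have := Finset.card_le_card h1
          rw [Finset.card_erase_of_mem haB] at this
          have : 0 < B.card := Finset.card_pos.2 ⟨a, haB⟩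
          omega
        have hC1D : ∀ D ∈ 𝒞.erase C, Disjoint C1 D := by
          intro D hD
          obtain ⟨hne, hD'⟩ := Finset.mem_erase.1 hD
          refine Finset.disjoint_left.2 fun x hx hxD => ?_
          rcases Finset.mem_union.1 (hC1sub hx) with h | h
          · exact Finset.disjoint_left.1 (hCD D hD' C hC' hne).1 hxD h
          · exact Finset.disjoint_left.1 (hC D hD').2.2.2 hxD (Finset.mem_sdiff.1 h).1
        have hC1Dadj : ∀ D ∈ 𝒞.erase C, ∃ u ∈ C1, ∃ v ∈ D, adj u v := by
          intro D hD
          obtain ⟨hne, hD'⟩ := Finset.mem_erase.1 hD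
          obtain ⟨u, hu, v, hv, h⟩ := (hCD C hC' D hD' hne.symm).2
          exact ⟨u, hCC1 hu, v, hv, h⟩
        refine ih _ ?_ (insert C1 (𝒞.erase C)) X1 rfl ?_ ?_ ?_
        · have h1 := Finset.card_insert_le C1 (𝒞.erase C)
          have h2 := Finset.card_erase_le (s := 𝒞) (a := C)
          omega
        · intro D hD
          rcases Finset.mem_insert.1 hD with hD | hD
          · subst hD
            refine ⟨?_, hC1conn, ?_, ?_⟩
            · exact hC1sub.trans (Finset.union_subset hCS (Finset.sdiff_subset.trans hBS))
            · have : X1 ∩ C1 ⊆ Z := by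
                intro x hx
                obtain ⟨hx1, hx2⟩ := Finset.mem_inter.1 hx
                rcases Finset.mem_union.1 hx1 with h | h
                · exfalso
                  obtain ⟨hxX, hxC⟩ := Finset.mem_sdiff.1 h
                  rcases Finset.mem_union.1 (hC1sub hx2) with h | h
                  · exact hxC h
                  · exact hBX x (Finset.mem_sdiff.1 h).1 hxX
                · exact (Finset.mem_inter.1 h).1
              have := hmono this
              omega
            · refine Finset.disjoint_left.2 fun x hx hx' => ?_
              exact (Finset.mem_sdiff.1 (hβX1 hx')).2 hx
          · obtain ⟨hne, hD'⟩ := Finset.mem_erase.1 hD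
            obtain ⟨h1, h2, h3, h4⟩ := hC D hD'
            refine ⟨h1, h2, (hmono ?_).trans h3, h4.mono_right (hβX1.trans Finset.sdiff_subset)⟩
            intro x hx
            obtain ⟨hx1, hx2⟩ := Finset.mem_inter.1 hx
            rcases Finset.mem_union.1 hx1 with h | h
            · exact Finset.mem_inter.2 ⟨(Finset.mem_sdiff.1 h).1, hx2⟩
            · exact absurd hx2 (Finset.disjoint_left.1 (hC1D D hD) (Finset.mem_inter.1 h).2)
        · intro D hD E hE hne
          rcases Finset.mem_insert.1 hD with hD | hD
          · rcases Finset.mem_insert.1 hE with hE | hE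
            · exact absurd (hD.trans hE.symm) hne
            · subst hD
              exact ⟨hC1D E hE, hC1Dadj E hE⟩
          · rcases Finset.mem_insert.1 hE with hE | hE
            · subst hE
              obtain ⟨u, hu, v, hv, h⟩ := hC1Dadj D hD
              exact ⟨(hC1D D hD).symm, v, hv, u, hu, hsymm _ _ h⟩
            · exact hCD D (Finset.mem_of_mem_erase hD) E (Finset.mem_of_mem_erase hE) hne
        · intro x hx
          rcases Finset.mem_union.1 hx with h | h
          · obtain ⟨hxX, hxC⟩ := Finset.mem_sdiff.1 h
            obtain ⟨D, hD, hxD⟩ := Finset.mem_biUnion.1 (hX hxX)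
            refine Finset.mem_biUnion.2 ⟨D, Finset.mem_insert_of_mem (Finset.mem_erase.2 ⟨?_, hD⟩), hxD⟩
            rintro rfl; exact hxC hxD
          · exact Finset.mem_biUnion.2 ⟨C1, Finset.mem_insert_self _ _, (Finset.mem_inter.1 h).2⟩
  exact main _ ∅ ∅ rfl (by simp) (by simp) (by simp)

end Separator

end

section
section Division
variable {α : Type*} {adj : α → α → Prop}

/-- Components of a finite set. -/
noncomputable def comps (adj : α → α → Prop) (S : Finset α) : Finset (Finset α) :=
  S.powerset.filter (fun K => Conn adj K ∧
    ∀ K' ⊆ S, Conn adj K' → (∃ x ∈ K, x ∈ K') → K' ⊆ K)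

lemma mem_comps {S K : Finset α} : K ∈ comps adj S ↔ K ⊆ S ∧ Conn adj K ∧
    ∀ K' ⊆ S, Conn adj K' → (∃ x ∈ K, x ∈ K') → K' ⊆ K := by
  simp [comps]

lemma conn_subset_comp {S L : Finset α} (hL : L ⊆ S) (hc : Conn adj L) :
    ∃ K ∈ comps adj S, L ⊆ K := by
  set fam := S.powerset.filter (fun K => Conn adj K ∧ L ⊆ K) with hfam
  have hm : ∀ K, K ∈ fam ↔ K ⊆ S ∧ Conn adj K ∧ L ⊆ K := by intro K; simp [hfam]
  obtain ⟨x, hx⟩ := hc.1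
  have hconn : Conn adj (fam.biUnion id) :=
    conn_biUnion ⟨L, (hm L).2 ⟨hL, hc, subset_rfl⟩⟩ (fun K hK => ((hm K).1 hK).2.1)
      (fun K hK K' hK' => ⟨x, ((hm K).1 hK).2.2 hx, ((hm K').1 hK').2.2 hx⟩)
  have hLs : L ⊆ fam.biUnion id := Finset.subset_biUnion_of_mem id ((hm L).2 ⟨hL, hc, subset_rfl⟩)
  have hsub : fam.biUnion id ⊆ S := Finset.biUnion_subset.2 fun K hK => ((hm K).1 hK).1
  refine ⟨fam.biUnion id, mem_comps.2 ⟨hsub, hconn, ?_⟩, hLs⟩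
  rintro K' hK' hK'c ⟨y, hy, hy'⟩
  have hU : Conn adj (({fam.biUnion id, K'} : Finset (Finset α)).biUnion id) := by
    refine conn_biUnion ⟨K', by simp⟩ ?_ ?_
    · intro K hK
      rcases Finset.mem_insert.1 hK with h | h
      · rw [h]; exact hconn
      · rw [Finset.mem_singleton.1 h]; exact hK'c
    · intro A hA B hB
      have : ∀ A ∈ ({fam.biUnion id, K'} : Finset (Finset α)), y ∈ A := by
        intro K hK
        rcases Finset.mem_insert.1 hK with h | h
        · rw [h]; exact hy
        · rw [Finset.mem_singleton.1 h]; exact hy'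
      exact ⟨y, this A hA, this B hB⟩
  have hKU : K' ⊆ ({fam.biUnion id, K'} : Finset (Finset α)).biUnion id :=
    Finset.subset_biUnion_of_mem id (by simp)
  have hLU : fam.biUnion id ⊆ ({fam.biUnion id, K'} : Finset (Finset α)).biUnion id :=
    Finset.subset_biUnion_of_mem id (Finset.mem_insert_self _ _)
  refine hKU.trans (Finset.subset_biUnion_of_mem id ((hm _).2 ⟨?_, hU, hLs.trans hLU⟩))
  refine Finset.biUnion_subset.2 fun K hK => ?_
  rcases Finset.mem_insert.1 hK with h | h
  · rw [h]; exact hsub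
  · rw [Finset.mem_singleton.1 h]; exact hK'

lemma comps_disjoint {S K K' : Finset α} (hK : K ∈ comps adj S) (hK' : K' ∈ comps adj S)
    (hne : K ≠ K') : Disjoint K K' := by
  refine Finset.disjoint_left.2 fun x hx hx' => hne ?_
  have h := mem_comps.1 hK
  have h' := mem_comps.1 hK'
  exact Finset.Subset.antisymm (h'.2.2 K h.1 h.2.1 ⟨x, hx', hx⟩) (h.2.2 K' h'.1 h'.2.1 ⟨x, hx, hx'⟩)

lemma sum_comps_le {S S' : Finset α} (hS : S' ⊆ S) (μ : α → ℝ) (hμ : ∀ v, 0 ≤ μ v) :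
    ∑ K ∈ comps adj S', ∑ v ∈ K, μ v ≤ ∑ v ∈ S, μ v := by
  have := Finset.sum_biUnion (s := comps adj S') (t := id) (f := μ)
    (fun K hK K' hK' hne => comps_disjoint hK hK' hne)
  simp only [id] at this
  rw [← this]
  refine Finset.sum_le_sum_of_subset_of_nonneg ?_ fun i _ _ => hμ i
  exact (Finset.biUnion_subset.2 fun K hK => (mem_comps.1 hK).1).trans hS

theorem division (hsymm : ∀ u v, adj u v → adj v u) (hK5 : NoK5 adj) (c : α → ℕ) (μ : α → ℝ)
    (hμ : ∀ v, (c v : ℝ) ^ 2 ≤ μ v) (T : ℝ) (hT : 1 ≤ T) (S : Finset α) :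
    ∃ X ⊆ S, ((∑ v ∈ X, c v : ℕ) : ℝ) ≤ 300 * (∑ v ∈ S, μ v) / √T ∧
      ∀ K ⊆ S \ X, Conn adj K → ∑ v ∈ K, μ v ≤ T := by
  have hμ0 : ∀ v, 0 ≤ μ v := fun v => (sq_nonneg _).trans (hμ v)
  have hsT : 0 < √T := Real.sqrt_pos.2 (by linarith)
  have key : ∀ n : ℕ, ∀ S : Finset α, S.card = n →
      ∃ X ⊆ S, ((∑ v ∈ X, c v : ℕ) : ℝ) ≤ (if ∑ v ∈ S, μ v ≤ T then 0 else
        300 * (∑ v ∈ S, μ v) / √T - 150 * √(∑ v ∈ S, μ v)) ∧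
      ∀ K ⊆ S \ X, Conn adj K → ∑ v ∈ K, μ v ≤ T := by
    intro n
    induction n using Nat.strong_induction_on with
    | _ n ih =>
    intro S hS
    by_cases hsm : ∑ v ∈ S, μ v ≤ T
    · refine ⟨∅, by simp, by simp [hsm], fun K hK _ => le_trans ?_ hsm⟩
      refine Finset.sum_le_sum_of_subset_of_nonneg ?_ fun i _ _ => hμ0 i
      simpa using hK
    · obtain ⟨X0, hX0, hcost, hhalf⟩ := separator hsymm hK5 c μ hμ0 S
      set x := ∑ v ∈ S, μ v with hx
      have hxT : T < x := not_le.1 hsm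
      have hx1 : 1 < x := by linarith
      have hrec : ∀ K ∈ comps adj (S \ X0), ∃ X ⊆ K, ((∑ v ∈ X, c v : ℕ) : ℝ) ≤
          (if ∑ v ∈ K, μ v ≤ T then 0 else
          300 * (∑ v ∈ K, μ v) / √T - 150 * √(∑ v ∈ K, μ v)) ∧
          ∀ L ⊆ K \ X, Conn adj L → ∑ v ∈ L, μ v ≤ T := by
        intro K hK
        obtain ⟨h1, h2, -⟩ := mem_comps.1 hK
        have h3 := hhalf K h1 h2
        refine ih K.card ?_ K rfl
        rw [← hS]
        refine Finset.card_lt_card ⟨h1.trans Finset.sdiff_subset, fun h => ?_⟩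
        have : K = S := Finset.Subset.antisymm (h1.trans Finset.sdiff_subset) h
        rw [this] at h3
        linarith
      choose! Y hYK hYc hYL using hrec
      refine ⟨X0 ∪ (comps adj (S \ X0)).biUnion Y, ?_, ?_, ?_⟩
      · refine Finset.union_subset hX0 (Finset.biUnion_subset.2 fun K hK => ?_)
        exact (hYK K hK).trans ((mem_comps.1 hK).1.trans Finset.sdiff_subset)
      · rw [if_neg hsm]
        have h1 : ∑ v ∈ X0 ∪ (comps adj (S \ X0)).biUnion Y, c v ≤
            ∑ v ∈ X0, c v + ∑ K ∈ comps adj (S \ X0), ∑ v ∈ Y K, c v := by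
          have := Finset.sum_union_inter (s₁ := X0) (s₂ := (comps adj (S \ X0)).biUnion Y) (f := c)
          have := sum_biUnion_le_nat (s := comps adj (S \ X0)) (t := Y) (f := c)
          omega
        have h1' : ((∑ v ∈ X0 ∪ (comps adj (S \ X0)).biUnion Y, c v : ℕ) : ℝ) ≤
            ((∑ v ∈ X0, c v : ℕ) : ℝ) + ∑ K ∈ comps adj (S \ X0), ((∑ v ∈ Y K, c v : ℕ) : ℝ) := by
          exact_mod_cast h1
        have hsx1 : 1 ≤ √x := by rw [Real.one_le_sqrt]; exact hx1.le
        have hsxx : √x * √x = x := Real.mul_self_sqrt (by linarith)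
        have h2 : ((∑ v ∈ X0, c v : ℕ) : ℝ) ≤ 50 * √x := by
          have h3 : ((∑ v ∈ X0, c v : ℕ) : ℝ) ≤ 25 * ((Nat.sqrt (∑ v ∈ S, c v ^ 2) : ℕ) + 1) := by
            exact_mod_cast hcost
          have h4 : ((Nat.sqrt (∑ v ∈ S, c v ^ 2) : ℕ) : ℝ) ≤ √x := by
            refine Real.le_sqrt_of_sq_le ?_
            calc ((Nat.sqrt (∑ v ∈ S, c v ^ 2) : ℕ) : ℝ) ^ 2 ≤ ((∑ v ∈ S, c v ^ 2 : ℕ) : ℝ) := by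
                  exact_mod_cast Nat.sqrt_le' _
              _ = ∑ v ∈ S, (c v : ℝ) ^ 2 := by push_cast; rfl
              _ ≤ x := Finset.sum_le_sum fun v _ => hμ v
          linarith
        have hsTx : √T ≤ √x := Real.sqrt_le_sqrt hxT.le
        set A := 300 / √T - 210 / √x with hA
        have hA0 : 0 ≤ A := by
          rw [hA, sub_nonneg, div_le_div_iff₀ (by linarith) hsT]
          linarith
        have h3 : ∀ K ∈ comps adj (S \ X0), ((∑ v ∈ Y K, c v : ℕ) : ℝ) ≤ A * ∑ v ∈ K, μ v := by
          intro K hK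
          have hy0 : 0 ≤ ∑ v ∈ K, μ v := Finset.sum_nonneg fun v _ => hμ0 v
          have hh := hhalf K (mem_comps.1 hK).1 (mem_comps.1 hK).2.1
          refine (hYc K hK).trans ?_
          set y := ∑ v ∈ K, μ v
          split_ifs with h
          · positivity
          · have h5 : 1.4 * y / √x ≤ √y := by
              refine Real.le_sqrt_of_sq_le ?_
              rw [div_pow, Real.sq_sqrt (by linarith), div_le_iff₀ (by linarith)]
              nlinarith
            have : A * y = 300 * y / √T - 150 * (1.4 * y / √x) := by rw [hA]; ring
            rw [this]; linarith
        have h4 : ∑ K ∈ comps adj (S \ X0), ((∑ v ∈ Y K, c v : ℕ) : ℝ) ≤ A * x := by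
          refine (Finset.sum_le_sum h3).trans ?_
          rw [← Finset.mul_sum]
          exact mul_le_mul_of_nonneg_left (sum_comps_le Finset.sdiff_subset μ hμ0) hA0
        have h5 : A * x = 300 * x / √T - 210 * √x := by
          rw [hA, sub_mul]
          congr 1
          · ring
          · rw [div_mul_eq_mul_div, div_eq_iff (by positivity)]
            rw [mul_assoc, hsxx]
        linarith
      · intro L hL hLc
        have hL0 : L ⊆ S \ X0 := hL.trans (Finset.sdiff_subset_sdiff subset_rfl Finset.subset_union_left)
        obtain ⟨K, hK, hLK⟩ := conn_subset_comp hL0 hLc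
        refine hYL K hK L (fun v hv => Finset.mem_sdiff.2 ⟨hLK hv, fun hvY => ?_⟩) hLc
        exact (Finset.mem_sdiff.1 (hL hv)).2
          (Finset.mem_union_right _ (Finset.mem_biUnion.2 ⟨K, hK, hvY⟩))
  obtain ⟨X, h1, h2, h3⟩ := key _ S rfl
  refine ⟨X, h1, h2.trans ?_, h3⟩
  have : 0 ≤ ∑ v ∈ S, μ v := Finset.sum_nonneg fun v _ => hμ0 v
  split_ifs
  · positivity
  · have := Real.sqrt_nonneg (∑ v ∈ S, μ v)
    linarith

end Division

end

section
section Plane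
variable {ι : Type*}

/-- Consecutive vertices along a curve. -/
def cadj (f : ι → ℝ → ℝ × ℝ) (V : Finset (ℝ × ℝ)) (u v : ℝ × ℝ) : Prop :=
  u ∈ V ∧ v ∈ V ∧ ∃ i, ∃ a ∈ Set.Icc (0:ℝ) 1, ∃ b ∈ Set.Icc (0:ℝ) 1, a < b ∧
    ((f i a = u ∧ f i b = v) ∨ (f i a = v ∧ f i b = u)) ∧ ∀ t ∈ Set.Ioo a b, f i t ∉ V

lemma cadj_symm (f : ι → ℝ → ℝ × ℝ) (V : Finset (ℝ × ℝ)) (u v : ℝ × ℝ) (h : cadj f V u v) :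
    cadj f V v u := by
  obtain ⟨h1, h2, i, a, ha, b, hb, hab, h, h3⟩ := h
  exact ⟨h2, h1, i, a, ha, b, hb, hab, h.symm, h3⟩

/-- The region drawn by a vertex set. -/
def region (f : ι → ℝ → ℝ × ℝ) (V S : Finset (ℝ × ℝ)) : Set (ℝ × ℝ) :=
  {x | x ∈ S ∨ ∃ i, ∃ a ∈ Set.Icc (0:ℝ) 1, ∃ b ∈ Set.Icc (0:ℝ) 1,
    f i a ∈ S ∧ f i b ∈ S ∧ (∀ t ∈ Set.Ioo a b, f i t ∉ V) ∧ ∃ t ∈ Set.Ioo a b, x = f i t}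

lemma region_mono (f : ι → ℝ → ℝ × ℝ) (V : Finset (ℝ × ℝ)) {S S' : Finset (ℝ × ℝ)} (h : S ⊆ S') :
    region f V S ⊆ region f V S' := by
  rintro x (hx | ⟨i, a, ha, b, hb, h1, h2, h3⟩)
  · exact Or.inl (h hx)
  · exact Or.inr ⟨i, a, ha, b, hb, h h1, h h2, h3⟩

lemma region_disjoint (f : ι → ℝ → ℝ × ℝ) (hinj : ∀ i, Set.InjOn (f i) (Set.Icc 0 1))
    (V : Finset (ℝ × ℝ))
    (hV : ∀ i j, i ≠ j → ∀ s ∈ Set.Icc (0:ℝ) 1, ∀ t ∈ Set.Icc (0:ℝ) 1, f i s = f j t → f i s ∈ V)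
    {S S' : Finset (ℝ × ℝ)} (hS : S ⊆ V) (hS' : S' ⊆ V) (hd : Disjoint S S') (x : ℝ × ℝ)
    (h1 : x ∈ region f V S) (h2 : x ∈ region f V S') : False := by
  rcases h1 with h1 | ⟨i, a, ha, b, hb, hfa, hfb, hab, t, ht, hx⟩
  · rcases h2 with h2 | ⟨j, a', ha', b', hb', hfa', hfb', hab', t', ht', hx'⟩
    · exact Finset.disjoint_left.1 hd h1 h2
    · exact hab' t' ht' (hx' ▸ hS h1)
  · rcases h2 with h2 | ⟨j, a', ha', b', hb', hfa', hfb', hab', t', ht', hx'⟩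
    · exact hab t ht (hx ▸ hS' h2)
    · have htI : t ∈ Set.Icc (0:ℝ) 1 := ⟨ha.1.trans ht.1.le, ht.2.le.trans hb.2⟩
      have htI' : t' ∈ Set.Icc (0:ℝ) 1 := ⟨ha'.1.trans ht'.1.le, ht'.2.le.trans hb'.2⟩
      by_cases hij : i = j
      · subst hij
        have htt : t = t' := hinj i htI htI' (hx.symm.trans hx')
        subst htt
        have e1 : a ≤ a' := by
          by_contra h
          exact hab' a ⟨not_le.1 h, ht.1.trans ht'.2⟩ (hS hfa)
        have e2 : a' ≤ a := by
          by_contra h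
          exact hab a' ⟨not_le.1 h, ht'.1.trans ht.2⟩ (hS' hfa')
        have e3 : a = a' := le_antisymm e1 e2
        subst e3
        exact Finset.disjoint_left.1 hd hfa hfa'
      · exact hab t ht (hV i j hij t htI t' htI' (hx.symm.trans hx'))

lemma joined_edge (f : ι → ℝ → ℝ × ℝ) (hc : ∀ i, Continuous (f i)) (V S : Finset (ℝ × ℝ))
    {u v : ℝ × ℝ} (hu : u ∈ S) (hv : v ∈ S) (h : cadj f V u v) : JoinedIn (region f V S) u v := by
  obtain ⟨-, -, i, a, ha, b, hb, hab, h, h3⟩ := h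
  have hfa : f i a ∈ S := by rcases h with h | h <;> rw [h.1] <;> assumption
  have hfb : f i b ∈ S := by rcases h with h | h <;> rw [h.2] <;> assumption
  have hpc : IsPathConnected (f i '' Set.Icc a b) :=
    ((convex_Icc a b).isPathConnected ⟨a, by simp [hab.le]⟩).image (hc i)
  have hsub : f i '' Set.Icc a b ⊆ region f V S := by
    rintro x ⟨t, ht, rfl⟩
    rcases eq_or_lt_of_le ht.1 with h1 | h1
    · rw [← h1]; exact Or.inl hfa
    · rcases eq_or_lt_of_le ht.2 with h2 | h2
      · rw [h2]; exact Or.inl hfb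
      · exact Or.inr ⟨i, a, ha, b, hb, hfa, hfb, h3, t, ⟨h1, h2⟩, rfl⟩
  have ma : f i a ∈ f i '' Set.Icc a b := ⟨a, by simp [hab.le], rfl⟩
  have mb : f i b ∈ f i '' Set.Icc a b := ⟨b, by simp [hab.le], rfl⟩
  rcases h with h | h
  · rw [← h.1, ← h.2]; exact (hpc.joinedIn _ ma _ mb).mono hsub
  · rw [← h.1, ← h.2]; exact (hpc.joinedIn _ mb _ ma).mono hsub

lemma joined_conn (f : ι → ℝ → ℝ × ℝ) (hc : ∀ i, Continuous (f i)) (V S : Finset (ℝ × ℝ))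
    (hS : Conn (cadj f V) S) {u v : ℝ × ℝ} (hu : u ∈ S) (hv : v ∈ S) :
    JoinedIn (region f V S) u v := by
  have := hS.2 (S.filter (fun v => JoinedIn (region f V S) u v)) (Finset.filter_subset _ _)
    ⟨u, by simp [hu]; exact JoinedIn.refl (Or.inl hu)⟩ (by
      intro x hx y hy hxy
      rw [Finset.mem_filter] at hx ⊢
      exact ⟨hy, hx.2.trans (joined_edge f hc V S hx.1 hy hxy)⟩)
  rw [← this] at hv
  exact (Finset.mem_filter.1 hv).2

theorem noK5_cadj (f : ι → ℝ → ℝ × ℝ) (hc : ∀ i, Continuous (f i))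
    (hinj : ∀ i, Set.InjOn (f i) (Set.Icc 0 1)) (V : Finset (ℝ × ℝ))
    (hV : ∀ i j, i ≠ j → ∀ s ∈ Set.Icc (0:ℝ) 1, ∀ t ∈ Set.Icc (0:ℝ) 1, f i s = f j t → f i s ∈ V) :
    NoK5 (cadj f V) := by
  intro B hB hdis hadj
  have hBV : ∀ i, B i ⊆ V := by
    intro i
    have := (hB i).2 ((B i).filter (fun v => v ∈ V)) (Finset.filter_subset _ _) (by
      obtain ⟨j, hj⟩ : ∃ j, i ≠ j := by
        by_cases h : i = 0
        · exact ⟨1, by rw [h]; decide⟩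
        · exact ⟨0, h⟩
      obtain ⟨u, hu, v, hv, h⟩ := hadj i j hj
      exact ⟨u, Finset.mem_filter.2 ⟨hu, h.1⟩⟩) (by
      intro u hu v hv huv
      exact Finset.mem_filter.2 ⟨hv, huv.2.1⟩)
    rw [← this]
    intro x hx
    exact (Finset.mem_filter.1 hx).2
  have hne : ∀ i, ∃ p, p ∈ B i := fun i => (hB i).1
  choose p hp using hne
  have hj : ∀ i j, i ≠ j → JoinedIn (region f V (B i ∪ B j)) (p i) (p j) := by
    intro i j hij
    obtain ⟨u, hu, v, hv, h⟩ := hadj i j hij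
    have h1 := (joined_conn f hc V _ (hB i) (hp i) hu).mono
      (region_mono f V (Finset.subset_union_left (s₂ := B j)))
    have h2 := (joined_conn f hc V _ (hB j) hv (hp j)).mono
      (region_mono f V (Finset.subset_union_right (s₁ := B i)))
    have h3 := joined_edge f hc V (B i ∪ B j) (Finset.mem_union_left _ hu)
      (Finset.mem_union_right _ hv) h
    exact (h1.trans h3).trans h2
  have hj' : ∀ i j, ∃ g : ℝ → ℝ × ℝ, i ≠ j → Continuous g ∧ g 0 = p i ∧ g 1 = p j ∧
      ∀ t, g t ∈ region f V (B i ∪ B j) := by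
    intro i j
    by_cases hij : i = j
    · exact ⟨fun _ => 0, fun h => absurd hij h⟩
    · obtain ⟨γ, hγ⟩ := hj i j hij
      refine ⟨γ.extend, fun _ => ⟨γ.continuous_extend, γ.extend_zero, γ.extend_one, fun t => ?_⟩⟩
      have : γ.extend t ∈ Set.range γ := by rw [← γ.extend_range]; exact ⟨t, rfl⟩
      obtain ⟨s, hs⟩ := this
      rw [← hs]; exact hγ s
  choose g hg using hj'
  set e := Complex.equivRealProdCLM.symm with he
  refine no_K5 (fun i => e (p i)) (fun i j t => e (g i j t)) ?_ ?_ ?_ ?_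
  · intro i j hij; exact e.continuous.comp (hg i j hij.ne).1
  · intro i j hij; simp only [(hg i j hij.ne).2.1]
  · intro i j hij; simp only [(hg i j hij.ne).2.2.1]
  · intro a b c d hab hcd h1 h2 h3 h4 s t hst
    have hst' := e.injective hst
    refine region_disjoint f hinj V hV (S := B a ∪ B b) (S' := B c ∪ B d)
      (Finset.union_subset (hBV _) (hBV _)) (Finset.union_subset (hBV _) (hBV _)) ?_ (g a b s)
      ((hg a b hab.ne).2.2.2 s) (hst' ▸ (hg c d hcd.ne).2.2.2 t)
    simp only [Finset.disjoint_union_left, Finset.disjoint_union_right]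
    exact ⟨⟨hdis _ _ h1, hdis _ _ h3⟩, ⟨hdis _ _ h2, hdis _ _ h4⟩⟩

lemma arc_conn (f : ι → ℝ → ℝ × ℝ) (V : Finset (ℝ × ℝ)) (i : ι) (K : Finset (ℝ × ℝ))
    (hK : K.Nonempty) (hKV : K ⊆ V) (θ : ℝ × ℝ → ℝ)
    (hθ : ∀ x ∈ K, θ x ∈ Set.Icc (0:ℝ) 1 ∧ f i (θ x) = x)
    (hinj : Set.InjOn (f i) (Set.Icc 0 1))
    (hconv : ∀ x ∈ K, ∀ y ∈ K, ∀ t ∈ Set.Ioo (θ x) (θ y), f i t ∈ V → f i t ∈ K) :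
    Conn (cadj f V) K := by
  refine ⟨hK, fun T hT hTne hcl => ?_⟩
  by_contra hTK
  obtain ⟨y0, hy0, hy0T⟩ : ∃ y ∈ K, y ∉ T := by
    by_contra h; push Not at h
    exact hTK (Finset.Subset.antisymm hT h)
  obtain ⟨x0, hx0⟩ := hTne
  obtain ⟨⟨x, y⟩, hxy, hmin⟩ := Finset.exists_min_image (T ×ˢ (K \ T))
    (fun p => |θ p.1 - θ p.2|) ⟨(x0, y0), by simp [hx0, hy0, hy0T]⟩
  obtain ⟨hx, hy⟩ := Finset.mem_product.1 hxy
  obtain ⟨hyK, hyT⟩ := Finset.mem_sdiff.1 hy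
  simp only at hx hyK hyT
  have hxK := hT hx
  have hθ' : ∀ t ∈ Set.Icc (0:ℝ) 1, f i t ∈ K → θ (f i t) = t := fun t ht htK =>
    hinj (hθ _ htK).1 ht (hθ _ htK).2
  have hne : θ x ≠ θ y := by
    intro h
    have h1 := (hθ x hxK).2
    rw [h, (hθ y hyK).2] at h1
    exact hyT (h1 ▸ hx)
  have hno : ∀ t ∈ Set.Icc (0:ℝ) 1, f i t ∈ K → |θ x - t| < |θ x - θ y| → |t - θ y| < |θ x - θ y| →
      False := by
    intro t ht htK h1 h2
    by_cases htT : f i t ∈ T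
    · have := hmin (f i t, y) (Finset.mem_product.2 ⟨htT, hy⟩)
      simp only [hθ' t ht htK] at this
      linarith
    · have := hmin (x, f i t) (Finset.mem_product.2 ⟨hx, Finset.mem_sdiff.2 ⟨htK, htT⟩⟩)
      simp only [hθ' t ht htK] at this
      linarith
  refine hyT (hcl x hx y hyK ⟨hKV hxK, hKV hyK, i, ?_⟩)
  rcases lt_or_gt_of_ne hne with h | h
  · refine ⟨θ x, (hθ x hxK).1, θ y, (hθ y hyK).1, h, Or.inl ⟨(hθ x hxK).2, (hθ y hyK).2⟩, ?_⟩
    intro t ht htV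
    refine hno t ⟨(hθ x hxK).1.1.trans ht.1.le, ht.2.le.trans (hθ y hyK).1.2⟩
      (hconv x hxK y hyK t ht htV) ?_ ?_
    · rw [abs_sub_comm, abs_of_pos (by linarith [ht.1]), abs_sub_comm, abs_of_pos (by linarith)]
      linarith [ht.2]
    · rw [abs_sub_comm, abs_of_pos (by linarith [ht.2]), abs_sub_comm, abs_of_pos (by linarith)]
      linarith [ht.1]
  · refine ⟨θ y, (hθ y hyK).1, θ x, (hθ x hxK).1, h, Or.inr ⟨(hθ y hyK).2, (hθ x hxK).2⟩, ?_⟩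
    intro t ht htV
    refine hno t ⟨(hθ y hyK).1.1.trans ht.1.le, ht.2.le.trans (hθ x hxK).1.2⟩
      (hconv y hyK x hxK t ht htV) ?_ ?_
    · rw [abs_of_pos (by linarith [ht.2]), abs_of_pos (by linarith)]
      linarith [ht.1]
    · rw [abs_of_pos (by linarith [ht.1]), abs_of_pos (by linarith)]
      linarith [ht.2]

end Plane

end

section
section Geometry

lemma lower_part (A : Finset ℝ) (s : ℕ) (h : s ≤ A.card) :
    ∃ B ⊆ A, B.card = s ∧ ∀ x ∈ B, ∀ y ∈ A, y ∉ B → x < y := by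
  induction s with
  | zero => exact ⟨∅, by simp, by simp, by simp⟩
  | succ s ih =>
    obtain ⟨B, hBA, hBc, hB⟩ := ih (by omega)
    have hne : (A \ B).Nonempty := by
      rw [← Finset.card_pos, Finset.card_sdiff_of_subset hBA]; omega
    have hm := Finset.mem_sdiff.1 ((A \ B).min'_mem hne)
    refine ⟨insert ((A \ B).min' hne) B, Finset.insert_subset hm.1 hBA, ?_, ?_⟩
    · rw [Finset.card_insert_of_notMem hm.2, hBc]
    · intro x hx y hy hyB
      rw [Finset.mem_insert, not_or] at hyB
      rcases Finset.mem_insert.1 hx with h | h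
      · rw [h]
        exact lt_of_le_of_ne ((A \ B).min'_le y (Finset.mem_sdiff.2 ⟨hy, hyB.2⟩)) (Ne.symm hyB.1)
      · exact hB x h y hy hyB.2

lemma cut_blocks (s : ℕ) (hs : 1 ≤ s) (A : Finset ℝ) :
    ∃ 𝓑 : Finset (Finset ℝ), A.card ≤ s * (𝓑.card + 1) ∧ (∀ b ∈ 𝓑, b ⊆ A ∧ b.card = s) ∧
      ∀ b ∈ 𝓑, ∀ b' ∈ 𝓑, b ≠ b' → (∀ x ∈ b, ∀ y ∈ b', x < y) ∨ (∀ x ∈ b, ∀ y ∈ b', y < x) := by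
  induction hn : A.card using Nat.strong_induction_on generalizing A with
  | _ n ih =>
  by_cases h : A.card < s
  · refine ⟨∅, ?_, by simp, by simp⟩
    simp; omega
  · obtain ⟨B, hBA, hBc, hB⟩ := lower_part A s (not_lt.1 h)
    have hcard : (A \ B).card = A.card - s := by rw [Finset.card_sdiff_of_subset hBA, hBc]
    obtain ⟨𝓑, h1, h2, h3⟩ := ih (A \ B).card (by omega) (A \ B) rfl
    have hlt : ∀ b ∈ 𝓑, ∀ x ∈ B, ∀ y ∈ b, x < y := by
      intro b hb x hx y hy
      have := Finset.mem_sdiff.1 ((h2 b hb).1 hy)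
      exact hB x hx y this.1 this.2
    have hBn : B ∉ 𝓑 := by
      intro hmem
      obtain ⟨x, hx⟩ : B.Nonempty := by rw [← Finset.card_pos]; omega
      exact lt_irrefl _ (hlt B hmem x hx x hx)
    refine ⟨insert B 𝓑, ?_, ?_, ?_⟩
    · rw [Finset.card_insert_of_notMem hBn]
      nlinarith [Nat.sub_add_cancel (not_lt.1 h)]
    · intro b hb
      rcases Finset.mem_insert.1 hb with rfl | hb
      · exact ⟨hBA, hBc⟩
      · exact ⟨(h2 b hb).1.trans Finset.sdiff_subset, (h2 b hb).2⟩
    · intro b hb b' hb' hne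
      rcases Finset.mem_insert.1 hb with h | hb1
      · rcases Finset.mem_insert.1 hb' with h' | hb1'
        · exact absurd (h.trans h'.symm) hne
        · rw [h]; exact Or.inl (hlt b' hb1')
      · rcases Finset.mem_insert.1 hb' with h' | hb1'
        · rw [h']; exact Or.inr fun x hx y hy => hlt b hb1 y hy x hx
        · exact h3 b hb1 b' hb1' hne


lemma curve_blocks (g : ℝ → ℝ × ℝ) (hinj : Set.InjOn g (Set.Icc 0 1)) (s : ℕ) (hs : 1 ≤ s)
    (P X : Finset (ℝ × ℝ)) (γ : Set (ℝ × ℝ)) (hγ : γ = g '' Set.Icc 0 1) :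
    ∃ 𝓑 : Finset (Finset (ℝ × ℝ)),
      (P.filter (fun p => p ∈ γ)).card ≤ s * (𝓑.card + (X.filter (fun p => p ∈ γ)).card + 1) ∧
      (∀ b ∈ 𝓑, b ⊆ P ∧ (b : Set (ℝ × ℝ)) ⊆ γ ∧ b.card = s ∧
        ∃ a ∈ Set.Icc (0:ℝ) 1, ∃ a' ∈ Set.Icc (0:ℝ) 1, a ≤ a' ∧
          (∀ t ∈ Set.Icc a a', g t ∉ X) ∧ ∀ x ∈ b, ∃ t ∈ Set.Icc a a', g t = x) ∧
      ∀ b ∈ 𝓑, ∀ b' ∈ 𝓑, b ≠ b' → Disjoint b b' := by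
  have hθ : ∀ x : ℝ × ℝ, ∃ t, x ∈ γ → t ∈ Set.Icc (0:ℝ) 1 ∧ g t = x := by
    intro x
    by_cases hx : x ∈ γ
    · rw [hγ] at hx
      obtain ⟨t, ht, h⟩ := hx
      exact ⟨t, fun _ => ⟨ht, h⟩⟩
    · exact ⟨0, fun h => absurd h hx⟩
  choose θ hθ using hθ
  set A := (P.filter (fun p => p ∈ γ)).image θ with hA
  have hAmem : ∀ t ∈ A, t ∈ Set.Icc (0:ℝ) 1 ∧ g t ∈ P ∧ g t ∈ γ := by
    intro t ht
    obtain ⟨x, hx, rfl⟩ := Finset.mem_image.1 ht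
    obtain ⟨hxP, hxγ⟩ := Finset.mem_filter.1 hx
    rw [(hθ x hxγ).2]
    exact ⟨(hθ x hxγ).1, hxP, hxγ⟩
  have hAcard : A.card = (P.filter (fun p => p ∈ γ)).card := by
    refine Finset.card_image_of_injOn fun x hx y hy hxy => ?_
    have h1 := (hθ x (Finset.mem_filter.1 hx).2).2
    have h2 := (hθ y (Finset.mem_filter.1 hy).2).2
    rw [← h1, ← h2, hxy]
  obtain ⟨𝓐, h1, h2, h3⟩ := cut_blocks s hs A
  set dead : Finset ℝ → Prop := fun b => ∃ x ∈ b, ∃ y ∈ b, ∃ t ∈ Set.Icc x y, g t ∈ X with hdead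
  have hdeadcard : (𝓐.filter dead).card ≤ (X.filter (fun p => p ∈ γ)).card := by
    have hw : ∀ b : Finset ℝ, ∃ t, dead b → ∃ x ∈ b, ∃ y ∈ b, t ∈ Set.Icc x y ∧ g t ∈ X := by
      intro b
      by_cases hb : dead b
      · obtain ⟨x, hx, y, hy, t, ht, hX⟩ := hb
        exact ⟨t, fun _ => ⟨x, hx, y, hy, ht, hX⟩⟩
      · exact ⟨0, fun h => absurd h hb⟩
    choose w hw using hw
    have hwI : ∀ b ∈ 𝓐, dead b → w b ∈ Set.Icc (0:ℝ) 1 := by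
      intro b hb hd
      obtain ⟨x, hx, y, hy, ht, -⟩ := hw b hd
      have a1 := (hAmem x ((h2 b hb).1 hx)).1
      have a2 := (hAmem y ((h2 b hb).1 hy)).1
      exact ⟨a1.1.trans ht.1, ht.2.trans a2.2⟩
    refine Finset.card_le_card_of_injOn (fun b => g (w b)) ?_ ?_
    · intro b hb
      obtain ⟨hb, hd⟩ := Finset.mem_filter.1 hb
      obtain ⟨x, hx, y, hy, ht, hX⟩ := hw b hd
      refine Finset.mem_filter.2 ⟨hX, ?_⟩
      rw [hγ]; exact ⟨w b, hwI b hb hd, rfl⟩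
    · intro b hb b' hb' hbb
      obtain ⟨hb, hd⟩ := Finset.mem_filter.1 hb
      obtain ⟨hb', hd'⟩ := Finset.mem_filter.1 hb'
      have hww : w b = w b' := hinj (hwI b hb hd) (hwI b' hb' hd') hbb
      obtain ⟨x, hx, y, hy, ht, hX⟩ := hw b hd
      obtain ⟨x', hx', y', hy', ht', hX'⟩ := hw b' hd'
      by_contra hne
      rcases h3 b hb b' hb' hne with h | h
      · have := h y hy x' hx'
        have := ht.2; have := ht'.1; linarith
      · have := h x hx y' hy'
        have := ht.1; have := ht'.2; linarith
  have hginj : ∀ b ∈ 𝓐, ∀ b' ∈ 𝓐, ∀ t ∈ b, ∀ t' ∈ b', g t = g t' → t = t' := by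
    intro b hb b' hb' t ht t' ht' h
    exact hinj (hAmem t ((h2 b hb).1 ht)).1 (hAmem t' ((h2 b' hb').1 ht')).1 h
  have himginj : Set.InjOn (fun b : Finset ℝ => b.image g) 𝓐 := by
    intro b hb b' hb' hbb
    by_contra hne
    obtain ⟨x, hx⟩ : b.Nonempty := by rw [← Finset.card_pos, (h2 b hb).2]; omega
    have : g x ∈ b'.image g := by
      have : g x ∈ b.image g := Finset.mem_image_of_mem _ hx
      simp only at hbb
      rwa [hbb] at this
    obtain ⟨y, hy, hxy⟩ := Finset.mem_image.1 this
    have := hginj b' hb' b hb y hy x hx hxy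
    subst this
    rcases h3 b hb b' hb' hne with h | h
    · exact lt_irrefl _ (h y hx y hy)
    · exact lt_irrefl _ (h y hx y hy)
  refine ⟨(𝓐.filter (fun b => ¬ dead b)).image (fun b => b.image g), ?_, ?_, ?_⟩
  · rw [Finset.card_image_of_injOn (himginj.mono (by
      intro x hx; exact (Finset.mem_filter.1 hx).1)), ← hAcard]
    refine h1.trans (Nat.mul_le_mul_left _ ?_)
    have := Finset.card_filter_add_card_filter_not (s := 𝓐) dead
    omega
  · intro b hb
    obtain ⟨a, ha, rfl⟩ := Finset.mem_image.1 hb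
    obtain ⟨ha, hnd⟩ := Finset.mem_filter.1 ha
    have haA := (h2 a ha).1
    have hne : a.Nonempty := by rw [← Finset.card_pos, (h2 a ha).2]; omega
    refine ⟨?_, ?_, ?_, a.min' hne, (hAmem _ (haA (a.min'_mem hne))).1, a.max' hne,
      (hAmem _ (haA (a.max'_mem hne))).1, a.min'_le _ (a.max'_mem hne), ?_, ?_⟩
    · intro x hx
      obtain ⟨t, ht, rfl⟩ := Finset.mem_image.1 hx
      exact (hAmem t (haA ht)).2.1
    · intro x hx
      obtain ⟨t, ht, rfl⟩ := Finset.mem_image.1 (Finset.mem_coe.1 hx)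
      exact (hAmem t (haA ht)).2.2
    · rw [Finset.card_image_of_injOn, (h2 a ha).2]
      exact fun t ht t' ht' h => hginj a ha a ha t ht t' ht' h
    · intro t ht htX
      exact hnd ⟨_, a.min'_mem hne, _, a.max'_mem hne, t, ht, htX⟩
    · intro x hx
      obtain ⟨t, ht, rfl⟩ := Finset.mem_image.1 hx
      exact ⟨t, ⟨a.min'_le _ ht, a.le_max' _ ht⟩, rfl⟩
  · intro b hb b' hb' hne
    obtain ⟨a, ha, rfl⟩ := Finset.mem_image.1 hb
    obtain ⟨a', ha', rfl⟩ := Finset.mem_image.1 hb'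
    obtain ⟨ha, -⟩ := Finset.mem_filter.1 ha
    obtain ⟨ha', -⟩ := Finset.mem_filter.1 ha'
    have hne' : a ≠ a' := fun h => hne (by rw [h])
    refine Finset.disjoint_left.2 fun x hx hx' => ?_
    obtain ⟨t, ht, rfl⟩ := Finset.mem_image.1 hx
    obtain ⟨t', ht', h⟩ := Finset.mem_image.1 hx'
    have := hginj a' ha' a ha t' ht' t ht h
    subst this
    rcases h3 a ha a' ha' hne' with h | h
    · exact lt_irrefl _ (h _ ht _ ht')
    · exact lt_irrefl _ (h _ ht _ ht')


theorem pieces_exist (k s : ℕ) (hs : 1 ≤ s) (P : Finset (ℝ × ℝ)) (C : Finset (Set (ℝ × ℝ)))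
    (hC : KIntersecting C k) (T W : ℝ) (hT : 1 ≤ T) (hW : 0 ≤ W) :
    ∃ (𝒬 : Finset (Finset (ℝ × ℝ))) (bl : Set (ℝ × ℝ) → Finset (Finset (ℝ × ℝ))) (cost : ℝ),
      (∀ Q ∈ 𝒬, Q ⊆ P ∧ W * (Q.card : ℝ) ≤ T) ∧
      (∀ Q ∈ 𝒬, ∀ Q' ∈ 𝒬, Q ≠ Q' → Disjoint Q Q') ∧
      (∀ γ ∈ C, ∀ b ∈ bl γ, (b : Set (ℝ × ℝ)) ⊆ γ ∧ b.card = s ∧ ∃ Q ∈ 𝒬, b ⊆ Q) ∧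
      (∀ γ ∈ C, ∀ b ∈ bl γ, ∀ b' ∈ bl γ, b ≠ b' → Disjoint b b') ∧
      (incidences P C : ℝ) ≤ s * ((∑ γ ∈ C, ((bl γ).card : ℝ)) + cost + C.card) ∧
      cost ≤ 300 * (2 * k * (C.card : ℝ) ^ 2 + P.card + W * P.card) / √T := by
  obtain ⟨hsimple, hinter⟩ := hC
  have hpar : ∀ γ : Set (ℝ × ℝ), ∃ g : ℝ → ℝ × ℝ, γ ∈ C →
      Continuous g ∧ Set.InjOn g (Set.Icc 0 1) ∧ γ = g '' Set.Icc 0 1 := by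
    intro γ
    by_cases hγ : γ ∈ C
    · obtain ⟨f, hf, hfi, hfr⟩ := hsimple γ hγ
      refine ⟨Set.IccExtend zero_le_one f, fun _ => ⟨hf.Icc_extend', ?_, ?_⟩⟩
      · intro x hx y hy hxy
        rw [Set.IccExtend_of_mem _ _ hx, Set.IccExtend_of_mem _ _ hy] at hxy
        exact congrArg Subtype.val (hfi hxy)
      · rw [hfr]
        ext x
        constructor
        · rintro ⟨t, rfl⟩
          exact ⟨t, t.2, by rw [Set.IccExtend_of_mem _ _ t.2]⟩
        · rintro ⟨t, ht, rfl⟩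
          exact ⟨⟨t, ht⟩, by rw [Set.IccExtend_of_mem _ _ ht]⟩
    · exact ⟨fun _ => 0, fun h => absurd h hγ⟩
  choose g hg using hpar
  -- vertices
  set X0 : Finset (ℝ × ℝ) := C.offDiag.biUnion (fun p =>
    if h : (p.1 ∩ p.2).Finite then h.toFinset else ∅) with hX0
  have hX0mem : ∀ x, x ∈ X0 ↔ ∃ γ ∈ C, ∃ γ' ∈ C, γ ≠ γ' ∧ x ∈ γ ∧ x ∈ γ' := by
    intro x
    simp only [hX0, Finset.mem_biUnion, Finset.mem_offDiag]
    constructor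
    · rintro ⟨⟨γ, γ'⟩, ⟨h1, h2, h3⟩, h4⟩
      simp only at h1 h2 h3 h4
      rw [dif_pos (hinter γ h1 γ' h2 h3).1] at h4
      have := (Set.Finite.mem_toFinset _).1 h4
      exact ⟨γ, h1, γ', h2, h3, this.1, this.2⟩
    · rintro ⟨γ, h1, γ', h2, h3, h4, h5⟩
      refine ⟨(γ, γ'), ⟨h1, h2, h3⟩, ?_⟩
      simp only
      rw [dif_pos (hinter γ h1 γ' h2 h3).1]
      exact (Set.Finite.mem_toFinset _).2 ⟨h4, h5⟩
  set V := P ∪ X0 with hVdef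
  set f : C → ℝ → ℝ × ℝ := fun i => g i.1 with hf
  have hVint : ∀ i j : C, i ≠ j → ∀ a ∈ Set.Icc (0:ℝ) 1, ∀ t ∈ Set.Icc (0:ℝ) 1,
      f i a = f j t → f i a ∈ V := by
    intro i j hij a ha t ht h
    refine Finset.mem_union_right _ ((hX0mem _).2 ⟨i.1, i.2, j.1, j.2,
      fun h => hij (Subtype.ext h), ?_, ?_⟩)
    · rw [(hg i.1 i.2).2.2]; exact ⟨a, ha, rfl⟩
    · rw [h, (hg j.1 j.2).2.2]; exact ⟨t, ht, rfl⟩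
  have hK5 : NoK5 (cadj f V) := noK5_cadj f (fun i => (hg i.1 i.2).1) (fun i => (hg i.1 i.2).2.1) V hVint
  set c : ℝ × ℝ → ℕ := fun v => (C.filter (fun γ => v ∈ γ)).card with hc
  set μ : ℝ × ℝ → ℝ := fun v => (c v : ℝ) ^ 2 + if v ∈ P then W else 0 with hμ
  have hμc : ∀ v, (c v : ℝ) ^ 2 ≤ μ v := by
    intro v; simp only [hμ]; split_ifs <;> linarith
  obtain ⟨X, hXV, hXc, hXK⟩ := division (cadj_symm f V) hK5 c μ hμc T hT V
  replace hXK : ∀ K ⊆ V \ X, Conn (cadj f V) K → ∑ v ∈ K, μ v ≤ T := by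
    intro K hK hKc
    exact hXK K (by convert hK) hKc
  -- total weight
  have hcsq : ∀ v ∈ V, c v ^ 2 ≤ 2 * (C.filter (fun γ => v ∈ γ)).offDiag.card +
      if v ∈ P then 1 else 0 := by
    intro v hv
    rw [Finset.offDiag_card]
    have hcc : (C.filter (fun γ => v ∈ γ)).card = c v := rfl
    rw [hcc]
    by_cases hvP : v ∈ P
    · rw [if_pos hvP]
      rcases Nat.lt_or_ge (c v) 2 with h | h
      · interval_cases c v <;> simp
      · have : c v * 2 ≤ c v * c v := Nat.mul_le_mul_left _ h
        rw [sq]; omega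
    · rw [if_neg hvP]
      have hvX : v ∈ X0 := by
        rcases Finset.mem_union.1 hv with h | h
        · exact absurd h hvP
        · exact h
      obtain ⟨γ, h1, γ', h2, h3, h4, h5⟩ := (hX0mem v).1 hvX
      have h : 2 ≤ c v := by
        refine Finset.one_lt_card.2 ⟨γ, by simp [h1, h4], γ', by simp [h2, h5], h3⟩
      have : c v * 2 ≤ c v * c v := Nat.mul_le_mul_left _ h
      rw [sq]; omega
  have hpairs : ∑ v ∈ V, (C.filter (fun γ => v ∈ γ)).offDiag.card ≤ k * C.card ^ 2 := by
    calc ∑ v ∈ V, (C.filter (fun γ => v ∈ γ)).offDiag.card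
        = ∑ v ∈ V, ∑ p ∈ C.offDiag, if v ∈ p.1 ∧ v ∈ p.2 then 1 else 0 := by
          refine Finset.sum_congr rfl fun v _ => ?_
          rw [← Finset.sum_filter, Finset.sum_const, smul_eq_mul, mul_one]
          congr 1
          ext p
          simp only [Finset.mem_offDiag, Finset.mem_filter]
          tauto
      _ = ∑ p ∈ C.offDiag, ∑ v ∈ V, if v ∈ p.1 ∧ v ∈ p.2 then 1 else 0 := Finset.sum_comm
      _ ≤ ∑ p ∈ C.offDiag, k := by
          refine Finset.sum_le_sum fun p hp => ?_
          obtain ⟨h1, h2, h3⟩ := Finset.mem_offDiag.1 hp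
          obtain ⟨hfin, hle⟩ := hinter _ h1 _ h2 h3
          rw [← Finset.sum_filter, Finset.sum_const, smul_eq_mul, mul_one]
          refine le_trans ?_ hle
          rw [← Set.ncard_coe_finset]
          refine Set.ncard_le_ncard ?_ hfin
          intro x hx
          have := (Finset.mem_filter.1 (Finset.mem_coe.1 hx)).2
          exact ⟨this.1, this.2⟩
      _ = C.offDiag.card * k := by rw [Finset.sum_const, smul_eq_mul]
      _ ≤ k * C.card ^ 2 := by
          rw [Finset.offDiag_card, mul_comm, sq]
          exact Nat.mul_le_mul_left _ (Nat.sub_le _ _)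
  have hPV : V.filter (fun v => v ∈ P) = P := by
    ext v; simp only [Finset.mem_filter, hVdef, Finset.mem_union]; tauto
  have hsq : ∑ v ∈ V, c v ^ 2 ≤ 2 * (k * C.card ^ 2) + P.card := by
    refine (Finset.sum_le_sum hcsq).trans ?_
    rw [Finset.sum_add_distrib, ← Finset.mul_sum, ← Finset.sum_filter, Finset.sum_const,
      smul_eq_mul, mul_one, hPV]
    omega
  have htotal : ∑ v ∈ V, μ v ≤ 2 * k * (C.card : ℝ) ^ 2 + P.card + W * P.card := by
    simp only [hμ]
    rw [Finset.sum_add_distrib, ← Finset.sum_filter, Finset.sum_const, hPV, nsmul_eq_mul]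
    have : ((∑ v ∈ V, c v ^ 2 : ℕ) : ℝ) ≤ ((2 * (k * C.card ^ 2) + P.card : ℕ) : ℝ) := by
      exact_mod_cast hsq
    push_cast at this
    nlinarith
  -- blocks
  have hbl : ∀ γ : Set (ℝ × ℝ), ∃ 𝓑 : Finset (Finset (ℝ × ℝ)), γ ∈ C →
      (P.filter (fun p => p ∈ γ)).card ≤ s * (𝓑.card + (X.filter (fun p => p ∈ γ)).card + 1) ∧
      (∀ b ∈ 𝓑, b ⊆ P ∧ (b : Set (ℝ × ℝ)) ⊆ γ ∧ b.card = s ∧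
        ∃ a ∈ Set.Icc (0:ℝ) 1, ∃ a' ∈ Set.Icc (0:ℝ) 1, a ≤ a' ∧
          (∀ t ∈ Set.Icc a a', g γ t ∉ X) ∧ ∀ x ∈ b, ∃ t ∈ Set.Icc a a', g γ t = x) ∧
      ∀ b ∈ 𝓑, ∀ b' ∈ 𝓑, b ≠ b' → Disjoint b b' := by
    intro γ
    by_cases hγ : γ ∈ C
    · obtain ⟨𝓑, h⟩ := curve_blocks (g γ) (hg γ hγ).2.1 s hs P X γ (hg γ hγ).2.2
      exact ⟨𝓑, fun _ => h⟩
    · exact ⟨∅, fun h => absurd h hγ⟩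
  choose bl hbl using hbl
  refine ⟨(comps (cadj f V) (V \ X)).image (fun K => K ∩ P), bl, ((∑ v ∈ X, c v : ℕ) : ℝ),
    ?_, ?_, ?_, ?_, ?_, ?_⟩
  · intro Q hQ
    obtain ⟨K, hK, rfl⟩ := Finset.mem_image.1 hQ
    obtain ⟨hK1, hK2, -⟩ := mem_comps.1 hK
    refine ⟨Finset.inter_subset_right, le_trans ?_ (hXK K hK1 hK2)⟩
    simp only [hμ]
    rw [Finset.sum_add_distrib, ← Finset.sum_filter, Finset.sum_const, nsmul_eq_mul,
      Finset.filter_mem_eq_inter]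
    have : 0 ≤ ∑ v ∈ K, (c v : ℝ) ^ 2 := Finset.sum_nonneg fun v _ => sq_nonneg _
    linarith
  · intro Q hQ Q' hQ' hne
    obtain ⟨K, hK, rfl⟩ := Finset.mem_image.1 hQ
    obtain ⟨K', hK', rfl⟩ := Finset.mem_image.1 hQ'
    have : K ≠ K' := fun h => hne (by rw [h])
    exact (comps_disjoint hK hK' this).mono Finset.inter_subset_left Finset.inter_subset_left
  · intro γ hγ b hb
    obtain ⟨hbP, hbγ, hbs, a, ha, a', ha', haa, hX, hpar⟩ := (hbl γ hγ).2.1 b hb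
    refine ⟨hbγ, hbs, ?_⟩
    set K := V.filter (fun v => ∃ t ∈ Set.Icc a a', g γ t = v) with hK
    have hbK : b ⊆ K := fun x hx =>
      Finset.mem_filter.2 ⟨Finset.mem_union_left _ (hbP hx), hpar x hx⟩
    have hbne : b.Nonempty := by rw [← Finset.card_pos, hbs]; omega
    have hθ : ∀ x : ℝ × ℝ, ∃ t, x ∈ K → t ∈ Set.Icc a a' ∧ g γ t = x := by
      intro x
      by_cases hx : x ∈ K
      · obtain ⟨t, ht, h⟩ := (Finset.mem_filter.1 hx).2
        exact ⟨t, fun _ => ⟨ht, h⟩⟩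
      · exact ⟨0, fun h => absurd h hx⟩
    choose θ hθ using hθ
    have hKconn : Conn (cadj f V) K := by
      refine arc_conn f V ⟨γ, hγ⟩ K (hbne.mono hbK) (Finset.filter_subset _ _) θ ?_
        (hg γ hγ).2.1 ?_
      · intro x hx
        exact ⟨⟨ha.1.trans (hθ x hx).1.1, (hθ x hx).1.2.trans ha'.2⟩, (hθ x hx).2⟩
      · intro x hx y hy t ht htV
        exact Finset.mem_filter.2 ⟨htV, t, ⟨(hθ x hx).1.1.trans ht.1.le,
          ht.2.le.trans (hθ y hy).1.2⟩, rfl⟩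
    have hKX : K ⊆ V \ X := by
      intro x hx
      obtain ⟨hxV, t, ht, rfl⟩ := Finset.mem_filter.1 hx
      exact Finset.mem_sdiff.2 ⟨hxV, hX t ht⟩
    obtain ⟨L, hL, hKL⟩ := conn_subset_comp hKX hKconn
    exact ⟨L ∩ P, Finset.mem_image_of_mem _ hL, Finset.subset_inter (hbK.trans hKL) hbP⟩
  · intro γ hγ; exact (hbl γ hγ).2.2
  · have h1 : incidences P C ≤ s * (∑ γ ∈ C, (bl γ).card + ∑ v ∈ X, c v + C.card) := by
      unfold incidences
      have h2 : ∑ v ∈ X, c v = ∑ γ ∈ C, (X.filter (fun p => p ∈ γ)).card := by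
        simp only [hc, Finset.card_filter]
        exact Finset.sum_comm
      calc _ ≤ ∑ γ ∈ C, s * ((bl γ).card + (X.filter (fun p => p ∈ γ)).card + 1) :=
            Finset.sum_le_sum fun γ hγ => (hbl γ hγ).1
        _ = _ := by
            rw [← Finset.mul_sum, Finset.sum_add_distrib, Finset.sum_add_distrib, h2]
            simp
    exact_mod_cast h1
  · refine hXc.trans ?_
    gcongr

end Geometry

end

section
open MeasureTheory Filter Topology

noncomputable section

abbrev Om : Type := Finset ℕ → Bool

/-- sigma-algebra generated by coordinates in Q -/
abbrev sg (Q : Set (Finset ℕ)) : MeasurableSpace Om := cylinderEvents (X := fun _ => Bool) Q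

def Tm (τ : ℕ → ℕ) (ω : Om) : Om := fun v => ω (v.image τ)

lemma sg_le (Q : Set (Finset ℕ)) : sg Q ≤ (MeasurableSpace.pi : MeasurableSpace Om) :=
  cylinderEvents_le_pi

lemma sg_mono {Q Q' : Set (Finset ℕ)} (h : Q ⊆ Q') : sg Q ≤ sg Q' := cylinderEvents_mono h

lemma Tm_meas (τ : ℕ → ℕ) (Q Q' : Set (Finset ℕ)) (h : ∀ v ∈ Q, v.image τ ∈ Q') :
    @Measurable _ _ (sg Q') (sg Q) (Tm τ) := by
  refine (@measurable_cylinderEvents_iff _ _ _ (sg Q') _ _ _).2 ?_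
  intro v hv
  exact measurable_cylinderEvent_apply (X := fun _ : Finset ℕ => Bool) (h v hv)

lemma Tm_measurable (τ : ℕ → ℕ) : Measurable (Tm τ) := by
  refine measurable_pi_iff.2 fun v => measurable_pi_apply _

lemma sg_depends_set (Q : Set (Finset ℕ)) (E : Set Om) (hE : MeasurableSet[sg Q] E) (ω ω' : Om)
    (h : ∀ v ∈ Q, ω v = ω' v) : ω ∈ E ↔ ω' ∈ E := by
  let m : MeasurableSpace Om :=
    { MeasurableSet' := fun E => (ω ∈ E ↔ ω' ∈ E)
      measurableSet_empty := by simp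
      measurableSet_compl := by intro s hs; simp [hs]
      measurableSet_iUnion := by
        intro f hf
        simp only [Set.mem_iUnion]
        exact exists_congr hf }
  have : sg Q ≤ m := by
    refine iSup₂_le fun v hv => ?_
    rintro _ ⟨t, -, rfl⟩
    change ω v ∈ t ↔ ω' v ∈ t
    rw [h v hv]
  exact this E hE

lemma sg_depends (Q : Set (Finset ℕ)) (f : Om → ℝ) (hf : Measurable[sg Q] f) (ω ω' : Om)
    (h : ∀ v ∈ Q, ω v = ω' v) : f ω = f ω' := by
  have := sg_depends_set Q (f ⁻¹' {f ω'}) (hf (measurableSet_singleton _)) ω ω' h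
  simpa using this

lemma sg_iSup (Q : ℕ → Set (Finset ℕ)) : (⨆ n, sg (Q n)) = sg (⋃ n, Q n) := by
  apply le_antisymm
  · exact iSup_le fun n => sg_mono (Set.subset_iUnion Q n)
  · refine iSup₂_le fun v hv => ?_
    obtain ⟨n, hn⟩ := Set.mem_iUnion.1 hv
    refine le_trans ?_ (le_iSup _ n)
    exact le_iSup₂ (f := fun v (_ : v ∈ Q n) => MeasurableSpace.comap (fun σ : Om => σ v) inferInstance) v hn

def filt (Q : ℕ → Set (Finset ℕ)) (hQ : Monotone Q) :
    Filtration ℕ (MeasurableSpace.pi : MeasurableSpace Om) where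
  seq n := sg (Q n)
  mono' := fun _ _ h => sg_mono (hQ h)
  le' := fun _ => sg_le _

def InvT (μ : Measure Om) : Prop := ∀ τ : ℕ → ℕ, Function.Injective τ → μ.map (Tm τ) = μ

lemma InvT.integral {μ : Measure Om} (h : InvT μ) (τ : ℕ → ℕ) (hτ : Function.Injective τ)
    (f : Om → ℝ) (hf : Measurable f) : ∫ ω, f (Tm τ ω) ∂μ = ∫ ω, f ω ∂μ := by
  conv_rhs => rw [← h τ hτ]
  rw [integral_map (Tm_measurable τ).aemeasurable hf.aestronglyMeasurable]

lemma integrable_bdd {μ : Measure Om} [IsFiniteMeasure μ] (f : Om → ℝ) (hf : Measurable f)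
    (hb : ∀ᵐ ω ∂μ, |f ω| ≤ 1) : Integrable f μ :=
  Integrable.of_bound hf.aestronglyMeasurable 1 hb

lemma condExp_bdd {μ : Measure Om} {m : MeasurableSpace Om} (f : Om → ℝ)
    (hb : ∀ᵐ ω ∂μ, |f ω| ≤ 1) : ∀ᵐ ω ∂μ, |(μ[f|m]) ω| ≤ 1 :=
  ae_bdd_abs_condExp_of_ae_bdd_abs hb

lemma ce_meas {μ : Measure Om} {m : MeasurableSpace Om} (f : Om → ℝ) : Measurable[m] (μ[f|m]) :=
  stronglyMeasurable_condExp.measurable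

/-- pull out: `∫ X Z = ∫ E[X|m] Z` -/
lemma pull_out {μ : Measure Om} [IsFiniteMeasure μ] {m : MeasurableSpace Om}
    (hm : m ≤ MeasurableSpace.pi) (X Z : Om → ℝ) (hX : Integrable X μ) (hZ : Measurable[m] Z)
    (hb : ∀ᵐ ω ∂μ, |Z ω| ≤ 1) : ∫ ω, X ω * Z ω ∂μ = ∫ ω, (μ[X|m]) ω * Z ω ∂μ := by
  have h1 : μ[fun ω => X ω * Z ω|m] =ᵐ[μ] fun ω => (μ[X|m]) ω * Z ω := by
    refine condExp_mul_of_stronglyMeasurable_right hZ.stronglyMeasurable ?_ hX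
    exact hX.mul_bdd (c := 1) (hZ.mono hm le_rfl).aestronglyMeasurable hb
  rw [← integral_condExp hm, integral_congr_ae h1]

def sp (s : ℕ) (v : Finset ℕ) : Finset ℕ := v ∩ Finset.range s

lemma tendsto_int_bdd {μ : Measure Om} [IsFiniteMeasure μ] (F : ℕ → Om → ℝ) (f : Om → ℝ) (C : ℝ)
    (hF : ∀ n, Measurable (F n)) (hb : ∀ n, ∀ᵐ ω ∂μ, |F n ω| ≤ C)
    (hlim : ∀ᵐ ω ∂μ, Tendsto (fun n => F n ω) atTop (𝓝 (f ω))) :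
    Tendsto (fun n => ∫ ω, F n ω ∂μ) atTop (𝓝 (∫ ω, f ω ∂μ)) :=
  tendsto_integral_of_dominated_convergence (fun _ => C) (fun n => (hF n).aestronglyMeasurable)
    (integrable_const C) hb hlim

lemma cut_iUnion (A : Set (Finset ℕ)) : (⋃ n : ℕ, {v | v ∈ A ∧ v ⊆ Finset.range n}) = A := by
  ext v
  simp only [Set.mem_iUnion, Set.mem_ofPred_eq]
  constructor
  · rintro ⟨n, h, -⟩; exact h
  · intro h
    refine ⟨v.sup id + 1, h, fun x hx => ?_⟩
    have := Finset.le_sup (f := id) hx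
    simp only [id] at this
    simp; omega

lemma cut_mono (A : Set (Finset ℕ)) : Monotone (fun n : ℕ => {v | v ∈ A ∧ v ⊆ Finset.range n}) := by
  intro a b hab v hv
  exact ⟨hv.1, hv.2.trans (Finset.range_mono hab)⟩

lemma levy {μ : Measure Om} [IsFiniteMeasure μ] (Q : ℕ → Set (Finset ℕ)) (hQ : Monotone Q)
    (X : Om → ℝ) : ∀ᵐ ω ∂μ, Tendsto (fun n => (μ[X|sg (Q n)]) ω) atTop
      (𝓝 ((μ[X|sg (⋃ n, Q n)]) ω)) := by
  have := tendsto_ae_condExp (μ := μ) (ℱ := filt Q hQ) X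
  have e : (⨆ n, (filt Q hQ) n) = sg (⋃ n, Q n) := sg_iSup Q
  rw [e] at this
  exact this

/-- relative independence -/
lemma RI (μ : Measure Om) [IsProbabilityMeasure μ] (hI : InvT μ) (s : ℕ) (e : Finset ℕ)
    (he : e ⊆ Finset.range s) (𝒬 : Set (Finset ℕ)) (hd : ∀ a ∈ 𝒬, ∀ b ⊆ a, b ∈ 𝒬)
    (X : Om → ℝ) (hX : Measurable[sg {v | sp s v ⊆ e}] X) (hb : ∀ ω, |X ω| ≤ 1) :
    μ[X|sg {v | sp s v ∈ 𝒬}] =ᵐ[μ] μ[X|sg {v | sp s v ∈ 𝒬 ∧ sp s v ⊆ e}] := by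
  set A : Set (Finset ℕ) := {v | sp s v ∈ 𝒬} with hA
  set B : Set (Finset ℕ) := {v | sp s v ⊆ e} with hB
  set D : Set (Finset ℕ) := {v | sp s v ∈ 𝒬 ∧ sp s v ⊆ e} with hD
  set cut : Set (Finset ℕ) → ℕ → Set (Finset ℕ) := fun A n => {v | v ∈ A ∧ v ⊆ Finset.range n}
    with hcut
  have hXm : Measurable X := hX.mono (sg_le _) le_rfl
  have hb' : ∀ᵐ ω ∂μ, |X ω| ≤ 1 := .of_forall hb
  have hXi : Integrable X μ := integrable_bdd X hXm hb'
  set Xn : ℕ → Om → ℝ := fun n => μ[X|sg (cut B n)] with hXn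
  set Yn : ℕ → Om → ℝ := fun n => μ[X|sg (cut A n)] with hYn
  set p1 : Om → ℝ := μ[X|sg A] with hp1
  set p2 : Om → ℝ := μ[X|sg D] with hp2
  have mXn : ∀ n, Measurable (Xn n) := fun n => (ce_meas X).mono (sg_le _) le_rfl
  have mYn : ∀ n, Measurable (Yn n) := fun n => (ce_meas X).mono (sg_le _) le_rfl
  have mp1 : Measurable p1 := (ce_meas X).mono (sg_le _) le_rfl
  have mp2 : Measurable p2 := (ce_meas X).mono (sg_le _) le_rfl
  have bXn : ∀ n, ∀ᵐ ω ∂μ, |Xn n ω| ≤ 1 := fun n => condExp_bdd X hb'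
  have bYn : ∀ n, ∀ᵐ ω ∂μ, |Yn n ω| ≤ 1 := fun n => condExp_bdd X hb'
  have bp1 : ∀ᵐ ω ∂μ, |p1 ω| ≤ 1 := condExp_bdd X hb'
  have bp2 : ∀ᵐ ω ∂μ, |p2 ω| ≤ 1 := condExp_bdd X hb'
  have lX : ∀ᵐ ω ∂μ, Tendsto (fun n => Xn n ω) atTop (𝓝 (X ω)) := by
    have := levy (μ := μ) _ (cut_mono B) X
    rw [cut_iUnion B] at this
    rwa [condExp_of_stronglyMeasurable (sg_le _) hX.stronglyMeasurable hXi] at this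
  have lY : ∀ᵐ ω ∂μ, Tendsto (fun n => Yn n ω) atTop (𝓝 (p1 ω)) := by
    have := levy (μ := μ) _ (cut_mono A) X
    rwa [cut_iUnion A] at this
  -- key inequality
  have key : ∀ n, s ≤ n → ∫ ω, Xn n ω * Yn n ω ∂μ ≤
      (∫ ω, |Xn n ω - X ω| ∂μ) + ((∫ ω, p2 ω * p2 ω ∂μ) + ∫ ω, Yn n ω * Yn n ω ∂μ) / 2 := by
    intro n hn
    set τ : ℕ → ℕ := fun i => if i ∈ e ∨ (s ≤ i ∧ i < n) then i else n + i with hτ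
    have hlt : ∀ i, i ∈ e → i < s := fun i hi => Finset.mem_range.1 (he hi)
    have hinj : Function.Injective τ := by
      intro i j hij
      simp only [hτ] at hij
      split_ifs at hij with h1 h2 h2
      · exact hij
      · exfalso
        rcases h1 with h1 | h1
        · have := hlt i h1; omega
        · omega
      · exfalso
        rcases h2 with h2 | h2
        · have := hlt j h2; omega
        · omega
      · omega
    have e1 : ∀ ω, Xn n (Tm τ ω) = Xn n ω := by
      intro ω
      refine sg_depends (cut B n) _ (ce_meas X) _ _ fun v hv => ?_
      have : v.image τ = v := by
        conv_rhs => rw [← Finset.image_id (s := v)]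
        refine Finset.image_congr fun i hi => ?_
        have hin : i < n := Finset.mem_range.1 (hv.2 hi)
        have : i ∈ e ∨ (s ≤ i ∧ i < n) := by
          by_cases his : i < s
          · left
            exact hv.1 (Finset.mem_inter.2 ⟨hi, Finset.mem_range.2 his⟩)
          · right; omega
        simp [hτ, this]
      simp only [Tm, this]
    have mZ : Measurable[sg D] (fun ω => Yn n (Tm τ ω)) := by
      refine @Measurable.comp _ _ _ (sg D) (sg (cut A n)) _ _ _ (ce_meas X) (Tm_meas τ _ _ fun v hv => ?_)
      have : sp s (v.image τ) ⊆ sp s v ∩ e := by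
        intro x hx
        simp only [sp, Finset.mem_inter, Finset.mem_image, Finset.mem_range] at hx ⊢
        obtain ⟨⟨i, hi, hix⟩, hxs⟩ := hx
        simp only [hτ] at hix
        split_ifs at hix with h
        · subst hix
          rcases h with h | h
          · exact ⟨⟨hi, hxs⟩, h⟩
          · omega
        · omega
      exact ⟨hd _ hv.1 _ (this.trans Finset.inter_subset_left), this.trans Finset.inter_subset_right⟩
    set Z : Om → ℝ := fun ω => Yn n (Tm τ ω) with hZ
    have mZ' : Measurable Z := mZ.mono (sg_le _) le_rfl
    have bZ : ∀ᵐ ω ∂μ, |Z ω| ≤ 1 := by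
      have h1 : ∀ᵐ ω ∂(μ.map (Tm τ)), |Yn n ω| ≤ 1 := by rw [hI τ hinj]; exact bYn n
      exact ae_of_ae_map (Tm_measurable τ).aemeasurable h1
    have s1 : ∫ ω, Xn n ω * Yn n ω ∂μ = ∫ ω, Xn n ω * Z ω ∂μ := by
      have h0 := hI.integral τ hinj (fun ω => Xn n ω * Yn n ω) ((mXn n).mul (mYn n))
      simp only [e1] at h0
      exact h0.symm
    have s2 : ∫ ω, X ω * Z ω ∂μ = ∫ ω, p2 ω * Z ω ∂μ := pull_out (sg_le _) X Z hXi mZ bZ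
    have s3 : ∫ ω, Z ω * Z ω ∂μ = ∫ ω, Yn n ω * Yn n ω ∂μ :=
      hI.integral τ hinj _ ((mYn n).mul (mYn n))
    have bmul : ∀ f g : Om → ℝ, (∀ᵐ ω ∂μ, |f ω| ≤ 1) → (∀ᵐ ω ∂μ, |g ω| ≤ 1) → Measurable f →
        Measurable g → Integrable (fun ω => f ω * g ω) μ := by
      intro f g hf hg mf mg
      refine integrable_bdd _ (mf.mul mg) ?_
      filter_upwards [hf, hg] with ω h1 h2
      rw [abs_mul]
      exact mul_le_one₀ h1 (abs_nonneg _) h2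
    have s4 : ∫ ω, Xn n ω * Z ω ∂μ ≤ (∫ ω, |Xn n ω - X ω| ∂μ) + ∫ ω, X ω * Z ω ∂μ := by
      have iX : Integrable (fun ω => |Xn n ω - X ω|) μ :=
        ((integrable_bdd _ (mXn n) (bXn n)).sub hXi).abs
      rw [← integral_add iX (bmul X Z hb' bZ hXm mZ')]
      refine integral_mono_ae (bmul _ _ (bXn n) bZ (mXn n) mZ') (iX.add (bmul X Z hb' bZ hXm mZ')) ?_
      filter_upwards [bZ] with ω h1
      have : (Xn n ω - X ω) * Z ω ≤ |Xn n ω - X ω| := by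
        refine (le_abs_self _).trans ?_
        rw [abs_mul]
        exact mul_le_of_le_one_right (abs_nonneg _) h1
      linarith
    have s5 : ∫ ω, p2 ω * Z ω ∂μ ≤ ((∫ ω, p2 ω * p2 ω ∂μ) + ∫ ω, Z ω * Z ω ∂μ) / 2 := by
      rw [← integral_add (bmul _ _ bp2 bp2 mp2 mp2) (bmul _ _ bZ bZ mZ' mZ'), ← integral_div]
      refine integral_mono (bmul _ _ bp2 bZ mp2 mZ')
        (((bmul _ _ bp2 bp2 mp2 mp2).add (bmul _ _ bZ bZ mZ' mZ')).div_const 2) fun ω => ?_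
      nlinarith [sq_nonneg (p2 ω - Z ω)]
    rw [s1]
    rw [s3] at s5
    linarith
  -- limits
  have bmul1 : ∀ f g : Om → ℝ, (∀ᵐ ω ∂μ, |f ω| ≤ 1) → (∀ᵐ ω ∂μ, |g ω| ≤ 1) →
      ∀ᵐ ω ∂μ, |f ω * g ω| ≤ 1 := by
    intro f g hf hg
    filter_upwards [hf, hg] with ω h1 h2
    rw [abs_mul]
    exact mul_le_one₀ h1 (abs_nonneg _) h2
  have L1 : Tendsto (fun n => ∫ ω, Xn n ω * Yn n ω ∂μ) atTop (𝓝 (∫ ω, X ω * p1 ω ∂μ)) := by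
    refine tendsto_int_bdd _ _ 1 (fun n => (mXn n).mul (mYn n)) (fun n => bmul1 _ _ (bXn n) (bYn n)) ?_
    filter_upwards [lX, lY] with ω h1 h2
    exact h1.mul h2
  have L2 : Tendsto (fun n => ∫ ω, Yn n ω * Yn n ω ∂μ) atTop (𝓝 (∫ ω, p1 ω * p1 ω ∂μ)) := by
    refine tendsto_int_bdd _ _ 1 (fun n => (mYn n).mul (mYn n)) (fun n => bmul1 _ _ (bYn n) (bYn n)) ?_
    filter_upwards [lY] with ω h2
    exact h2.mul h2
  have L3 : Tendsto (fun n => ∫ ω, |Xn n ω - X ω| ∂μ) atTop (𝓝 (∫ _, (0:ℝ) ∂μ)) := by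
    refine tendsto_int_bdd _ _ 2 (fun n => ((mXn n).sub hXm).abs) (fun n => ?_) ?_
    · filter_upwards [bXn n] with ω h1
      rw [abs_abs]
      refine (abs_sub _ _).trans ?_
      have := hb ω
      linarith
    · filter_upwards [lX] with ω h1
      have := (h1.sub_const (X ω)).abs
      simpa using this
  rw [integral_zero] at L3
  have L4 := le_of_tendsto_of_tendsto L1 (L3.add ((L2.const_add (∫ ω, p2 ω * p2 ω ∂μ)).div_const 2))
    (eventually_atTop.2 ⟨s, key⟩)
  have q1 : ∫ ω, X ω * p1 ω ∂μ = ∫ ω, p1 ω * p1 ω ∂μ :=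
    pull_out (sg_le _) X p1 hXi (ce_meas X) bp1
  have hDA : sg D ≤ sg A := sg_mono fun v hv => hv.1
  have q2 : ∫ ω, p1 ω * p2 ω ∂μ = ∫ ω, p2 ω * p2 ω ∂μ := by
    rw [← pull_out (sg_le _) X p2 hXi (ce_meas X) bp2]
    rw [← pull_out (sg_le _) X p2 hXi ((ce_meas X).mono hDA le_rfl) bp2]
  have ib : ∀ f g : Om → ℝ, (∀ᵐ ω ∂μ, |f ω| ≤ 1) → (∀ᵐ ω ∂μ, |g ω| ≤ 1) → Measurable f →
      Measurable g → Integrable (fun ω => f ω * g ω) μ :=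
    fun f g hf hg mf mg => integrable_bdd _ (mf.mul mg) (bmul1 f g hf hg)
  have q3 : ∫ ω, (p1 ω - p2 ω) ^ 2 ∂μ ≤ 0 := by
    have : ∀ ω, (p1 ω - p2 ω) ^ 2 = p1 ω * p1 ω + p2 ω * p2 ω - 2 * (p1 ω * p2 ω) := by
      intro ω; ring
    simp only [this]
    rw [integral_sub (f := fun ω => p1 ω * p1 ω + p2 ω * p2 ω) ((ib _ _ bp1 bp1 mp1 mp1).add (ib _ _ bp2 bp2 mp2 mp2))
      ((ib _ _ bp1 bp2 mp1 mp2).const_mul 2), integral_add (ib _ _ bp1 bp1 mp1 mp1)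
      (ib _ _ bp2 bp2 mp2 mp2), integral_const_mul, q2]
    linarith
  have i2 : Integrable (fun ω => (p1 ω - p2 ω) ^ 2) μ := by
    refine Integrable.of_bound ((mp1.sub mp2).pow_const 2).aestronglyMeasurable 4 ?_
    filter_upwards [bp1, bp2] with ω h1 h2
    rw [Real.norm_eq_abs, abs_pow]
    have := abs_sub (p1 ω) (p2 ω)
    nlinarith [abs_nonneg (p1 ω - p2 ω)]
  have q4 := (integral_eq_zero_iff_of_nonneg (fun ω => sq_nonneg _) i2).1
    (le_antisymm q3 (integral_nonneg fun ω => sq_nonneg _))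
  filter_upwards [q4] with ω h
  have : (p1 ω - p2 ω) ^ 2 = 0 := h
  nlinarith [pow_eq_zero_iff (two_ne_zero) |>.1 this]

end

end

section
open MeasureTheory Filter Topology

noncomputable section

def ind (A : Set Om) : Om → ℝ := A.indicator (fun _ => (1:ℝ))

lemma ind_of_mem {A : Set Om} {ω : Om} (h : ω ∈ A) : ind A ω = 1 := Set.indicator_of_mem h _
lemma ind_of_notMem {A : Set Om} {ω : Om} (h : ω ∉ A) : ind A ω = 0 := Set.indicator_of_notMem h _

lemma ind_nonneg (A : Set Om) (ω : Om) : 0 ≤ ind A ω := by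
  by_cases h : ω ∈ A
  · rw [ind_of_mem h]; norm_num
  · rw [ind_of_notMem h]

lemma ind_abs (A : Set Om) (ω : Om) : |ind A ω| ≤ 1 := by
  by_cases h : ω ∈ A
  · rw [ind_of_mem h]; norm_num
  · rw [ind_of_notMem h]; norm_num

lemma ind_meas {m : MeasurableSpace Om} {A : Set Om} (h : MeasurableSet[m] A) :
    Measurable[m] (ind A) := Measurable.indicator measurable_const h

lemma ind_inter (A B : Set Om) (ω : Om) : ind (A ∩ B) ω = ind A ω * ind B ω := by
  by_cases h : ω ∈ A <;> by_cases h' : ω ∈ B <;> simp [ind, h, h']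

lemma ind_mono {A B : Set Om} (h : A ⊆ B) (ω : Om) : ind A ω ≤ ind B ω :=
  Set.indicator_le_indicator_of_subset h (fun _ => zero_le_one) ω

lemma ind_prod {ι : Type*} (S : Finset ι) (A : ι → Set Om) (ω : Om) :
    ∏ f ∈ S, ind (A f) ω = ind (⋂ f ∈ S, A f) ω := by
  induction S using Finset.induction_on with
  | empty => simp [ind]
  | insert a S ha ih =>
    rw [Finset.prod_insert ha, ih, ← ind_inter, Finset.set_biInter_insert]

lemma ind_integral (μ : Measure Om) {A : Set Om} (h : MeasurableSet A) :
    ∫ ω, ind A ω ∂μ = μ.real A := by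
  simp only [ind]
  rw [integral_indicator_const _ h]; simp

lemma ind_integrable (μ : Measure Om) [IsFiniteMeasure μ] {A : Set Om} (h : MeasurableSet A) :
    Integrable (ind A) μ := integrable_bdd _ (ind_meas h) (.of_forall (ind_abs A))

lemma lt_meas {m : MeasurableSpace Om} {f g : Om → ℝ} (hf : Measurable[m] f)
    (hg : Measurable[m] g) : MeasurableSet[m] {ω | f ω < g ω} := measurableSet_lt hf hg

lemma approx (ρ : Measure Om) [IsFiniteMeasure ρ] (Q : ℕ → Set (Finset ℕ)) (hQ : Monotone Q)
    (E : Set Om) (hE : MeasurableSet[sg (⋃ n, Q n)] E) (η : ℝ) (hη : 0 < η) :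
    ∃ n E', MeasurableSet[sg (Q n)] E' ∧ ρ.real (symmDiff E E') < η := by
  have hE0 : MeasurableSet E := sg_le _ _ hE
  have h1 := levy (μ := ρ) Q hQ (ind E)
  rw [condExp_of_stronglyMeasurable (sg_le _) (ind_meas hE).stronglyMeasurable
    (ind_integrable ρ hE0)] at h1
  set E' : ℕ → Set Om := fun n => {ω | 1 / 2 < (ρ[ind E|sg (Q n)]) ω} with hE'
  have mE' : ∀ n, MeasurableSet[sg (Q n)] (E' n) := fun n =>
    lt_meas (@measurable_const _ _ _ (sg (Q n)) _) (ce_meas _)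
  have mS : ∀ n, MeasurableSet (symmDiff E (E' n)) := fun n => hE0.symmDiff (sg_le _ _ (mE' n))
  have h2 : Tendsto (fun n => ∫ ω, ind (symmDiff E (E' n)) ω ∂ρ) atTop (𝓝 (∫ _, (0:ℝ) ∂ρ)) := by
    refine tendsto_int_bdd _ _ 1 (fun n => ind_meas (mS n)) (fun n => .of_forall (ind_abs _)) ?_
    filter_upwards [h1] with ω hω
    apply tendsto_const_nhds.congr'
    by_cases hm : ω ∈ E
    · rw [ind_of_mem hm] at hω
      filter_upwards [hω.eventually (lt_mem_nhds (show (1/2:ℝ) < 1 by norm_num))] with n hn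
      rw [ind_of_notMem]
      rw [Set.mem_symmDiff]
      have : ω ∈ E' n := hn
      tauto
    · rw [ind_of_notMem hm] at hω
      filter_upwards [hω.eventually (gt_mem_nhds (show (0:ℝ) < 1/2 by norm_num))] with n hn
      rw [ind_of_notMem]
      rw [Set.mem_symmDiff]
      have : ω ∉ E' n := fun h => (lt_irrefl _ (lt_trans (show (1/2:ℝ) < _ from h) hn))
      tauto
  simp only [ind_integral ρ (mS _), integral_zero] at h2
  obtain ⟨n, hn⟩ := (h2.eventually (gt_mem_nhds hη)).exists
  exact ⟨n, E' n, mE' n, hn⟩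

lemma setInt (μ : Measure Om) [IsFiniteMeasure μ] {m : MeasurableSpace Om}
    (hm : m ≤ MeasurableSpace.pi) {A B : Set Om} (hA : MeasurableSet[MeasurableSpace.pi] A)
    (hB : MeasurableSet[m] B) :
    ∫ ω, (μ[ind A|m]) ω * ind B ω ∂μ = μ.real (A ∩ B) := by
  rw [← pull_out hm _ _ (ind_integrable μ hA) (ind_meas hB) (.of_forall (ind_abs B))]
  simp only [← ind_inter]
  exact ind_integral μ (hA.inter (hm _ hB))

/-- the set where the conditional density of W in A is more than `1-δ` -/
def Dset (μ : Measure Om) (m : MeasurableSpace Om) (A W : Set Om) (δ : ℝ) : Set Om :=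
  {ω | (1 - δ) * (μ[ind A|m]) ω < (μ[ind (W ∩ A)|m]) ω}

lemma Dset_meas (μ : Measure Om) (m : MeasurableSpace Om) (A W : Set Om) (δ : ℝ) :
    MeasurableSet[m] (Dset μ m A W δ) :=
  lt_meas ((ce_meas (ind A)).const_mul (1 - δ)) (ce_meas _)

lemma cell_bound (μ : Measure Om) [IsProbabilityMeasure μ] {m : MeasurableSpace Om}
    (hm : m ≤ MeasurableSpace.pi) {A W W' V : Set Om} (hA : MeasurableSet[MeasurableSpace.pi] A)
    (hW : MeasurableSet[MeasurableSpace.pi] W) (hV : MeasurableSet[m] V)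
    (hVA : W' ∩ A = V ∩ A) (δ : ℝ) (hδ : 0 < δ) :
    μ.real (A ∩ W ∩ (Dset μ m A W δ)ᶜ) ≤ (1 + 1 / δ) * μ.real (A ∩ symmDiff W W') := by
  set D := Dset μ m A W δ with hD
  have mD : MeasurableSet[m] D := Dset_meas μ m A W δ
  have mU : MeasurableSet[m] (V ∩ Dᶜ) := hV.inter mD.compl
  have mU0 := hm _ mU
  have h1 := setInt μ hm hA mU
  have h2 := setInt μ hm (hW.inter hA) mU
  have h3 : μ.real (W ∩ A ∩ (V ∩ Dᶜ)) ≤ (1 - δ) * μ.real (A ∩ (V ∩ Dᶜ)) := by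
    rw [← h1, ← h2, ← integral_const_mul]
    have ib : ∀ B : Set Om, Integrable (fun ω => (μ[ind B|m]) ω * ind (V ∩ Dᶜ) ω) μ := by
      intro B
      refine integrable_condExp.mul_bdd (c := 1) (ind_meas mU0).aestronglyMeasurable
        (.of_forall (ind_abs _))
    refine integral_mono (ib _) ((ib _).const_mul _) fun ω => ?_
    by_cases hω : ω ∈ V ∩ Dᶜ
    · simp only [ind_of_mem hω, mul_one]
      exact not_lt.1 hω.2
    · simp [ind_of_notMem hω]
  have h4 : μ.real (A ∩ (V ∩ Dᶜ)) ≤ μ.real (W ∩ A ∩ (V ∩ Dᶜ)) + μ.real (A ∩ symmDiff W W') := by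
    refine (measureReal_mono ?_).trans (measureReal_union_le _ _)
    rintro ω ⟨ha, hv, hd⟩
    have : ω ∈ W' ∩ A := hVA ▸ ⟨hv, ha⟩
    by_cases hw : ω ∈ W
    · exact Or.inl ⟨⟨hw, ha⟩, hv, hd⟩
    · exact Or.inr ⟨ha, Or.inr ⟨this.1, hw⟩⟩
  have h5 : δ * μ.real (A ∩ (V ∩ Dᶜ)) ≤ μ.real (A ∩ symmDiff W W') := by linarith
  have h6 : μ.real (A ∩ (V ∩ Dᶜ)) ≤ 1 / δ * μ.real (A ∩ symmDiff W W') := by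
    rw [div_mul_eq_mul_div, one_mul, le_div_iff₀ hδ]; linarith
  have h7 : μ.real (A ∩ W ∩ Dᶜ) ≤ μ.real (A ∩ (V ∩ Dᶜ)) + μ.real (A ∩ symmDiff W W') := by
    refine (measureReal_mono ?_).trans (measureReal_union_le _ _)
    rintro ω ⟨⟨ha, hw⟩, hd⟩
    by_cases hw' : ω ∈ W'
    · have : ω ∈ V ∩ A := hVA ▸ ⟨hw', ha⟩
      exact Or.inl ⟨ha, this.1, hd⟩
    · exact Or.inr ⟨ha, Or.inl ⟨hw, hw'⟩⟩
  linarith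

/-- coordinates seen by the set `e` at level `j` -/
def Sj (s : ℕ) (e : Finset ℕ) (j : ℕ) : Set (Finset ℕ) := {v | sp s v ⊆ e ∧ (sp s v).card ≤ j}

def Lj (s : ℕ) (j : ℕ) : Set (Finset ℕ) := {v | (sp s v).card ≤ j}

def Gn (s : ℕ) (e : Finset ℕ) (j n : ℕ) : Set (Finset ℕ) :=
  {v | sp s v ⊆ e ∧ (sp s v).card ≤ j + 1 ∧ ((sp s v).card ≤ j ∨ v ⊆ Finset.range n)}

lemma Gn_mono (s e j) : Monotone (Gn s e j) := by
  intro a b hab v hv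
  exact ⟨hv.1, hv.2.1, hv.2.2.imp id fun h => h.trans (Finset.range_mono hab)⟩

lemma Gn_iUnion (s e j) : (⋃ n, Gn s e j n) = Sj s e (j+1) := by
  ext v
  simp only [Set.mem_iUnion, Gn, Sj, Set.mem_ofPred_eq]
  constructor
  · rintro ⟨n, h, h2, -⟩; exact ⟨h, h2⟩
  · intro h
    refine ⟨v.sup id + 1, h.1, h.2, Or.inr fun x hx => ?_⟩
    have := Finset.le_sup (f := id) hx
    simp only [id] at this
    simp; omega

def Fn (s j n : ℕ) : Finset (Finset ℕ) :=
  (Finset.range n).powerset.filter (fun v => (sp s v).card = j + 1)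

def cellA (s j n : ℕ) (a : Finset (Finset ℕ)) (e : Finset ℕ) : Set Om :=
  {ω | ∀ v ∈ Fn s j n, sp s v ⊆ e → (ω v = true ↔ v ∈ a)}

def cellF (s j n : ℕ) (a : Finset (Finset ℕ)) (f : Finset ℕ) : Set Om :=
  {ω | ∀ v ∈ Fn s j n, sp s v = f → (ω v = true ↔ v ∈ a)}

lemma coord_meas (Q : Set (Finset ℕ)) (v : Finset ℕ) (hv : v ∈ Q) (p : Prop) :
    MeasurableSet[sg Q] {ω : Om | ω v = true ↔ p} := by
  have h : Measurable[sg Q] (fun ω : Om => ω v) :=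
    measurable_cylinderEvent_apply (X := fun _ : Finset ℕ => Bool) hv
  by_cases hp : p
  · have : {ω : Om | ω v = true ↔ p} = (fun ω : Om => ω v) ⁻¹' {true} := by ext; simp [hp]
    rw [this]; exact h (MeasurableSet.singleton _)
  · have : {ω : Om | ω v = true ↔ p} = (fun ω : Om => ω v) ⁻¹' {false} := by ext; simp [hp]
    rw [this]; exact h (MeasurableSet.singleton _)

lemma cell_meas_gen (Q : Set (Finset ℕ)) (F : Finset (Finset ℕ)) (a : Finset (Finset ℕ))
    (p : Finset ℕ → Prop) (h : ∀ v ∈ F, p v → v ∈ Q) :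
    MeasurableSet[sg Q] {ω : Om | ∀ v ∈ F, p v → (ω v = true ↔ v ∈ a)} := by
  have : {ω : Om | ∀ v ∈ F, p v → (ω v = true ↔ v ∈ a)} =
      ⋂ v ∈ F.filter p, {ω : Om | ω v = true ↔ v ∈ a} := by
    ext ω; simp
  rw [this]
  refine @Finset.measurableSet_biInter _ _ (sg Q) _ _ fun v hv => ?_
  rw [Finset.mem_filter] at hv
  exact coord_meas Q v (h v hv.1 hv.2) _

lemma cellA_meas (s j n a e) : MeasurableSet[sg (Sj s e (j+1))] (cellA s j n a e) := by
  refine cell_meas_gen _ _ _ _ fun v hv h => ⟨h, ?_⟩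
  simp only [Fn, Finset.mem_filter] at hv
  exact hv.2.le

lemma cellF_meas (s j n a f) : MeasurableSet[sg {v | sp s v = f}] (cellF s j n a f) :=
  cell_meas_gen _ _ _ _ fun _ _ h => h

lemma cell_trace (s j n a e) (S : Set Om) (hS : MeasurableSet[sg (Gn s e j n)] S) :
    ∃ V, MeasurableSet[sg (Sj s e j)] V ∧ S ∩ cellA s j n a e = V ∩ cellA s j n a e := by
  set A := cellA s j n a e with hA
  let m : MeasurableSpace Om :=
    { MeasurableSet' := fun S => ∃ V, MeasurableSet[sg (Sj s e j)] V ∧ S ∩ A = V ∩ A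
      measurableSet_empty := ⟨∅, @MeasurableSet.empty _ (sg (Sj s e j)), rfl⟩
      measurableSet_compl := by
        rintro S ⟨V, hV, h⟩
        refine ⟨Vᶜ, hV.compl, ?_⟩
        ext ω
        have := Set.ext_iff.1 h ω
        simp only [Set.mem_inter_iff, Set.mem_compl_iff] at this ⊢
        tauto
      measurableSet_iUnion := by
        intro S hS
        choose V hV h using hS
        refine ⟨⋃ i, V i, MeasurableSet.iUnion hV, ?_⟩
        rw [Set.iUnion_inter, Set.iUnion_inter]
        exact Set.iUnion_congr h }
  have : sg (Gn s e j n) ≤ m := by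
    refine iSup₂_le fun v hv => ?_
    rintro _ ⟨t, ht, rfl⟩
    change ∃ V, MeasurableSet[sg (Sj s e j)] V ∧ _ ∩ A = V ∩ A
    by_cases hj : (sp s v).card ≤ j
    · refine ⟨_, ?_, rfl⟩
      have h : Measurable[sg (Sj s e j)] (fun ω : Om => ω v) :=
        measurable_cylinderEvent_apply (X := fun _ : Finset ℕ => Bool) ⟨hv.1, hj⟩
      exact h ht
    · have hvF : v ∈ Fn s j n := by
        simp only [Fn, Finset.mem_filter, Finset.mem_powerset]
        exact ⟨hv.2.2.resolve_left hj, by have := hv.2.1; omega⟩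
      refine ⟨{ω | decide (v ∈ a) ∈ t}, ?_, ?_⟩
      · by_cases h : decide (v ∈ a) ∈ t
        · simp only [h]; exact @MeasurableSet.univ _ (sg (Sj s e j))
        · simp only [h]; exact @MeasurableSet.empty _ (sg (Sj s e j))
      · ext ω
        simp only [Set.mem_inter_iff, Set.mem_preimage, Set.mem_ofPred_eq]
        refine and_congr_left fun hω => ?_
        have : ω v = decide (v ∈ a) := by
          have := hω v hvF hv.1
          by_cases h : v ∈ a <;> simp_all
        rw [this]
  exact this S hS

end

end

section
open MeasureTheory Filter Topology

noncomputable section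

lemma pf_eq (μ : Measure Om) [IsProbabilityMeasure μ] (hI : InvT μ) (s j : ℕ) (f : Finset ℕ)
    (hf : f ⊆ Finset.range s) (hc : f.card = j + 1) (X : Om → ℝ)
    (hX : Measurable[sg {v | sp s v ⊆ f}] X) (hb : ∀ ω, |X ω| ≤ 1) :
    μ[X|sg {v | ¬ f ⊆ sp s v}] =ᵐ[μ] μ[X|sg (Lj s j)] := by
  have h1 := RI μ hI s f hf {g | ¬ f ⊆ g} (fun a ha b hba h => ha (h.trans hba)) X hX hb
  have h2 := RI μ hI s f hf {g | g.card ≤ j}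
    (fun a ha b hba => (Finset.card_le_card hba).trans ha) X hX hb
  have e : {v | sp s v ∈ {g | ¬ f ⊆ g} ∧ sp s v ⊆ f} = {v | sp s v ∈ {g | g.card ≤ j} ∧ sp s v ⊆ f} := by
    ext v
    simp only [Set.mem_ofPred_eq]
    refine and_congr_left fun hv => ?_
    constructor
    · intro h
      by_contra h'
      exact h (Finset.eq_of_subset_of_card_le hv (by omega)).superset
    · intro h h'
      have := Finset.card_le_card h'
      omega
  rw [e] at h1
  exact h1.trans h2.symm

lemma mul_bdd_ae {μ : Measure Om} {f g : Om → ℝ} (hf : ∀ᵐ ω ∂μ, |f ω| ≤ 1)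
    (hg : ∀ᵐ ω ∂μ, |g ω| ≤ 1) : ∀ᵐ ω ∂μ, |f ω * g ω| ≤ 1 := by
  filter_upwards [hf, hg] with ω h1 h2
  rw [abs_mul]
  exact mul_le_one₀ h1 (abs_nonneg _) h2

lemma prod_formula (μ : Measure Om) [IsProbabilityMeasure μ] (hI : InvT μ) (s j : ℕ)
    (A : Finset ℕ → Set Om) (hA : ∀ f, MeasurableSet[sg {v | sp s v = f}] (A f))
    (R : Set (Finset ℕ)) (hjR : Lj s j ⊆ R)
    (𝓕 : Finset (Finset ℕ)) (h𝓕 : ∀ f ∈ 𝓕, f ⊆ Finset.range s ∧ f.card = j + 1)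
    (hR : ∀ v ∈ R, ∀ f ∈ 𝓕, ¬ f ⊆ sp s v) (Z : Om → ℝ) (hZ : Measurable[sg R] Z)
    (hb : ∀ᵐ ω ∂μ, |Z ω| ≤ 1) :
    ∫ ω, Z ω * ∏ f ∈ 𝓕, ind (A f) ω ∂μ = ∫ ω, Z ω * ∏ f ∈ 𝓕, (μ[ind (A f)|sg (Lj s j)]) ω ∂μ := by
  induction 𝓕 using Finset.induction_on generalizing Z with
  | empty => simp
  | insert f 𝓕 hf ih =>
    have hfc := h𝓕 f (Finset.mem_insert_self _ _)
    set p := μ[ind (A f)|sg (Lj s j)] with hp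
    have mAf0 : MeasurableSet (A f) := sg_le _ _ (hA f)
    have hY : Measurable[sg {v | ¬ f ⊆ sp s v}] (fun ω => Z ω * ind (⋂ g ∈ 𝓕, A g) ω) := by
      refine Measurable.mul (hZ.mono (sg_mono fun v hv => hR v hv f (Finset.mem_insert_self _ _)) le_rfl) ?_
      refine ind_meas (@Finset.measurableSet_biInter _ _ (sg _) _ _ fun g hg => ?_)
      refine sg_mono ?_ _ (hA g)
      intro v hv hsub
      have hv' : sp s v = g := hv
      rw [hv'] at hsub
      have := h𝓕 g (Finset.mem_insert_of_mem hg)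
      have := Finset.eq_of_subset_of_card_le hsub (by omega)
      exact hf (this ▸ hg)
    have hYb : ∀ᵐ ω ∂μ, |Z ω * ind (⋂ g ∈ 𝓕, A g) ω| ≤ 1 := mul_bdd_ae hb (.of_forall (ind_abs _))
    have h1 := pull_out (sg_le _) (ind (A f)) _ (ind_integrable μ mAf0) hY hYb
    have h2 := pf_eq μ hI s j f hfc.1 hfc.2 (ind (A f))
      ((ind_meas (hA f)).mono (sg_mono fun v hv => (show sp s v = f from hv).le) le_rfl) (ind_abs _)
    have bp : ∀ᵐ ω ∂μ, |p ω| ≤ 1 := condExp_bdd _ (.of_forall (ind_abs _))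
    have h3 := ih (fun g hg => h𝓕 g (Finset.mem_insert_of_mem hg))
      (fun v hv g hg => hR v hv g (Finset.mem_insert_of_mem hg)) (fun ω => Z ω * p ω)
      (hZ.mul ((ce_meas _).mono (sg_mono hjR) le_rfl)) (mul_bdd_ae hb bp)
    calc ∫ ω, Z ω * ∏ f ∈ insert f 𝓕, ind (A f) ω ∂μ
        = ∫ ω, ind (A f) ω * (Z ω * ind (⋂ g ∈ 𝓕, A g) ω) ∂μ := by
          refine integral_congr_ae (.of_forall fun ω => ?_)
          simp only [Finset.prod_insert hf, ind_prod]; ring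
      _ = ∫ ω, (Z ω * p ω) * ∏ g ∈ 𝓕, ind (A g) ω ∂μ := by
          rw [h1]
          refine integral_congr_ae ?_
          filter_upwards [h2] with ω hω
          simp only [ind_prod, hω]; ring
      _ = _ := by
          rw [h3]
          refine integral_congr_ae (.of_forall fun ω => ?_)
          simp only [Finset.prod_insert hf]; ring

lemma prod_bdd_ae {μ : Measure Om} {ι : Type*} (S : Finset ι) (g : ι → Om → ℝ)
    (h : ∀ i ∈ S, ∀ᵐ ω ∂μ, |g i ω| ≤ 1) : ∀ᵐ ω ∂μ, |∏ i ∈ S, g i ω| ≤ 1 := by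
  induction S using Finset.induction_on with
  | empty => simp
  | insert a S ha ih =>
    have := mul_bdd_ae (h a (Finset.mem_insert_self _ _))
      (ih fun i hi => h i (Finset.mem_insert_of_mem hi))
    simpa only [Finset.prod_insert ha] using this

/-- identity for `Y` in the sigma-algebra of `e` -/
lemma e_formula (μ : Measure Om) [IsProbabilityMeasure μ] (hI : InvT μ) (s j : ℕ)
    (A : Finset ℕ → Set Om) (hA : ∀ f, MeasurableSet[sg {v | sp s v = f}] (A f))
    (𝓕 : Finset (Finset ℕ)) (h𝓕 : ∀ f ∈ 𝓕, f ⊆ Finset.range s ∧ f.card = j + 1)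
    (e : Finset ℕ) (he : e ⊆ Finset.range s) (h𝓕e : ∀ f ∈ 𝓕, ¬ f ⊆ e)
    (D Y : Set Om) (hD : MeasurableSet[sg (Lj s j)] D)
    (hY : MeasurableSet[sg {v | sp s v ⊆ e}] Y) :
    μ.real (D ∩ Y ∩ ⋂ f ∈ 𝓕, A f) =
      ∫ ω, (μ[ind Y|sg (Sj s e j)]) ω * (ind D ω * ∏ f ∈ 𝓕, (μ[ind (A f)|sg (Lj s j)]) ω) ∂μ := by
  have hL : ∀ v ∈ Lj s j, ∀ f ∈ 𝓕, ¬ f ⊆ sp s v := by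
    intro v hv f hf hsub
    have h1 := Finset.card_le_card hsub
    have h2 : (sp s v).card ≤ j := hv
    have := (h𝓕 f hf).2
    omega
  have mD : MeasurableSet D := sg_le _ _ hD
  have mY : MeasurableSet Y := sg_le _ _ hY
  have mA : MeasurableSet (⋂ f ∈ 𝓕, A f) :=
    Finset.measurableSet_biInter _ fun f _ => sg_le _ _ (hA f)
  have h1 := prod_formula μ hI s j A hA (Lj s j ∪ {v | sp s v ⊆ e}) Set.subset_union_left 𝓕 h𝓕
    (by
      rintro v (hv | hv) f hf hsub
      · exact hL v hv f hf hsub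
      · exact h𝓕e f hf (hsub.trans hv)) (ind (D ∩ Y))
    (ind_meas ((sg_mono Set.subset_union_left _ hD).inter (sg_mono Set.subset_union_right _ hY)))
    (.of_forall (ind_abs _))
  have h2 := pull_out (μ := μ) (sg_le (Lj s j)) (ind Y)
    (fun ω => ind D ω * ∏ f ∈ 𝓕, (μ[ind (A f)|sg (Lj s j)]) ω) (ind_integrable μ mY)
    ((ind_meas hD).mul (Finset.measurable_fun_prod _ fun f _ => ce_meas _))
    (mul_bdd_ae (.of_forall (ind_abs _)) (prod_bdd_ae _ _ fun f _ =>
      condExp_bdd _ (.of_forall (ind_abs _))))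
  have h3 := RI μ hI s e he {g | g.card ≤ j}
    (fun a ha b hba => (Finset.card_le_card hba).trans ha) (ind Y) (ind_meas hY) (ind_abs _)
  have e3 : {v | sp s v ∈ {g : Finset ℕ | g.card ≤ j} ∧ sp s v ⊆ e} = Sj s e j := by
    ext v; simp only [Sj, Set.mem_ofPred_eq]; tauto
  rw [e3] at h3
  rw [← ind_integral μ ((mD.inter mY).inter mA)]
  calc ∫ ω, ind (D ∩ Y ∩ ⋂ f ∈ 𝓕, A f) ω ∂μ
      = ∫ ω, ind (D ∩ Y) ω * ∏ f ∈ 𝓕, ind (A f) ω ∂μ := by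
        simp only [ind_prod, ← ind_inter]
    _ = ∫ ω, ind Y ω * (ind D ω * ∏ f ∈ 𝓕, (μ[ind (A f)|sg (Lj s j)]) ω) ∂μ := by
        rw [h1]
        refine integral_congr_ae (.of_forall fun ω => ?_)
        simp only [ind_inter]; ring
    _ = _ := by
        rw [h2]
        refine integral_congr_ae ?_
        filter_upwards [h3] with ω hω
        rw [← hω]
        rfl

lemma ind_condExp_mono (μ : Measure Om) [IsProbabilityMeasure μ] (m : MeasurableSpace Om)
    {A B : Set Om} (hA : MeasurableSet[MeasurableSpace.pi] A) (hB : MeasurableSet[MeasurableSpace.pi] B) (h : A ⊆ B) :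
    ∀ᵐ ω ∂μ, (μ[ind A|m]) ω ≤ (μ[ind B|m]) ω :=
  condExp_mono (ind_integrable μ hA) (ind_integrable μ hB) (.of_forall (ind_mono h))

lemma ind_condExp_nonneg (μ : Measure Om) (m : MeasurableSpace Om) (A : Set Om) :
    ∀ᵐ ω ∂μ, 0 ≤ (μ[ind A|m]) ω :=
  condExp_nonneg (.of_forall (ind_nonneg A))

/-- Counting step: if `μ(∩ D_e) > 0` then `μ(∩ W_e) > 0`. -/
lemma count_step (μ : Measure Om) [IsProbabilityMeasure μ] (hI : InvT μ) (s j : ℕ)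
    (A : Finset ℕ → Set Om) (hA : ∀ f, MeasurableSet[sg {v | sp s v = f}] (A f))
    (𝓔 : Finset (Finset ℕ)) (h𝓔 : ∀ e ∈ 𝓔, e ⊆ Finset.range s)
    (W : Finset ℕ → Set Om) (hW : ∀ e ∈ 𝓔, MeasurableSet[sg {v | sp s v ⊆ e}] (W e))
    (Ae : Finset ℕ → Set Om) (hAe : ∀ e ∈ 𝓔, Ae e = ⋂ f ∈ (e.powersetCard (j+1)), A f)
    (δ : ℝ) (hδ : 0 < δ) (hδ' : δ * 𝓔.card < 1)
    (hpos : 0 < μ.real (⋂ e ∈ 𝓔, Dset μ (sg (Sj s e j)) (Ae e) (W e) δ)) :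
    0 < μ.real (⋂ e ∈ 𝓔, W e) := by
  set Dd : Finset ℕ → Set Om := fun e => Dset μ (sg (Sj s e j)) (Ae e) (W e) δ with hDd
  set D := ⋂ e ∈ 𝓔, Dd e with hD
  set 𝓕 : Finset (Finset ℕ) := 𝓔.biUnion fun e => e.powersetCard (j+1) with h𝓕
  have h𝓕' : ∀ f ∈ 𝓕, f ⊆ Finset.range s ∧ f.card = j + 1 := by
    intro f hf
    simp only [h𝓕, Finset.mem_biUnion, Finset.mem_powersetCard] at hf
    obtain ⟨e, he, hfe, hc⟩ := hf
    exact ⟨hfe.trans (h𝓔 e he), hc⟩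
  have mDL : MeasurableSet[sg (Lj s j)] D := by
    refine @Finset.measurableSet_biInter _ _ (sg _) _ _ fun e he => ?_
    exact sg_mono (fun v hv => hv.2) _ (Dset_meas μ (sg (Sj s e j)) (Ae e) (W e) δ)
  have mD : MeasurableSet D := sg_le _ _ mDL
  have mA0 : ∀ f, MeasurableSet (A f) := fun f => sg_le _ _ (hA f)
  have mAe : ∀ e ∈ 𝓔, MeasurableSet[sg {v | sp s v ⊆ e}] (Ae e) := by
    intro e he
    rw [hAe e he]
    refine @Finset.measurableSet_biInter _ _ (sg _) _ _ fun f hf => ?_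
    refine sg_mono ?_ _ (hA f)
    intro v hv
    rw [Finset.mem_powersetCard] at hf
    exact (show sp s v = f from hv).le.trans hf.1
  have mAe0 : ∀ e ∈ 𝓔, MeasurableSet (Ae e) := fun e he => sg_le _ _ (mAe e he)
  have mW0 : ∀ e ∈ 𝓔, MeasurableSet (W e) := fun e he => sg_le _ _ (hW e he)
  set p : Finset ℕ → Om → ℝ := fun f => μ[ind (A f)|sg (Lj s j)] with hp
  have bp : ∀ f, ∀ᵐ ω ∂μ, |p f ω| ≤ 1 := fun f => condExp_bdd _ (.of_forall (ind_abs _))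
  set AA := ⋂ f ∈ 𝓕, A f with hAA
  have mAA : MeasurableSet AA := Finset.measurableSet_biInter _ fun f _ => mA0 f
  -- on D_e, conditional probability of Ae is positive
  have posAe : ∀ e ∈ 𝓔, ∀ᵐ ω ∂μ, ω ∈ Dd e → 0 < (μ[ind (Ae e)|sg (Sj s e j)]) ω := by
    intro e he
    filter_upwards [ind_condExp_mono μ (sg (Sj s e j)) ((mW0 e he).inter (mAe0 e he)) (mAe0 e he)
      Set.inter_subset_right] with ω h1 h2
    have h3 : (1 - δ) * (μ[ind (Ae e)|sg (Sj s e j)]) ω < (μ[ind (W e ∩ Ae e)|sg (Sj s e j)]) ω := h2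
    nlinarith
  have posp : ∀ f ∈ 𝓕, ∀ᵐ ω ∂μ, ω ∈ D → 0 < p f ω := by
    intro f hf
    have hf' := hf
    simp only [h𝓕, Finset.mem_biUnion] at hf
    obtain ⟨e, he, hfe⟩ := hf
    have hsub : Ae e ⊆ A f := by
      rw [hAe e he]; exact Set.biInter_subset_of_mem hfe
    have h3 := RI μ hI s e (h𝓔 e he) {g | g.card ≤ j}
      (fun a ha b hba => (Finset.card_le_card hba).trans ha) (ind (Ae e))
      (ind_meas (mAe e he)) (ind_abs _)
    have e3 : {v | sp s v ∈ {g : Finset ℕ | g.card ≤ j} ∧ sp s v ⊆ e} = Sj s e j := by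
      ext v; simp only [Sj, Set.mem_ofPred_eq]; tauto
    rw [e3] at h3
    filter_upwards [posAe e he, h3, ind_condExp_mono μ (sg (Lj s j)) (mAe0 e he) (mA0 f) hsub]
      with ω h1 h2 h4 h5
    have h6 := h1 (Set.mem_iInter₂.1 h5 e he)
    rw [← h2] at h6
    exact lt_of_lt_of_le h6 h4
  -- measure of D ∩ AA positive
  have f1 : μ.real (D ∩ AA) = ∫ ω, ind D ω * ∏ f ∈ 𝓕, p f ω ∂μ := by
    rw [← ind_integral μ (mD.inter mAA)]
    simp only [ind_inter, hAA, ← ind_prod]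
    refine prod_formula μ hI s j A hA (Lj s j) subset_rfl 𝓕 h𝓕' ?_ (ind D) (ind_meas mDL)
      (.of_forall (ind_abs _))
    intro v hv f hf hsub
    have h1 := Finset.card_le_card hsub
    have h2 : (sp s v).card ≤ j := hv
    have := (h𝓕' f hf).2
    omega
  have posall : ∀ᵐ ω ∂μ, ω ∈ D → 0 < ∏ f ∈ 𝓕, p f ω := by
    have : ∀ᵐ ω ∂μ, ∀ f ∈ 𝓕, ω ∈ D → 0 < p f ω := (ae_ball_iff 𝓕.countable_toSet).2 posp
    filter_upwards [this] with ω h hD'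
    exact Finset.prod_pos fun f hf => h f hf hD'
  have mprod : Measurable (fun ω => ind D ω * ∏ f ∈ 𝓕, p f ω) :=
    (ind_meas mD).mul (Finset.measurable_fun_prod _ fun f _ => (ce_meas _).mono (sg_le _) le_rfl)
  have bprod : ∀ᵐ ω ∂μ, |ind D ω * ∏ f ∈ 𝓕, p f ω| ≤ 1 :=
    mul_bdd_ae (.of_forall (ind_abs _)) (prod_bdd_ae _ _ fun f _ => bp f)
  have f2 : 0 < μ.real (D ∩ AA) := by
    rw [f1]
    rw [integral_pos_iff_support_of_nonneg_ae _ (integrable_bdd _ mprod bprod)]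
    · have h0 : 0 < μ D := by
        rw [measureReal_def] at hpos
        exact (ENNReal.toReal_pos_iff.1 hpos).1
      refine lt_of_lt_of_le h0 (measure_mono_ae ?_)
      filter_upwards [posall] with ω h hω
      have := h hω
      change ind D ω * ∏ f ∈ 𝓕, p f ω ≠ 0
      rw [ind_of_mem hω]
      positivity
    · filter_upwards [posall] with ω h
      by_cases hω : ω ∈ D
      · have := h hω
        simp only [ind_of_mem hω, Pi.zero_apply, one_mul]
        exact this.le
      · simp [ind_of_notMem hω]
  -- each bad part is small
  have f3 : ∀ e ∈ 𝓔, μ.real (D ∩ AA ∩ (W e)ᶜ) ≤ δ * μ.real (D ∩ AA) := by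
    intro e he
    set 𝓕e := 𝓕.filter fun f => ¬ f ⊆ e with h𝓕e
    have hsplit : AA = Ae e ∩ ⋂ f ∈ 𝓕e, A f := by
      rw [hAe e he]
      ext ω
      simp only [hAA, Set.mem_inter_iff, Set.mem_iInter, h𝓕e, Finset.mem_filter,
        Finset.mem_powersetCard]
      constructor
      · intro h
        refine ⟨fun f hf => h f ?_, fun f hf => h f hf.1⟩
        simp only [h𝓕, Finset.mem_biUnion, Finset.mem_powersetCard]
        exact ⟨e, he, hf⟩
      · rintro ⟨h1, h2⟩ f hf
        by_cases hfe : f ⊆ e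
        · exact h1 f ⟨hfe, (h𝓕' f hf).2⟩
        · exact h2 f ⟨hf, hfe⟩
    have g1 := e_formula μ hI s j A hA 𝓕e (fun f hf => h𝓕' f (Finset.mem_filter.1 hf).1) e
      (h𝓔 e he) (fun f hf => (Finset.mem_filter.1 hf).2) D (Ae e) mDL (mAe e he)
    have g2 := e_formula μ hI s j A hA 𝓕e (fun f hf => h𝓕' f (Finset.mem_filter.1 hf).1) e
      (h𝓔 e he) (fun f hf => (Finset.mem_filter.1 hf).2) D (W e ∩ Ae e) mDL
      ((hW e he).inter (mAe e he))
    have k1 : D ∩ Ae e ∩ ⋂ f ∈ 𝓕e, A f = D ∩ AA := by rw [hsplit, Set.inter_assoc]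
    have k2 : D ∩ (W e ∩ Ae e) ∩ ⋂ f ∈ 𝓕e, A f = D ∩ AA ∩ W e := by
      rw [hsplit]; ext ω; simp only [Set.mem_inter_iff]; tauto
    rw [k1] at g1
    rw [k2] at g2
    have k3 : μ.real (D ∩ AA ∩ W e) + μ.real (D ∩ AA ∩ (W e)ᶜ) = μ.real (D ∩ AA) := by
      have := measureReal_inter_add_sdiff (μ := μ) (s := D ∩ AA) (mW0 e he)
      rwa [Set.sdiff_eq] at this
    have mP : Measurable (fun ω => ind D ω * ∏ f ∈ 𝓕e, p f ω) :=
      (ind_meas mD).mul (Finset.measurable_fun_prod _ fun f _ => (ce_meas _).mono (sg_le _) le_rfl)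
    have bP : ∀ᵐ ω ∂μ, |ind D ω * ∏ f ∈ 𝓕e, p f ω| ≤ 1 :=
      mul_bdd_ae (.of_forall (ind_abs _)) (prod_bdd_ae _ _ fun f _ => bp f)
    have iP : ∀ B : Set Om, Integrable (fun ω => (μ[ind B|sg (Sj s e j)]) ω *
        (ind D ω * ∏ f ∈ 𝓕e, p f ω)) μ := by
      intro B
      exact integrable_condExp.mul_bdd (c := 1) mP.aestronglyMeasurable bP
    have g3 : (1 - δ) * μ.real (D ∩ AA) ≤ μ.real (D ∩ AA ∩ W e) := by
      rw [g1, g2, ← integral_const_mul]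
      refine integral_mono_ae ((iP _).const_mul _) (iP _) ?_
      have nn : ∀ᵐ ω ∂μ, ∀ f ∈ 𝓕e, 0 ≤ p f ω :=
        (ae_ball_iff 𝓕e.countable_toSet).2 fun f _ => ind_condExp_nonneg μ _ _
      filter_upwards [nn] with ω hω
      have hP : 0 ≤ ∏ f ∈ 𝓕e, p f ω := Finset.prod_nonneg hω
      by_cases hωD : ω ∈ D
      · have h3 : (1 - δ) * (μ[ind (Ae e)|sg (Sj s e j)]) ω <
            (μ[ind (W e ∩ Ae e)|sg (Sj s e j)]) ω := Set.mem_iInter₂.1 hωD e he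
        simp only [ind_of_mem hωD, one_mul]
        rw [← mul_assoc]
        exact mul_le_mul_of_nonneg_right h3.le hP
      · simp [ind_of_notMem hωD]
    linarith
  have f4 : μ.real (D ∩ AA) ≤ μ.real (⋂ e ∈ 𝓔, W e) + ∑ e ∈ 𝓔, μ.real (D ∩ AA ∩ (W e)ᶜ) := by
    refine (measureReal_mono (s₂ := (⋂ e ∈ 𝓔, W e) ∪ ⋃ e ∈ 𝓔, (D ∩ AA ∩ (W e)ᶜ)) ?_).trans
      ((measureReal_union_le _ _).trans
        (add_le_add_right (measureReal_biUnion_finset_le _ _) _))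
    intro ω hω
    by_cases h : ω ∈ ⋂ e ∈ 𝓔, W e
    · exact Or.inl h
    · right
      simp only [Set.mem_iInter, not_forall] at h
      obtain ⟨e, he, hw⟩ := h
      exact Set.mem_biUnion he ⟨hω, hw⟩
  have f5 : ∑ e ∈ 𝓔, μ.real (D ∩ AA ∩ (W e)ᶜ) ≤ 𝓔.card * (δ * μ.real (D ∩ AA)) := by
    have := Finset.sum_le_card_nsmul 𝓔 _ _ f3
    simpa using this
  nlinarith

end

end

section
open MeasureTheory Filter Topology

noncomputable section

structure GoodP (s d : ℕ) (K : ℝ) (μ ν : Measure Om) : Prop where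
  pμ : IsProbabilityMeasure μ
  pν : IsProbabilityMeasure ν
  inv : InvT μ
  dom : ∀ e ⊆ Finset.range s, e.card = d → ∀ E, MeasurableSet[sg {v | sp s v ⊆ e}] E →
    ν.real E ≤ K * μ.real E
  one : ∀ e ⊆ Finset.range s, e.card = d → ν.real {ω : Om | ω e = true} = 1

lemma cellA_inter (s j n a e) (he : e ⊆ Finset.range s) :
    cellA s j n a e = ⋂ f ∈ e.powersetCard (j+1), cellF s j n a f := by
  ext ω
  simp only [cellA, cellF, Set.mem_iInter, Set.mem_ofPred_eq, Finset.mem_powersetCard]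
  constructor
  · rintro h f ⟨hf, -⟩ v hv rfl
    exact h v hv hf
  · intro h v hv hve
    refine h (sp s v) ⟨hve, ?_⟩ v hv rfl
    simp only [Fn, Finset.mem_filter] at hv
    exact hv.2

lemma cellA_filter (s j n a e) :
    cellA s j n (a.filter fun v => sp s v ⊆ e) e = cellA s j n a e := by
  ext ω
  simp only [cellA, Set.mem_ofPred_eq, Finset.mem_filter]
  refine forall_congr' fun v => forall_congr' fun hv => forall_congr' fun h => ?_
  simp [h]

lemma descend (s d : ℕ) (K : ℝ) (hK : 0 < K) (μ ν : Measure Om) (hg : GoodP s d K μ ν) (j : ℕ)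
    (W : Finset ℕ → Set Om)
    (hW : ∀ e ∈ (Finset.range s).powersetCard d, MeasurableSet[sg (Sj s e (j+1))] (W e))
    (hν : 0 < ν.real (⋂ e ∈ (Finset.range s).powersetCard d, W e)) :
    ∃ W' : Finset ℕ → Set Om,
      (∀ e ∈ (Finset.range s).powersetCard d, MeasurableSet[sg (Sj s e j)] (W' e)) ∧
      0 < ν.real (⋂ e ∈ (Finset.range s).powersetCard d, W' e) ∧
      (0 < μ.real (⋂ e ∈ (Finset.range s).powersetCard d, W' e) →
        0 < μ.real (⋂ e ∈ (Finset.range s).powersetCard d, W e)) := by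
  have := hg.pμ
  have := hg.pν
  set 𝓔 := (Finset.range s).powersetCard d with h𝓔
  set N : ℝ := (𝓔.card : ℝ) with hN
  have hN0 : 0 ≤ N := Nat.cast_nonneg _
  set δ : ℝ := 1 / (2 * (N + 1)) with hδ
  have hδ0 : 0 < δ := by positivity
  have hδ1 : δ * 𝓔.card < 1 := by
    rw [hδ, div_mul_eq_mul_div, one_mul, div_lt_one (by positivity)]; linarith
  set η : ℝ := ν.real (⋂ e ∈ 𝓔, W e) / (2 * (N + 1) * (K * (1 + 1 / δ))) with hη
  have hη0 : 0 < η := by positivity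
  have he𝓔 : ∀ e ∈ 𝓔, e ⊆ Finset.range s ∧ e.card = d := fun e he => Finset.mem_powersetCard.1 he
  have hap : ∀ e ∈ 𝓔, ∃ n W', MeasurableSet[sg (Gn s e j n)] W' ∧ μ.real (symmDiff (W e) W') < η := by
    intro e he
    exact approx μ (Gn s e j) (Gn_mono s e j) (W e) (by rw [Gn_iUnion]; exact hW e he) η hη0
  choose! n' Wt hWt hWtη using hap
  set n := 𝓔.sup n' with hn
  have hWt' : ∀ e ∈ 𝓔, MeasurableSet[sg (Gn s e j n)] (Wt e) := fun e he =>
    sg_mono (Gn_mono s e j (Finset.le_sup he)) _ (hWt e he)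
  set De : Finset (Finset ℕ) → Finset ℕ → Set Om := fun a e =>
    Dset μ (sg (Sj s e j)) (cellA s j n a e) (W e) δ with hDe
  have hSj : ∀ e, Sj s e j ⊆ {v | sp s v ⊆ e} := fun e v hv => hv.1
  have hSj1 : ∀ e, Sj s e (j+1) ⊆ {v | sp s v ⊆ e} := fun e v hv => hv.1
  have mW : ∀ e ∈ 𝓔, MeasurableSet (W e) := fun e he => sg_le _ _ (hW e he)
  have mA : ∀ a e, MeasurableSet (cellA s j n a e) := fun a e => sg_le _ _ (cellA_meas s j n a e)
  set piece : Finset ℕ → Finset (Finset ℕ) → Set Om := fun e a =>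
    cellA s j n a e ∩ W e ∩ (De a e)ᶜ with hpiece
  set Fe : Finset ℕ → Finset (Finset (Finset ℕ)) := fun e =>
    ((Fn s j n).filter fun v => sp s v ⊆ e).powerset with hFe
  set Bad : Finset ℕ → Set Om := fun e => ⋃ a ∈ Fe e, piece e a with hBad
  have mpiece : ∀ e ∈ 𝓔, ∀ a, MeasurableSet[sg {v | sp s v ⊆ e}] (piece e a) := by
    intro e he a
    refine ((sg_mono (hSj1 e) _ (cellA_meas s j n a e)).inter (sg_mono (hSj1 e) _ (hW e he))).inter
      (sg_mono (hSj e) _ (Dset_meas _ _ _ _ _).compl)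
  have mBad : ∀ e ∈ 𝓔, MeasurableSet[sg {v | sp s v ⊆ e}] (Bad e) := by
    intro e he
    exact Finset.measurableSet_biUnion _ fun a _ => mpiece e he a
  have hdisj : ∀ e, Set.PairwiseDisjoint (Fe e : Set (Finset (Finset ℕ)))
      (fun a => cellA s j n a e ∩ symmDiff (W e) (Wt e)) := by
    intro e a ha b hb hab
    refine Set.disjoint_left.2 ?_
    rintro ω ⟨h1, -⟩ ⟨h2, -⟩
    apply hab
    simp only [hFe, Finset.coe_powerset, Set.mem_preimage, Set.mem_powerset_iff,
      Finset.coe_subset] at ha hb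
    ext v
    constructor
    · intro hv
      have := Finset.mem_filter.1 (ha hv)
      exact (h2 v this.1 this.2).1 ((h1 v this.1 this.2).2 hv)
    · intro hv
      have := Finset.mem_filter.1 (hb hv)
      exact (h1 v this.1 this.2).1 ((h2 v this.1 this.2).2 hv)
  have bBad : ∀ e ∈ 𝓔, μ.real (Bad e) ≤ (1 + 1 / δ) * η := by
    intro e he
    have mWt : MeasurableSet (Wt e) := sg_le _ _ (hWt' e he)
    calc μ.real (Bad e) ≤ ∑ a ∈ Fe e, μ.real (piece e a) := measureReal_biUnion_finset_le _ _
      _ ≤ ∑ a ∈ Fe e, (1 + 1 / δ) * μ.real (cellA s j n a e ∩ symmDiff (W e) (Wt e)) := by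
          refine Finset.sum_le_sum fun a _ => ?_
          obtain ⟨V, hV, hVA⟩ := cell_trace s j n a e (Wt e) (hWt' e he)
          exact cell_bound μ (sg_le _) (mA a e) (mW e he) hV hVA δ hδ0
      _ = (1 + 1 / δ) * μ.real (⋃ a ∈ Fe e, cellA s j n a e ∩ symmDiff (W e) (Wt e)) := by
          rw [← Finset.mul_sum, measureReal_biUnion_finset (hdisj e)]
          intro a _
          exact (mA a e).inter ((mW e he).symmDiff mWt)
      _ ≤ (1 + 1 / δ) * η := by
          refine mul_le_mul_of_nonneg_left ?_ (by positivity)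
          refine le_trans (measureReal_mono ?_) (hWtη e he).le
          exact Set.iUnion₂_subset fun a _ => Set.inter_subset_right
  have νBad : ∑ e ∈ 𝓔, ν.real (Bad e) < ν.real (⋂ e ∈ 𝓔, W e) := by
    have h1 : ∀ e ∈ 𝓔, ν.real (Bad e) ≤ K * ((1 + 1 / δ) * η) := fun e he =>
      (hg.dom e (he𝓔 e he).1 (he𝓔 e he).2 _ (mBad e he)).trans
        (mul_le_mul_of_nonneg_left (bBad e he) hK.le)
    have h2 := Finset.sum_le_card_nsmul 𝓔 _ _ h1
    rw [nsmul_eq_mul] at h2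
    refine lt_of_le_of_lt h2 ?_
    rw [← hN]
    set X := ν.real (⋂ e ∈ 𝓔, W e)
    have hc : 0 < K * (1 + 1 / δ) := by positivity
    have : N * (K * ((1 + 1 / δ) * η)) = (N / (2 * (N + 1))) * X := by
      rw [hη]; field_simp
    rw [this]
    have : N / (2 * (N + 1)) < 1 := by rw [div_lt_one (by positivity)]; linarith
    nlinarith
  -- find cell
  have cover : (⋂ e ∈ 𝓔, W e) ⊆ (⋃ e ∈ 𝓔, Bad e) ∪ ⋃ a ∈ (Fn s j n).powerset, ⋂ e ∈ 𝓔, De a e := by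
    intro ω hω
    by_cases hb : ω ∈ ⋃ e ∈ 𝓔, Bad e
    · exact Or.inl hb
    · right
      set a := (Fn s j n).filter fun v => ω v = true with ha
      refine Set.mem_biUnion (Finset.mem_coe.2 (Finset.mem_powerset.2 (Finset.filter_subset _ _))) (x := a) ?_
      refine Set.mem_iInter₂.2 fun e he => ?_
      by_contra hD
      apply hb
      refine Set.mem_biUnion he ?_
      refine Set.mem_biUnion (x := a.filter fun v => sp s v ⊆ e) ?_ ?_
      · refine Finset.mem_coe.2 (Finset.mem_powerset.2 ?_)
        exact Finset.filter_subset_filter _ (Finset.filter_subset _ _)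
      · simp only [hpiece, hDe, cellA_filter]
        refine ⟨⟨?_, Set.mem_iInter₂.1 hω e he⟩, hD⟩
        intro v hv _
        simp [ha, hv]
  have hex : ∃ a ∈ (Fn s j n).powerset, 0 < ν.real (⋂ e ∈ 𝓔, De a e) := by
    by_contra hcon
    push Not at hcon
    have h1 : ν.real (⋂ e ∈ 𝓔, W e) ≤ ∑ e ∈ 𝓔, ν.real (Bad e) +
        ∑ a ∈ (Fn s j n).powerset, ν.real (⋂ e ∈ 𝓔, De a e) :=
      (measureReal_mono cover).trans ((measureReal_union_le _ _).trans
        (add_le_add (measureReal_biUnion_finset_le _ _) (measureReal_biUnion_finset_le _ _)))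
    have h2 := Finset.sum_nonpos hcon
    linarith
  obtain ⟨a, -, ha⟩ := hex
  refine ⟨De a, fun e he => Dset_meas _ _ _ _ _, ha, fun hpos => ?_⟩
  exact count_step μ hg.inv s j (cellF s j n a) (cellF_meas s j n a) 𝓔 (fun e he => (he𝓔 e he).1)
    W (fun e he => sg_mono (hSj1 e) _ (hW e he)) (cellA s j n a)
    (fun e he => cellA_inter s j n a e (he𝓔 e he).1) δ hδ0 hδ1 hpos

lemma good_pos (s d : ℕ) (hds : d ≤ s) (K : ℝ) (hK : 0 < K) (μ ν : Measure Om) (hg : GoodP s d K μ ν) :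
    0 < μ.real (⋂ e ∈ (Finset.range s).powersetCard d, {ω : Om | ω e = true}) := by
  have := hg.pμ
  have := hg.pν
  set 𝓔 := (Finset.range s).powersetCard d with h𝓔
  have he𝓔 : ∀ e ∈ 𝓔, e ⊆ Finset.range s ∧ e.card = d := fun e he => Finset.mem_powersetCard.1 he
  have main : ∀ i ≤ d, ∃ W : Finset ℕ → Set Om,
      (∀ e ∈ 𝓔, MeasurableSet[sg (Sj s e (d - i))] (W e)) ∧
      0 < ν.real (⋂ e ∈ 𝓔, W e) ∧
      (0 < μ.real (⋂ e ∈ 𝓔, W e) → 0 < μ.real (⋂ e ∈ 𝓔, {ω : Om | ω e = true})) := by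
    intro i
    induction i with
    | zero =>
      intro _
      have hm : ∀ e, ∀ Q : Set (Finset ℕ), e ∈ Q → MeasurableSet[sg Q] {ω : Om | ω e = true} := by
        intro e Q he
        have := coord_meas Q e he True
        simpa using this
      refine ⟨fun e => {ω : Om | ω e = true}, fun e he => hm e _ ?_, ?_, id⟩
      · have := he𝓔 e he
        have h2 : sp s e = e := Finset.inter_eq_left.2 this.1
        refine ⟨h2.le, ?_⟩
        rw [h2]; omega
      · have hae : ∀ᵐ ω ∂ν, ∀ e ∈ 𝓔, ω e = true := by
          refine (ae_ball_iff 𝓔.countable_toSet).2 fun e he => ?_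
          have h1 := hg.one e (he𝓔 e he).1 (he𝓔 e he).2
          have h2 : MeasurableSet {ω : Om | ω e = true} := sg_le _ _ (hm e Set.univ trivial)
          rw [measureReal_def, ENNReal.toReal_eq_one_iff] at h1
          exact (prob_compl_eq_zero_iff h2).2 h1
        have : ν.real (⋂ e ∈ 𝓔, {ω : Om | ω e = true}) = 1 := by
          rw [measureReal_def, ENNReal.toReal_eq_one_iff]
          rw [← measure_univ (μ := ν)]
          apply measure_congr
          filter_upwards [hae] with ω hω
          apply propext
          change ω ∈ (⋂ e ∈ 𝓔, {ω : Om | ω e = true}) ↔ ω ∈ (Set.univ : Set Om)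
          simpa using hω
        rw [this]; norm_num
    | succ i ih =>
      intro hi
      obtain ⟨W, h1, h2, h3⟩ := ih (by omega)
      have e1 : d - i = d - (i+1) + 1 := by omega
      rw [e1] at h1
      obtain ⟨W', g1, g2, g3⟩ := descend s d K hK μ ν hg _ W h1 h2
      exact ⟨W', g1, g2, fun h => h3 (g3 h)⟩
  obtain ⟨W, h1, h2, h3⟩ := main d le_rfl
  apply h3
  obtain ⟨e0, he0, hc0⟩ := Finset.exists_subset_card_eq (s := Finset.range s) (n := d) (by simpa using hds)
  have hm : MeasurableSet[sg {v | sp s v ⊆ e0}] (⋂ e ∈ 𝓔, W e) := by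
    refine @Finset.measurableSet_biInter _ _ (sg _) _ _ fun e he => ?_
    refine sg_mono ?_ _ (h1 e he)
    intro v hv
    have : (sp s v).card ≤ d - d := hv.2
    have : sp s v = ∅ := Finset.card_eq_zero.1 (by omega)
    change sp s v ⊆ e0
    rw [this]; simp
  have := hg.dom e0 he0 hc0 _ hm
  by_contra hcon
  push Not at hcon
  have h0 : μ.real (⋂ e ∈ 𝓔, W e) = 0 := le_antisymm hcon measureReal_nonneg
  rw [h0] at this
  linarith

end

end

section
open MeasureTheory Filter Topology

noncomputable section

structure PreGood (s d : ℕ) (K : ℝ) (μ ν : Measure Om) : Prop where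
  pμ : IsProbabilityMeasure μ
  pν : IsProbabilityMeasure ν
  inv : InvT μ
  dom : ∀ e ⊆ Finset.range s, e.card = d → ∀ n : ℕ, ∀ E,
    MeasurableSet[sg {v | v ∈ {v | sp s v ⊆ e} ∧ v ⊆ Finset.range n}] E →
    ν.real E ≤ K * μ.real E
  one : ∀ e ⊆ Finset.range s, e.card = d → ν.real {ω : Om | ω e = true} = 1

lemma fin_clopen (Q : Set (Finset ℕ)) (hQ : Q.Finite) (E : Set Om) (hE : MeasurableSet[sg Q] E) :
    IsClopen E := by
  have := hQ.to_subtype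
  let r : Om → (Q → Bool) := fun ω v => ω v
  have hr : Continuous r := by fun_prop
  have : E = r ⁻¹' (r '' E) := by
    apply Set.Subset.antisymm (Set.subset_preimage_image r E)
    rintro ω ⟨ω', h', h⟩
    refine (sg_depends_set Q E hE ω' ω fun v hv => ?_).1 h'
    exact congrFun h ⟨v, hv⟩
  rw [this]
  exact (isClopen_discrete _).preimage hr

lemma cut_finite (A : Set (Finset ℕ)) (n : ℕ) : {v | v ∈ A ∧ v ⊆ Finset.range n}.Finite := by
  refine (Finset.finite_toSet (Finset.range n).powerset).subset ?_
  rintro v ⟨-, hv⟩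
  exact Finset.mem_coe.2 (Finset.mem_powerset.2 hv)

lemma coord_clopen (e : Finset ℕ) : IsClopen {ω : Om | ω e = true} := by
  have h : Continuous (fun ω : Om => ω e) := continuous_apply e
  exact (isClopen_discrete {true}).preimage h

lemma Tm_continuous (τ : ℕ → ℕ) : Continuous (Tm τ) := by
  unfold Tm; fun_prop

lemma real_tendsto {L : Filter ℕ} (μs : ℕ → ProbabilityMeasure Om) (μ : ProbabilityMeasure Om)
    (h : Tendsto μs L (𝓝 μ)) {E : Set Om} (hE : IsClopen E) :
    Tendsto (fun i => (μs i : Measure Om).real E) L (𝓝 ((μ : Measure Om).real E)) := by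
  have := ProbabilityMeasure.tendsto_measure_of_isClopen_of_tendsto h hE
  exact (NNReal.continuous_coe.tendsto _).comp this

lemma limit_contra (s d : ℕ) (hds : d ≤ s) (K : ℝ) (hK : 0 < K)
    (h : ∀ n : ℕ, ∃ μ ν : Measure Om, PreGood s d K μ ν ∧
      μ.real (⋂ e ∈ (Finset.range s).powersetCard d, {ω : Om | ω e = true}) ≤ 1 / ((n : ℝ) + 1)) :
    False := by
  choose μ ν hg hsm using h
  let μ' : ℕ → ProbabilityMeasure Om := fun n => ⟨μ n, (hg n).pμ⟩
  let ν' : ℕ → ProbabilityMeasure Om := fun n => ⟨ν n, (hg n).pν⟩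
  let L : Ultrafilter ℕ := hyperfilter ℕ
  have hL : (L : Filter ℕ) ≤ atTop := Nat.hyperfilter_le_atTop
  obtain ⟨μl, -, hμl⟩ := isCompact_univ.ultrafilter_le_nhds (L.map μ') (by simp)
  obtain ⟨νl, -, hνl⟩ := isCompact_univ.ultrafilter_le_nhds (L.map ν') (by simp)
  have hμt : Tendsto μ' L (𝓝 μl) := hμl
  have hνt : Tendsto ν' L (𝓝 νl) := hνl
  have hdom0 : ∀ e ⊆ Finset.range s, e.card = d → ∀ n : ℕ, ∀ E,
      MeasurableSet[sg {v | v ∈ {v | sp s v ⊆ e} ∧ v ⊆ Finset.range n}] E →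
      (νl : Measure Om).real E ≤ K * (μl : Measure Om).real E := by
    intro e he hed n E hE
    have hc := fin_clopen _ (cut_finite _ n) E hE
    refine le_of_tendsto_of_tendsto (real_tendsto ν' νl hνt hc)
      ((real_tendsto μ' μl hμt hc).const_mul K) (Eventually.of_forall fun i => ?_)
    exact (hg i).dom e he hed n E hE
  have good : GoodP s d K (μl : Measure Om) (νl : Measure Om) := by
    refine ⟨inferInstance, inferInstance, ?_, ?_, ?_⟩
    · intro τ hτ
      have h1 := ProbabilityMeasure.tendsto_map_of_tendsto_of_continuous μ' μl hμt (Tm_continuous τ)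
      have h2 : (fun i => (μ' i).map (Tm_continuous τ).measurable.aemeasurable) = μ' := by
        funext i
        apply Subtype.ext
        exact (hg i).inv τ hτ
      rw [h2] at h1
      have h3 := tendsto_nhds_unique h1 hμt
      exact congrArg (fun x : ProbabilityMeasure Om => (x : Measure Om)) h3
    · intro e he hed E hE
      refine le_of_forall_pos_le_add fun η hη => ?_
      have hm := sg_le _ _ hE
      obtain ⟨n, E', hE', hη'⟩ := approx ((μl : Measure Om) + (νl : Measure Om))
        (fun n => {v | v ∈ {v | sp s v ⊆ e} ∧ v ⊆ Finset.range n}) (cut_mono _) E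
        (by rw [cut_iUnion]; exact hE) (η / (1 + K)) (by positivity)
      have h1 := hdom0 e he hed n E' hE'
      rw [measureReal_add_apply] at hη'
      have a1 : (νl : Measure Om).real E ≤ (νl : Measure Om).real E' + (νl : Measure Om).real (symmDiff E E') := by
        refine le_trans (measureReal_mono (s₂ := E' ∪ symmDiff E E') ?_) (measureReal_union_le _ _)
        intro x hx
        by_cases h : x ∈ E'
        · exact Or.inl h
        · exact Or.inr (Or.inl ⟨hx, h⟩)
      have a2 : (μl : Measure Om).real E' ≤ (μl : Measure Om).real E + (μl : Measure Om).real (symmDiff E E') := by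
        refine le_trans (measureReal_mono (s₂ := E ∪ symmDiff E E') ?_) (measureReal_union_le _ _)
        intro x hx
        by_cases h : x ∈ E
        · exact Or.inl h
        · exact Or.inr (Or.inr ⟨hx, h⟩)
      have b1 : 0 ≤ (μl : Measure Om).real (symmDiff E E') := measureReal_nonneg
      have b2 : 0 ≤ (νl : Measure Om).real (symmDiff E E') := measureReal_nonneg
      rw [lt_div_iff₀ (by positivity)] at hη'
      nlinarith
    · intro e he hed
      have h1 := real_tendsto ν' νl hνt (coord_clopen e)
      refine tendsto_nhds_unique h1 ?_
      refine tendsto_const_nhds.congr fun i => ?_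
      exact ((hg i).one e he hed).symm
  have hpos := good_pos s d hds K hK _ _ good
  have hc : IsClopen (⋂ e ∈ (Finset.range s).powersetCard d, {ω : Om | ω e = true}) :=
    isClopen_biInter_finset fun e _ => coord_clopen e
  have h1 := real_tendsto μ' μl hμt hc
  have h2 : Tendsto (fun n : ℕ => 1 / ((n : ℝ) + 1)) L (𝓝 0) :=
    tendsto_one_div_add_atTop_nhds_zero_nat.mono_left hL
  have h3 := le_of_tendsto_of_tendsto h1 h2 (Eventually.of_forall fun i => hsm i)
  linarith

end

end

section
open MeasureTheory Filter Topology

noncomputable section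

set_option linter.unusedSectionVars false
namespace Smp
variable {V : Type} [Fintype V] [Nonempty V]

def Uv (V : Type) [Fintype V] [Nonempty V] : @Measure V ⊤ :=
  @PMF.toMeasure V ⊤ (PMF.uniformOfFintype V)


local instance mV : MeasurableSpace V := ⊤

instance : IsProbabilityMeasure (Uv V) := PMF.toMeasure.isProbabilityMeasure _

lemma Uv_single (x : V) : (Uv V) {x} = (Fintype.card V : ENNReal)⁻¹ := by
  rw [Uv, PMF.toMeasure_apply_singleton _ _ (by trivial)]
  simp

def mi (V : Type) [Fintype V] [Nonempty V] : Measure (ℕ → V) :=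
  Measure.infinitePi (fun _ => Uv V)

instance : IsProbabilityMeasure (mi V) := by unfold mi; infer_instance

def Dep (T : Finset ℕ) (A : Set (ℕ → V)) : Prop :=
  ∀ z z' : ℕ → V, (∀ i ∈ T, z i = z' i) → (z ∈ A ↔ z' ∈ A)

lemma Dep.eq {T : Finset ℕ} {A : Set (ℕ → V)} (h : Dep T A) :
    A = (fun z (i : T) => z i) ⁻¹' ((fun (z : ℕ → V) (i : T) => z i) '' A) := by
  apply Set.Subset.antisymm (Set.subset_preimage_image _ A)
  rintro z ⟨z', h', he⟩
  exact (h z' z fun i hi => congrFun he ⟨i, hi⟩).1 h'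

lemma fin_meas (T : Finset ℕ) (B : Set (T → V)) : MeasurableSet B :=
  (Set.toFinite B).measurableSet

lemma Dep.meas {T : Finset ℕ} {A : Set (ℕ → V)} (h : Dep T A) : MeasurableSet A := by
  rw [h.eq]
  refine measurableSet_preimage ?_ (fin_meas _ _)
  exact measurable_pi_iff.2 fun i => measurable_pi_apply _

def cyl (S : Finset ℕ) (c : ℕ → V) : Set (ℕ → V) := {z | ∀ i ∈ S, z i = c i}

lemma cyl_dep (S : Finset ℕ) (c : ℕ → V) : Dep S (cyl S c) := by
  intro z z' h
  refine forall₂_congr fun i hi => ?_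
  rw [h i hi]

lemma cyl_mi (S : Finset ℕ) (c : ℕ → V) :
    (mi V).real (cyl S c) = ((Fintype.card V : ℝ) ^ S.card)⁻¹ := by
  have : cyl S c = Set.pi S (fun i => {c i}) := by ext z; simp [cyl, Set.mem_pi]
  rw [this, Measure.real, mi, Measure.infinitePi_pi _ (fun i _ => by trivial)]
  simp [Uv_single]

lemma indep (S T : Finset ℕ) (hST : Disjoint S T) (A B : Set (ℕ → V)) (hA : Dep S A) (hB : Dep T B) :
    (mi V).real (A ∩ B) = (mi V).real A * (mi V).real B := by
  have h := ProbabilityTheory.iIndepFun_infinitePi (P := fun _ : ℕ => Uv V)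
    (X := fun _ => id) (fun _ => measurable_id)
  have h2 := h.indepFun_finset S T hST (fun i => measurable_pi_apply i)
  have h3 := h2.measure_inter_preimage_eq_mul _ _ (fin_meas S ((fun (z : ℕ → V) (i : S) => z i) '' A))
    (fin_meas T ((fun (z : ℕ → V) (i : T) => z i) '' B))
  simp only [id] at h3
  rw [← hA.eq, ← hB.eq] at h3
  simp only [Measure.real, mi]
  rw [h3, ENNReal.toReal_mul]

def Ph (h : Finset V → Prop) (z : ℕ → V) : Om := fun v => decide (h (v.image z))

lemma Ph_meas (h : Finset V → Prop) : Measurable (Ph h) := by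
  refine measurable_pi_iff.2 fun v => ?_
  refine measurable_to_bool ?_
  refine Dep.meas (T := v) ?_
  intro z z' hz
  have : v.image z = v.image z' := Finset.image_congr hz
  simp [Ph, this]

lemma mi_inv (τ : ℕ → ℕ) (hτ : Function.Injective τ) : (mi V).map (fun z i => z (τ i)) = mi V := by
  have hm : Measurable (fun (z : ℕ → V) i => z (τ i)) :=
    measurable_pi_iff.2 fun i => measurable_pi_apply _
  obtain ⟨g, hg⟩ := hτ.hasLeftInverse
  refine Measure.eq_infinitePi _ ?_
  intro s t ht
  rw [Measure.map_apply hm (MeasurableSet.pi s.countable_toSet fun i _ => ht i)]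
  have : (fun (z : ℕ → V) i => z (τ i)) ⁻¹' (Set.pi s t) =
      Set.pi (s.image τ) (fun j => t (g j)) := by
    ext z
    simp only [Set.mem_preimage, Set.mem_pi, Finset.coe_image, Set.forall_mem_image, Finset.mem_coe]
    refine forall₂_congr fun i _ => ?_
    rw [hg i]
  rw [this, mi, Measure.infinitePi_pi _ (fun i _ => by trivial), Finset.prod_image (by
    intro a _ b _ hab; exact hτ hab)]
  refine Finset.prod_congr rfl fun i _ => ?_
  rw [hg i]

lemma muV_inv (h : Finset V → Prop) : InvT ((mi V).map (Ph h)) := by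
  intro τ hτ
  have hm : Measurable (fun (z : ℕ → V) i => z (τ i)) :=
    measurable_pi_iff.2 fun i => measurable_pi_apply _
  rw [Measure.map_map (Tm_measurable τ) (Ph_meas h)]
  conv_rhs => rw [← mi_inv τ hτ]
  rw [Measure.map_map (Ph_meas h) hm]
  congr 1
  funext z v
  simp [Ph, Tm, Finset.image_image, Function.comp_def]

def BJ {ι : Type} (s : ℕ) (B : Finset ι) (b : ι → ℕ → V) : Set (ℕ → V) :=
  ⋃ i ∈ B, cyl (Finset.range s) (b i)

lemma BJ_meas {ι : Type} (s : ℕ) (B : Finset ι) (b : ι → ℕ → V) : MeasurableSet (BJ s B b) :=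
  Finset.measurableSet_biUnion _ fun i _ => (cyl_dep _ _).meas

variable {ι : Type} (s d : ℕ) (B : Finset ι) (b : ι → ℕ → V)

lemma BJ_inter (hds : d ≤ s)
    (hB : ∀ e ⊆ Finset.range s, e.card = d → ∀ i ∈ B, ∀ j ∈ B, (∀ x ∈ e, b i x = b j x) → i = j)
    (A : Set (ℕ → V)) (hA : MeasurableSet A) :
    (mi V).real (BJ s B b ∩ A) = ∑ i ∈ B, (mi V).real (cyl (Finset.range s) (b i) ∩ A) := by
  rw [BJ, Set.iUnion₂_inter, measureReal_biUnion_finset]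
  · intro i hi j hj hij
    refine Set.disjoint_left.2 fun z hz hz' => hij ?_
    refine hB (Finset.range d) (Finset.range_mono hds) (by simp) i hi j hj fun x hx => ?_
    have hx' := Finset.range_mono hds hx
    rw [← hz.1 x hx', ← hz'.1 x hx']
  · intro i hi
    exact (cyl_dep _ _).meas.inter hA

lemma BJ_val (hds : d ≤ s)
    (hB : ∀ e ⊆ Finset.range s, e.card = d → ∀ i ∈ B, ∀ j ∈ B, (∀ x ∈ e, b i x = b j x) → i = j) :
    (mi V).real (BJ s B b) = B.card * ((Fintype.card V : ℝ) ^ s)⁻¹ := by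
  have := BJ_inter s d B b hds hB Set.univ MeasurableSet.univ
  simpa [cyl_mi] using this

lemma BJ_dom (hds : d ≤ s)
    (hB : ∀ e ⊆ Finset.range s, e.card = d → ∀ i ∈ B, ∀ j ∈ B, (∀ x ∈ e, b i x = b j x) → i = j)
    (e : Finset ℕ) (he : e ⊆ Finset.range s) (hed : e.card = d) (n : ℕ)
    (A : Set (ℕ → V)) (hA : Dep (e ∪ (Finset.range n \ Finset.range s)) A) :
    (mi V).real (BJ s B b ∩ A) ≤ ((Fintype.card V : ℝ) ^ (s - d))⁻¹ * (mi V).real A := by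
  rw [BJ_inter s d B b hds hB A hA.meas]
  set T := e ∪ (Finset.range n \ Finset.range s) with hT
  have h1 : ∀ i ∈ B, (mi V).real (cyl (Finset.range s) (b i) ∩ A) =
      ((Fintype.card V : ℝ) ^ (s - d))⁻¹ * (mi V).real (cyl e (b i) ∩ A) := by
    intro i _
    have e1 : cyl (Finset.range s) (b i) ∩ A = cyl (Finset.range s \ e) (b i) ∩ (cyl e (b i) ∩ A) := by
      ext z
      simp only [cyl, Set.mem_inter_iff, Set.mem_ofPred_eq, ← and_assoc]
      refine and_congr_left fun _ => ?_
      constructor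
      · intro h
        exact ⟨fun x hx => h x (Finset.mem_sdiff.1 hx).1, fun x hx => h x (he hx)⟩
      · rintro ⟨h1, h2⟩ x hx
        by_cases hxe : x ∈ e
        · exact h2 x hxe
        · exact h1 x (Finset.mem_sdiff.2 ⟨hx, hxe⟩)
    rw [e1, indep (Finset.range s \ e) T _ _ _ (cyl_dep _ _), cyl_mi]
    · rw [Finset.card_sdiff_of_subset he, hed, Finset.card_range]
    · intro z z' hz
      refine and_congr (cyl_dep _ _ z z' fun x hx => hz x (Finset.mem_union_left _ hx)) (hA z z' hz)
    · rw [Finset.disjoint_left]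
      intro x hx hx'
      simp only [hT, Finset.mem_union, Finset.mem_sdiff] at hx hx'
      tauto
  rw [Finset.sum_congr rfl h1, ← Finset.mul_sum]
  refine mul_le_mul_of_nonneg_left ?_ (by positivity)
  rw [← measureReal_biUnion_finset]
  · exact measureReal_mono (by intro x hx; simp only [Set.mem_iUnion] at hx; obtain ⟨i, _, h⟩ := hx; exact h.2)
  · intro i hi j hj hij
    refine Set.disjoint_left.2 fun z hz hz' => hij ?_
    refine hB e he hed i hi j hj fun x hx => ?_
    rw [← hz.1 x hx, ← hz'.1 x hx]
  · intro i hi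
    exact (cyl_dep _ _).meas.inter hA.meas

lemma pregood (hds : d ≤ s) (c : ℝ) (hc : 0 < c) (h : Finset V → Prop)
    (hB : ∀ e ⊆ Finset.range s, e.card = d → ∀ i ∈ B, ∀ j ∈ B, (∀ x ∈ e, b i x = b j x) → i = j)
    (hcard : c * (Fintype.card V : ℝ) ^ d ≤ B.card)
    (hh : ∀ i ∈ B, ∀ e ⊆ Finset.range s, e.card = d → h (e.image (b i))) :
    PreGood s d (1 / c) ((mi V).map (Ph h)) ((ProbabilityTheory.cond (mi V) (BJ s B b)).map (Ph h)) := by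
  have hN : 0 < (Fintype.card V : ℝ) := by exact_mod_cast Fintype.card_pos
  have hBc : 0 < (B.card : ℝ) := lt_of_lt_of_le (by positivity) hcard
  have hval := BJ_val s d B b hds hB
  have hpos : 0 < (mi V).real (BJ s B b) := by rw [hval]; positivity
  have hne : mi V (BJ s B b) ≠ 0 := by
    intro h0; rw [Measure.real, h0] at hpos; simp at hpos
  have hpr := ProbabilityTheory.cond_isProbabilityMeasure hne
  have hreal : ∀ A, (ProbabilityTheory.cond (mi V) (BJ s B b)).real A =
      ((mi V).real (BJ s B b))⁻¹ * (mi V).real (BJ s B b ∩ A) := by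
    intro A
    rw [Measure.real, ProbabilityTheory.cond_apply (BJ_meas s B b), ENNReal.toReal_mul, ENNReal.toReal_inv]
    rfl
  refine ⟨Measure.isProbabilityMeasure_map (Ph_meas h).aemeasurable,
    Measure.isProbabilityMeasure_map (Ph_meas h).aemeasurable, muV_inv h, ?_, ?_⟩
  · intro e he hed n E hE
    have hEm := sg_le _ _ hE
    rw [map_measureReal_apply (Ph_meas h) hEm, map_measureReal_apply (Ph_meas h) hEm, hreal]
    have hdep : Dep (e ∪ (Finset.range n \ Finset.range s)) (Ph h ⁻¹' E) := by
      intro z z' hz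
      refine sg_depends_set _ E hE _ _ ?_
      rintro v ⟨hv1, hv2⟩
      have : v.image z = v.image z' := by
        refine Finset.image_congr fun x hx => hz x ?_
        have hxn := hv2 hx
        by_cases hxs : x ∈ Finset.range s
        · exact Finset.mem_union_left _ (hv1 (Finset.mem_inter.2 ⟨hx, hxs⟩))
        · exact Finset.mem_union_right _ (Finset.mem_sdiff.2 ⟨hxn, hxs⟩)
      simp [Ph, this]
    have hd := BJ_dom s d B b hds hB e he hed n _ hdep
    have hμ0 : 0 ≤ (mi V).real (Ph h ⁻¹' E) := measureReal_nonneg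
    rw [hval]
    calc _ ≤ ((B.card : ℝ) * ((Fintype.card V : ℝ) ^ s)⁻¹)⁻¹ *
          (((Fintype.card V : ℝ) ^ (s - d))⁻¹ * (mi V).real (Ph h ⁻¹' E)) := by gcongr
      _ = ((Fintype.card V : ℝ) ^ d / B.card) * (mi V).real (Ph h ⁻¹' E) := by
          have : (Fintype.card V : ℝ) ^ s = (Fintype.card V : ℝ) ^ d * (Fintype.card V : ℝ) ^ (s - d) := by
            rw [← pow_add]; congr 1; omega
          rw [this]; field_simp
      _ ≤ _ := by
          refine mul_le_mul_of_nonneg_right ?_ hμ0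
          rw [div_le_div_iff₀ hBc hc]; linarith
  · intro e he hed
    rw [map_measureReal_apply (Ph_meas h) (coord_clopen e).1.measurableSet, hreal]
    rw [Set.inter_eq_left.2, inv_mul_cancel₀ hpos.ne']
    intro z hz
    simp only [BJ, Set.mem_iUnion] at hz
    obtain ⟨i, hi, hz⟩ := hz
    have : e.image z = e.image (b i) := Finset.image_congr fun x hx => hz x (he hx)
    simp only [Set.mem_preimage, Set.mem_ofPred_eq, Ph, this]
    simpa using hh i hi e he hed

/-- counting bound -/
lemma mi_fin (A : Set (ℕ → V)) (G : Finset (Fin s → V)) (hA : ∀ z ∈ A, (fun i : Fin s => z i) ∈ G) :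
    (mi V).real A ≤ G.card * ((Fintype.card V : ℝ) ^ s)⁻¹ := by
  obtain ⟨x0⟩ := ‹Nonempty V›
  let ex : (Fin s → V) → ℕ → V := fun g i => if h : i < s then g ⟨i, h⟩ else x0
  have : A ⊆ ⋃ g ∈ G, cyl (Finset.range s) (ex g) := by
    intro z hz
    simp only [Set.mem_iUnion]
    refine ⟨_, hA z hz, fun i hi => ?_⟩
    simp [ex, Finset.mem_range.1 hi]
  refine (measureReal_mono this (measure_ne_top _ _)).trans ?_
  refine (measureReal_biUnion_finset_le _ _).trans ?_
  simp [cyl_mi]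

end Smp

theorem FRL (d s : ℕ) (hds : d ≤ s) (c : ℝ) (hc : 0 < c) : ∃ δ : ℝ, 0 < δ ∧
    ∀ (V : Type) [Fintype V] [Nonempty V] (h : Finset V → Prop) (B : Finset (Fin s → V)),
    (∀ e : Finset (Fin s), e.card = d → ∀ b ∈ B, ∀ b' ∈ B, (∀ i ∈ e, b i = b' i) → b = b') →
    c * (Fintype.card V : ℝ) ^ d ≤ B.card →
    (∀ b ∈ B, ∀ e : Finset (Fin s), e.card = d → h (e.image b)) →
    δ * (Fintype.card V : ℝ) ^ s ≤
      ((Finset.univ.filter fun z : Fin s → V => ∀ e : Finset (Fin s), e.card = d → h (e.image z)).card : ℝ) := by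
  by_contra hcon
  push Not at hcon
  refine limit_contra s d hds (1 / c) (by positivity) fun n => ?_
  obtain ⟨V, hF, hNe, h, B, hB, hcard, hh, hlt⟩ := hcon (1 / ((n : ℝ) + 1)) (by positivity)
  have x0 : V := hNe.some
  let ex : (Fin s → V) → ℕ → V := fun g i => if h : i < s then g ⟨i, h⟩ else x0
  have hex : ∀ g (i : Fin s), ex g i = g i := fun g i => by simp [ex]
  let pre : Finset ℕ → Finset (Fin s) := fun e => Finset.univ.filter fun i => (i : ℕ) ∈ e
  have hpre : ∀ e ⊆ Finset.range s, (pre e).image (fun i : Fin s => (i : ℕ)) = e := by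
    intro e he
    ext x
    simp only [pre, Finset.mem_image, Finset.mem_filter, Finset.mem_univ, true_and]
    constructor
    · rintro ⟨i, hi, rfl⟩; exact hi
    · intro hx; exact ⟨⟨x, Finset.mem_range.1 (he hx)⟩, hx, rfl⟩
  have hprec : ∀ e ⊆ Finset.range s, (pre e).card = e.card := by
    intro e he
    conv_rhs => rw [← hpre e he]
    rw [Finset.card_image_of_injective _ Fin.val_injective]
  have himg : ∀ e ⊆ Finset.range s, ∀ z : ℕ → V, e.image z = (pre e).image (fun i : Fin s => z i) := by
    intro e he z
    conv_lhs => rw [← hpre e he]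
    rw [Finset.image_image]; rfl
  refine ⟨_, _, Smp.pregood s d B ex hds c hc h ?_ hcard ?_, ?_⟩
  · intro e he hed b hb b' hb' hag
    refine hB (pre e) (by rw [hprec e he, hed]) b hb b' hb' fun i hi => ?_
    have := hag i (Finset.mem_filter.1 hi).2
    rwa [hex, hex] at this
  · intro b hb e he hed
    rw [himg e he]
    simp only [hex]
    exact hh b hb _ (by rw [hprec e he, hed])
  · have hm : MeasurableSet (⋂ e ∈ (Finset.range s).powersetCard d, {ω : Om | ω e = true}) :=
      Finset.measurableSet_biInter _ fun e _ => (coord_clopen e).1.measurableSet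
    rw [map_measureReal_apply (Smp.Ph_meas h) hm]
    refine (Smp.mi_fin s _ (Finset.univ.filter fun z : Fin s → V => ∀ e : Finset (Fin s), e.card = d → h (e.image z)) ?_).trans ?_
    · intro z hz
      simp only [Finset.mem_filter, Finset.mem_univ, true_and]
      intro e he
      simp only [Set.mem_preimage, Set.mem_iInter, Set.mem_ofPred_eq] at hz
      have := hz (e.image fun i : Fin s => (i : ℕ)) (by
        rw [Finset.mem_powersetCard, Finset.card_image_of_injective _ Fin.val_injective]
        refine ⟨?_, he⟩
        intro x hx
        obtain ⟨i, _, rfl⟩ := Finset.mem_image.1 hx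
        simp)
      simp only [Smp.Ph, Finset.image_image, decide_eq_true_eq] at this
      exact this
    · have hN : 0 < (Fintype.card V : ℝ) ^ s := by
        have : 0 < (Fintype.card V : ℝ) := by exact_mod_cast Fintype.card_pos
        positivity
      rw [mul_inv_le_iff₀ hN]
      exact hlt.le

end

end

section
lemma FRL2 (d s : ℕ) (hds : d ≤ s) (c : ℝ) (hc : 0 < c) : ∃ δ : ℝ, 0 < δ ∧
    ∀ (V : Type) [Fintype V] [Nonempty V] (Lam : Set (Set V)) (ι : Type) (BB : Finset ι)
      (o : ι → Fin s → V),
    (∀ e : Finset (Fin s), e.card = d → ∀ b ∈ BB, ∀ b' ∈ BB, (∀ i ∈ e, o b i = o b' i) → b = b') →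
    c * (Fintype.card V : ℝ) ^ d ≤ BB.card →
    (∀ b ∈ BB, ∀ e : Finset (Fin s), e.card = d → ∃ γ ∈ Lam, ∀ i ∈ e, o b i ∈ γ) →
    ∃ G : Finset (Fin s → V),
      (∀ z ∈ G, ∀ e : Finset (Fin s), e.card = d → ∃ γ ∈ Lam, ∀ i ∈ e, z i ∈ γ) ∧
      δ * (Fintype.card V : ℝ) ^ s ≤ G.card := by
  obtain ⟨δ, hδ, hF⟩ := FRL d s hds c hc
  refine ⟨δ, hδ, ?_⟩
  intro V _ _ Lam ι BB o hag hcard hL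
  obtain ⟨e0, -, he0⟩ := Finset.exists_subset_card_eq (s := (Finset.univ : Finset (Fin s))) (n := d)
    (by simp; omega)
  have hinj : Set.InjOn o BB := fun b hb b' hb' h => hag e0 he0 b hb b' hb' fun i _ => by rw [h]
  obtain ⟨h0, hh0⟩ : ∃ h0 : Finset V → Prop, ∀ S, h0 S ↔ ∃ γ ∈ Lam, ∀ x ∈ S, x ∈ γ := ⟨_, fun _ => Iff.rfl⟩
  have h := hF V h0 (BB.image o) ?_ ?_ ?_
  · refine ⟨_, ?_, h⟩
    intro z hz e he
    obtain ⟨γ, hγ, h⟩ := (hh0 _).1 ((Finset.mem_filter.1 hz).2 e he)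
    exact ⟨γ, hγ, fun i hi => h _ (Finset.mem_image_of_mem _ hi)⟩
  · intro e he b hb b' hb' h
    obtain ⟨b1, hb1, rfl⟩ := Finset.mem_image.1 hb
    obtain ⟨b2, hb2, rfl⟩ := Finset.mem_image.1 hb'
    rw [hag e he b1 hb1 b2 hb2 h]
  · rwa [Finset.card_image_of_injOn hinj]
  · intro b hb e he
    obtain ⟨b1, hb1, rfl⟩ := Finset.mem_image.1 hb
    obtain ⟨γ, hγ, h⟩ := hL b1 hb1 e he
    refine (hh0 _).2 ⟨γ, hγ, fun x hx => ?_⟩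
    obtain ⟨i, hi, rfl⟩ := Finset.mem_image.1 hx
    exact h i hi

end

section
lemma fiber_bound {V : Type} [Fintype V] (s : ℕ) (i : Fin s) (R : Finset (Fin s → V)) (q : ℕ)
    (hR : ∀ z ∈ R, ∃ F : Finset V, F.card ≤ q ∧ ∀ z' ∈ R, (∀ j, j ≠ i → z' j = z j) → z' i ∈ F) :
    R.card ≤ q * Fintype.card V ^ (s - 1) := by
  let f : (Fin s → V) → ({j : Fin s // j ≠ i} → V) := fun z j => z j
  have h1 := Finset.card_le_mul_card_image (f := f) R q (by
    intro a ha
    obtain ⟨z, hz, rfl⟩ := Finset.mem_image.1 ha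
    obtain ⟨F, hF, hF'⟩ := hR z hz
    refine le_trans ?_ hF
    refine Finset.card_le_card_of_injOn (fun z' => z' i) ?_ ?_
    · intro z' hz'
      have hz' := Finset.mem_filter.1 (Finset.mem_coe.1 hz')
      refine Finset.mem_coe.2 (hF' z' hz'.1 fun j hj => ?_)
      exact congrFun hz'.2 ⟨j, hj⟩
    · intro z' hz' z'' hz'' he
      have hz' := Finset.mem_filter.1 (Finset.mem_coe.1 hz')
      have hz'' := Finset.mem_filter.1 (Finset.mem_coe.1 hz'')
      funext j
      by_cases hj : j = i
      · subst hj; exact he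
      · exact congrFun (hz'.2.trans hz''.2.symm) ⟨j, hj⟩)
  refine h1.trans (Nat.mul_le_mul_left _ ?_)
  refine (Finset.card_le_univ _).trans ?_
  rw [Fintype.card_fun]
  simp

lemma kint_eq {C : Finset (Set (ℝ × ℝ))} {k : ℕ} (hC : KIntersecting C k) {γ γ' : Set (ℝ × ℝ)}
    (hγ : γ ∈ C) (hγ' : γ' ∈ C) (F : Finset (ℝ × ℝ)) (hF : k < F.card) (h1 : ∀ x ∈ F, x ∈ γ)
    (h2 : ∀ x ∈ F, x ∈ γ') : γ = γ' := by
  by_contra hne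
  obtain ⟨hfin, hcard⟩ := hC.2 γ hγ γ' hγ' hne
  have : (F : Set (ℝ × ℝ)).ncard ≤ (γ ∩ γ').ncard :=
    Set.ncard_le_ncard (fun x hx => ⟨h1 x hx, h2 x hx⟩) hfin
  rw [Set.ncard_coe_finset] at this
  omega

lemma heavy_count (k : ℕ) (C : Finset (Set (ℝ × ℝ))) (hC : KIntersecting C k)
    (Q : Finset (ℝ × ℝ)) (η : ℝ) (hη : 0 < η) (hQ : 2 * k ≤ η * Q.card) (hQ0 : 0 < Q.card) :
    ((C.filter fun γ => η * Q.card ≤ ((Q.filter fun p => p ∈ γ).card : ℝ)).card : ℝ) ≤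
      (2 / η) ^ (k + 1) := by
  set H := C.filter fun γ => η * Q.card ≤ ((Q.filter fun p => p ∈ γ).card : ℝ) with hH
  have h1 : ∑ γ ∈ H, ((Q.filter fun p => p ∈ γ).powersetCard (k+1)).card ≤ (Q.powersetCard (k+1)).card := by
    rw [← Finset.card_biUnion]
    · refine Finset.card_le_card ?_
      refine Finset.biUnion_subset.2 fun γ _ => ?_
      exact Finset.powersetCard_mono (Finset.filter_subset _ _)
    · intro γ hγ γ' hγ' hne
      refine Finset.disjoint_left.2 fun T hT hT' => hne ?_
      rw [Finset.mem_powersetCard] at hT hT'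
      refine kint_eq hC (Finset.mem_filter.1 hγ).1 (Finset.mem_filter.1 hγ').1 T (by omega) ?_ ?_
      · intro x hx; exact (Finset.mem_filter.1 (hT.1 hx)).2
      · intro x hx; exact (Finset.mem_filter.1 (hT'.1 hx)).2
  simp only [Finset.card_powersetCard] at h1
  have hf : (0:ℝ) < (k+1).factorial := by exact_mod_cast Nat.factorial_pos _
  have hq : (0:ℝ) < Q.card := by exact_mod_cast hQ0
  have h2 : ∀ γ ∈ H, (η * Q.card / 2) ^ (k+1) ≤ (k+1).factorial * (((Q.filter fun p => p ∈ γ).card).choose (k+1) : ℝ) := by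
    intro γ hγ
    have hx := (Finset.mem_filter.1 hγ).2
    refine le_trans ?_ ((div_le_iff₀' hf).1 (Nat.pow_le_choose (α := ℝ) (k+1) _))
    gcongr
    have hle : k ≤ (Q.filter fun p => p ∈ γ).card := by
      have : (k : ℝ) ≤ (Q.filter fun p => p ∈ γ).card := by
        have : (0:ℝ) ≤ k := Nat.cast_nonneg _
        linarith
      exact_mod_cast this
    rw [Nat.add_sub_add_right, Nat.cast_sub hle]
    linarith
  have h3 : ((Q.card).choose (k+1) : ℝ) ≤ (Q.card : ℝ) ^ (k+1) / (k+1).factorial := Nat.choose_le_pow_div _ _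
  have h4 : (H.card : ℝ) * (η * Q.card / 2) ^ (k+1) ≤ (Q.card : ℝ) ^ (k+1) := by
    calc (H.card : ℝ) * (η * Q.card / 2) ^ (k+1) = ∑ γ ∈ H, (η * Q.card / 2) ^ (k+1) := by simp
      _ ≤ ∑ γ ∈ H, (k+1).factorial * (((Q.filter fun p => p ∈ γ).card).choose (k+1) : ℝ) := Finset.sum_le_sum h2
      _ = (k+1).factorial * ((∑ γ ∈ H, ((Q.filter fun p => p ∈ γ).card).choose (k+1) : ℕ) : ℝ) := by
          rw [← Finset.mul_sum]; push_cast; rfl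
      _ ≤ (k+1).factorial * ((Q.card).choose (k+1) : ℝ) := by
          gcongr
      _ ≤ (k+1).factorial * ((Q.card : ℝ) ^ (k+1) / (k+1).factorial) := by gcongr
      _ = _ := by field_simp
  have h5 : (η * Q.card / 2) ^ (k+1) = (Q.card : ℝ) ^ (k+1) / (2 / η) ^ (k+1) := by
    rw [← div_pow]; congr 1; field_simp
  rw [h5, mul_div_assoc', div_le_iff₀ (by positivity), mul_comm] at h4
  exact le_of_mul_le_mul_left h4 (by positivity)

lemma block_card (s : ℕ) (hs : 1 ≤ s) (Q : Finset (ℝ × ℝ)) (B : Finset (Finset (ℝ × ℝ)))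
    (h1 : ∀ b ∈ B, b ⊆ Q ∧ b.card = s) (h2 : ∀ b ∈ B, ∀ b' ∈ B, b ≠ b' → Disjoint b b') :
    B.card ≤ Q.card := by
  have : (B.biUnion id).card = ∑ b ∈ B, b.card := Finset.card_biUnion h2
  have h3 : (B.biUnion id).card ≤ Q.card :=
    Finset.card_le_card (Finset.biUnion_subset.2 fun b hb => (h1 b hb).1)
  rw [Finset.sum_congr rfl fun b hb => (h1 b hb).2, Finset.sum_const, smul_eq_mul] at this
  nlinarith

lemma block_share {k s : ℕ} (hs : k < s) {C : Finset (Set (ℝ × ℝ))} (hC : KIntersecting C k)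
    (bl : Set (ℝ × ℝ) → Finset (Finset (ℝ × ℝ)))
    (h1 : ∀ γ ∈ C, ∀ b ∈ bl γ, (b : Set (ℝ × ℝ)) ⊆ γ ∧ b.card = s)
    (h2 : ∀ γ ∈ C, ∀ b ∈ bl γ, ∀ b' ∈ bl γ, b ≠ b' → Disjoint b b')
    {γ γ' : Set (ℝ × ℝ)} (hγ : γ ∈ C) (hγ' : γ' ∈ C) {b b' : Finset (ℝ × ℝ)} (hb : b ∈ bl γ)
    (hb' : b' ∈ bl γ') (F : Finset (ℝ × ℝ)) (hF : k < F.card) (hFb : F ⊆ b) (hFb' : F ⊆ b') :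
    γ = γ' ∧ b = b' := by
  have hg : γ = γ' := kint_eq hC hγ hγ' F hF (fun x hx => (h1 γ hγ b hb).1 (hFb hx))
    (fun x hx => (h1 γ' hγ' b' hb').1 (hFb' hx))
  refine ⟨hg, ?_⟩
  subst hg
  by_contra hne
  have hd := h2 γ hγ b hb b' hb' hne
  have : F.Nonempty := Finset.card_pos.1 (by omega)
  obtain ⟨x, hx⟩ := this
  exact Finset.disjoint_left.1 hd (hFb hx) (hFb' hx)

lemma good_tuple (k s : ℕ) (C L : Finset (Set (ℝ × ℝ))) (hLC : L ⊆ C)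
    (Q : Finset (ℝ × ℝ)) (z : Fin s → {x // x ∈ Q}) (hz : Function.Injective z)
    (hh : ∀ e : Finset (Fin s), e.card = k + 1 → ∃ γ ∈ L, ∀ i ∈ e, (z i : ℝ × ℝ) ∈ γ)
    (hd : ∀ e : Finset (Fin s), e.card = k + 1 → ∀ i ∉ e, ∀ γ ∈ L, (∀ j ∈ e, (z j : ℝ × ℝ) ∈ γ) →
      (z i : ℝ × ℝ) ∉ γ) : ContainsConfig Q C s k := by
  let f : Fin s → ℝ × ℝ := fun i => (z i : ℝ × ℝ)
  have hf : Function.Injective f := Subtype.val_injective.comp hz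
  let pre : Finset (ℝ × ℝ) → Finset (Fin s) := fun T => Finset.univ.filter fun i => f i ∈ T
  have hpre : ∀ T ∈ (Finset.univ.image f).powersetCard (k+1), (pre T).card = k + 1 := by
    intro T hT
    rw [Finset.mem_powersetCard] at hT
    rw [← hT.2, ← Finset.card_image_of_injective _ hf]
    congr 1
    ext x
    simp only [pre, Finset.mem_image, Finset.mem_filter, Finset.mem_univ, true_and]
    constructor
    · rintro ⟨i, hi, rfl⟩; exact hi
    · intro hx
      obtain ⟨i, -, hi⟩ := Finset.mem_image.1 (hT.1 hx)
      exact ⟨i, by rwa [hi], hi⟩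
  have hmem : ∀ T ∈ (Finset.univ.image f).powersetCard (k+1), ∃ γ ∈ L, ∀ i ∈ pre T, f i ∈ γ :=
    fun T hT => hh _ (hpre T hT)
  choose! φ hφL hφ using hmem
  refine ⟨Finset.univ.image f, ?_, ?_, φ, ?_, ?_⟩
  · intro x hx
    obtain ⟨i, -, rfl⟩ := Finset.mem_image.1 hx
    exact (z i).2
  · rw [Finset.card_image_of_injective _ hf]; simp
  · have key : ∀ T ∈ (Finset.univ.image f).powersetCard (k+1), ∀ T' ∈ (Finset.univ.image f).powersetCard (k+1),
        φ T = φ T' → T' ⊆ T := by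
      intro T hT T' hT' he x hx
      obtain ⟨i, -, rfl⟩ := Finset.mem_image.1 ((Finset.mem_powersetCard.1 hT').1 hx)
      by_contra hn
      refine hd (pre T) (hpre T hT) i ?_ (φ T) (hφL T hT) (hφ T hT) ?_
      · simpa [pre] using hn
      · rw [he]; exact hφ T' hT' i (by simpa [pre] using hx)
    intro T hT T' hT' he
    exact Finset.Subset.antisymm (key T' hT' T hT he.symm) (key T hT T' hT' he)
  · intro T hT
    refine ⟨hLC (hφL T hT), fun x hx => ?_⟩
    obtain ⟨i, -, rfl⟩ := Finset.mem_image.1 ((Finset.mem_powersetCard.1 hT).1 hx)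
    exact hφ T hT i (by simpa [pre] using hx)

lemma bad_count (k s : ℕ) (C L : Finset (Set (ℝ × ℝ))) (hC : KIntersecting C k) (hLC : L ⊆ C)
    (Q : Finset (ℝ × ℝ)) (η : ℝ) (hη : 0 ≤ η) (hL : ∀ γ ∈ L, ((Q.filter fun p => p ∈ γ).card : ℝ) ≤ η * Q.card)
    (G : Finset (Fin s → {x // x ∈ Q}))
    (hG : ∀ z ∈ G, ∀ e : Finset (Fin s), e.card = k + 1 → ∃ γ ∈ L, ∀ i ∈ e, (z i : ℝ × ℝ) ∈ γ)
    (hno : ¬ ContainsConfig Q C s k) :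
    (G.card : ℝ) ≤ s ^ 2 * (Q.card : ℝ) ^ (s - 1) + 2 ^ s * s * (η * Q.card * (Q.card : ℝ) ^ (s - 1)) := by
  have hV : Fintype.card {x // x ∈ Q} = Q.card := Fintype.card_coe Q
  let R1 : Fin s × Fin s → Finset (Fin s → {x // x ∈ Q}) := fun p =>
    Finset.univ.filter fun z => p.1 ≠ p.2 ∧ z p.1 = z p.2
  let R2 : Finset (Fin s) × Fin s → Finset (Fin s → {x // x ∈ Q}) := fun p =>
    Finset.univ.filter fun z => Function.Injective z ∧ p.1.card = k + 1 ∧ p.2 ∉ p.1 ∧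
      ∃ γ ∈ L, (∀ j ∈ p.1, (z j : ℝ × ℝ) ∈ γ) ∧ (z p.2 : ℝ × ℝ) ∈ γ
  have hsub : G ⊆ (Finset.univ.biUnion R1) ∪ (Finset.univ.biUnion R2) := by
    intro z hz
    by_contra hn
    simp only [Finset.mem_union, Finset.mem_biUnion, Finset.mem_univ, true_and, not_or, not_exists] at hn
    have hinj : Function.Injective z := by
      intro i j hij
      by_contra hne
      exact hn.1 (i, j) (Finset.mem_filter.2 ⟨Finset.mem_univ _, hne, hij⟩)
    refine hno (good_tuple k s C L hLC Q z hinj (hG z hz) ?_)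
    intro e he i hi γ hγ hj hzi
    exact hn.2 (e, i) (Finset.mem_filter.2 ⟨Finset.mem_univ _, hinj, he, hi, γ, hγ, hj, hzi⟩)
  have hR1 : ∀ p, (R1 p).card ≤ 1 * Q.card ^ (s - 1) := by
    intro p
    rw [← hV]
    refine fiber_bound s p.1 (R1 p) 1 ?_
    intro z hz
    refine ⟨{z p.2}, by simp, fun z' hz' hj => ?_⟩
    have h := (Finset.mem_filter.1 hz').2
    rw [Finset.mem_singleton, h.2, hj _ (Ne.symm h.1)]
  have hR2 : ∀ p, (R2 p).card ≤ ⌊η * Q.card⌋₊ * Q.card ^ (s - 1) := by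
    intro p
    nth_rewrite 2 [← hV]
    refine fiber_bound s p.2 (R2 p) _ ?_
    intro z hz
    obtain ⟨hinj, hc, hp, γ, hγ, hj, hi⟩ := (Finset.mem_filter.1 hz).2
    refine ⟨Finset.univ.filter fun x => (x : ℝ × ℝ) ∈ γ, ?_, ?_⟩
    · refine Nat.le_floor (le_trans ?_ (hL γ hγ))
      norm_cast
      refine Finset.card_le_card_of_injOn Subtype.val ?_ (Subtype.val_injective.injOn)
      intro x hx
      simp only [Finset.coe_filter, Finset.mem_univ, true_and, Set.mem_ofPred_eq] at hx ⊢
      exact ⟨x.2, hx⟩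
    · intro z' hz' hag
      obtain ⟨hinj', hc', hp', γ', hγ', hj', hi'⟩ := (Finset.mem_filter.1 hz').2
      have : γ = γ' := by
        refine kint_eq hC (hLC hγ) (hLC hγ') (p.1.image fun i => (z i : ℝ × ℝ)) ?_ ?_ ?_
        · have hv : Function.Injective (fun i => (z i : ℝ × ℝ)) := Subtype.val_injective.comp hinj
          rw [Finset.card_image_of_injective _ hv]; omega
        · intro x hx
          obtain ⟨i, hi, rfl⟩ := Finset.mem_image.1 hx
          exact hj i hi
        · intro x hx
          obtain ⟨i, hi, rfl⟩ := Finset.mem_image.1 hx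
          have := hj' i hi
          rwa [hag i (by rintro rfl; exact hp hi)] at this
      rw [this]
      simpa using hi'
  have h1 : G.card ≤ ∑ p : Fin s × Fin s, (R1 p).card + ∑ p : Finset (Fin s) × Fin s, (R2 p).card :=
    (Finset.card_le_card hsub).trans ((Finset.card_union_le _ _).trans
      (add_le_add Finset.card_biUnion_le Finset.card_biUnion_le))
  have h2 : G.card ≤ (s * s) * (1 * Q.card ^ (s-1)) + (2 ^ s * s) * (⌊η * Q.card⌋₊ * Q.card ^ (s - 1)) := by
    refine h1.trans (add_le_add ?_ ?_)
    · refine (Finset.sum_le_card_nsmul _ _ _ fun p _ => hR1 p).trans ?_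
      simp
    · refine (Finset.sum_le_card_nsmul _ _ _ fun p _ => hR2 p).trans ?_
      simp
  have h3 : (G.card : ℝ) ≤ (s * s) * (1 * (Q.card : ℝ) ^ (s-1)) + (2 ^ s * s) * (⌊η * Q.card⌋₊ * (Q.card : ℝ) ^ (s - 1)) := by
    exact_mod_cast h2
  have h4 : (⌊η * Q.card⌋₊ : ℝ) ≤ η * Q.card := Nat.floor_le (by positivity)
  refine h3.trans ?_
  rw [sq, one_mul]
  gcongr

end

section
lemma final_arith (s : ℕ) (hs : 1 ≤ s) (δ η N : ℝ) (hδ : 0 < δ) (hN : 0 < N)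
    (hN2 : 4 * (s : ℝ) ^ 2 / δ ≤ N) (h4 : 2 ^ s * (s : ℝ) * (η * N) = δ / 4 * N)
    (h1 : δ * N ^ s ≤ (s : ℝ) ^ 2 * N ^ (s - 1) + 2 ^ s * s * (η * N * N ^ (s - 1))) : False := by
  have hps : N ^ s = N * N ^ (s - 1) := by
    rw [← pow_succ']; congr 1; omega
  rw [hps] at h1
  have hpp : 0 < N ^ (s - 1) := by positivity
  have h2 : δ * N * N ^ (s-1) ≤ ((s:ℝ) ^ 2 + 2 ^ s * s * (η * N)) * N ^ (s - 1) := by linarith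
  have h3 := le_of_mul_le_mul_right h2 hpp
  rw [div_le_iff₀ hδ] at hN2
  rw [h4] at h3
  have := mul_pos hδ hN
  nlinarith

lemma comb (k s : ℕ) (hk : 1 ≤ k) (hs : k + 1 < s) (c : ℝ) (hc : 0 < c) : ∃ N0 : ℝ, 0 < N0 ∧
    ∀ (Q : Finset (ℝ × ℝ)) (C : Finset (Set (ℝ × ℝ))) (bl : Set (ℝ × ℝ) → Finset (Finset (ℝ × ℝ))),
      KIntersecting C k →
      (∀ γ ∈ C, ∀ b ∈ bl γ, (b : Set (ℝ × ℝ)) ⊆ γ ∧ b.card = s ∧ b ⊆ Q) →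
      (∀ γ ∈ C, ∀ b ∈ bl γ, ∀ b' ∈ bl γ, b ≠ b' → Disjoint b b') →
      N0 ≤ Q.card →
      c * (Q.card : ℝ) ^ (k + 1) ≤ ∑ γ ∈ C, ((bl γ).card : ℝ) →
      ContainsConfig Q C s k := by
  obtain ⟨δ, hδ, hF⟩ := FRL2 (k + 1) s hs.le (c / 2) (by positivity)
  have hs0 : (0:ℝ) < s := by exact_mod_cast (by omega : 0 < s)
  set η : ℝ := δ / (4 * (2 ^ s * s)) with hη
  have hη0 : 0 < η := by positivity
  refine ⟨max 1 (max (4 * s ^ 2 / δ) (max (2 * k / η) (2 / c * (2 / η) ^ (k + 1)))), by positivity, ?_⟩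
  intro Q C bl hC hbl hdisj hN hcount
  simp only [max_le_iff] at hN
  obtain ⟨hN1, hN2, hN3, hN4⟩ := hN
  by_contra hno
  set N : ℝ := (Q.card : ℝ) with hNdef
  have hNpos : 0 < N := by linarith
  have hQpos : 0 < Q.card := Nat.cast_pos.1 hNpos
  let hv : Set (ℝ × ℝ) → Prop := fun γ => η * N ≤ ((Q.filter fun p => p ∈ γ).card : ℝ)
  have hH := heavy_count k C hC Q η hη0 (by
    rw [div_le_iff₀ hη0] at hN3; linarith) hQpos
  set H := C.filter hv with hHd
  set L := C.filter fun γ => ¬ hv γ with hLd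
  have hLC : L ⊆ C := Finset.filter_subset _ _
  have hblN : ∀ γ ∈ C, ((bl γ).card : ℝ) ≤ N := by
    intro γ hγ
    have := block_card s (by omega) Q (bl γ) (fun b hb => ⟨(hbl γ hγ b hb).2.2, (hbl γ hγ b hb).2.1⟩) (hdisj γ hγ)
    exact Nat.cast_le.2 this
  have hsplit : ∑ γ ∈ C, ((bl γ).card : ℝ) = ∑ γ ∈ H, ((bl γ).card : ℝ) + ∑ γ ∈ L, ((bl γ).card : ℝ) :=
    (Finset.sum_filter_add_sum_filter_not C hv _).symm
  have hHs : ∑ γ ∈ H, ((bl γ).card : ℝ) ≤ c / 2 * N ^ (k + 1) := by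
    calc ∑ γ ∈ H, ((bl γ).card : ℝ) ≤ ∑ γ ∈ H, N :=
          Finset.sum_le_sum fun γ hγ => hblN γ (Finset.filter_subset _ _ hγ)
      _ = H.card * N := by simp
      _ ≤ (2 / η) ^ (k + 1) * N := by gcongr
      _ ≤ (c / 2 * N) * N := by
          have hX : ∀ X : ℝ, c / 2 * (2 / c * X) = X := fun X => by field_simp
          have := mul_le_mul_of_nonneg_left hN4 (by positivity : 0 ≤ c / 2)
          rw [hX] at this
          gcongr
      _ = c / 2 * N ^ 2 := by ring
      _ ≤ c / 2 * N ^ (k + 1) := by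
          refine mul_le_mul_of_nonneg_left ?_ (by positivity)
          exact pow_le_pow_right₀ hN1 (by omega)
  have hLs : c / 2 * N ^ (k + 1) ≤ ∑ γ ∈ L, ((bl γ).card : ℝ) := by linarith
  have hbl' : ∀ γ ∈ C, ∀ b ∈ bl γ, (b : Set (ℝ × ℝ)) ⊆ γ ∧ b.card = s :=
    fun γ hγ b hb => ⟨(hbl γ hγ b hb).1, (hbl γ hγ b hb).2.1⟩
  set BB := L.biUnion bl with hBB
  have hBBm : ∀ b ∈ BB, ∃ γ ∈ L, b ∈ bl γ := fun b hb => Finset.mem_biUnion.1 hb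
  have hshare : ∀ b ∈ BB, ∀ b' ∈ BB, ∀ F : Finset (ℝ × ℝ), k < F.card → F ⊆ b → F ⊆ b' → b = b' := by
    intro b hb b' hb' F hF h1 h2
    obtain ⟨γ, hγ, hb⟩ := hBBm b hb
    obtain ⟨γ', hγ', hb'⟩ := hBBm b' hb'
    exact (block_share (by omega : k < s) hC bl hbl' hdisj (hLC hγ) (hLC hγ') hb hb' F hF h1 h2).2
  have hBBc : (BB.card : ℝ) = ∑ γ ∈ L, ((bl γ).card : ℝ) := by
    rw [hBB, Finset.card_biUnion]
    · push_cast; rfl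
    · intro γ hγ γ' hγ' hne
      refine Finset.disjoint_left.2 fun b hb hb' => hne ?_
      refine (block_share (by omega : k < s) hC bl hbl' hdisj (hLC hγ) (hLC hγ') hb hb' b ?_ le_rfl le_rfl).1
      rw [(hbl' γ (hLC hγ) b hb).2]; omega
  have hord : ∀ b ∈ BB, ∃ o : Fin s → {x // x ∈ Q}, Function.Injective o ∧ ∀ i, (o i : ℝ × ℝ) ∈ b := by
    intro b hb
    obtain ⟨γ, hγ, hb⟩ := hBBm b hb
    obtain ⟨-, hcard, hbQ⟩ := hbl γ (hLC hγ) b hb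
    let eq := (b.equivFinOfCardEq hcard).symm
    refine ⟨fun i => ⟨(eq i : ℝ × ℝ), hbQ (eq i).2⟩, ?_, fun i => (eq i).2⟩
    intro i j hij
    have : (eq i : ℝ × ℝ) = eq j := congrArg (fun x : {x // x ∈ Q} => (x : ℝ × ℝ)) hij
    exact eq.injective (Subtype.ext this)
  have hne : Nonempty {x // x ∈ Q} := by
    obtain ⟨x, hx⟩ := Finset.card_pos.1 hQpos
    exact ⟨⟨x, hx⟩⟩
  choose! o ho1 ho2 using hord
  have hagree : ∀ e : Finset (Fin s), e.card = k + 1 → ∀ b ∈ BB, ∀ b' ∈ BB,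
      (∀ i ∈ e, o b i = o b' i) → b = b' := by
    intro e he b hb b' hb' hag
    have hv : Function.Injective (fun i => (o b i : ℝ × ℝ)) := Subtype.val_injective.comp (ho1 b hb)
    refine hshare b hb b' hb' (e.image fun i => (o b i : ℝ × ℝ)) ?_ ?_ ?_
    · rw [Finset.card_image_of_injective _ hv]; omega
    · intro x hx
      obtain ⟨i, hi, rfl⟩ := Finset.mem_image.1 hx
      exact ho2 b hb i
    · intro x hx
      obtain ⟨i, hi, rfl⟩ := Finset.mem_image.1 hx
      change (o b i : ℝ × ℝ) ∈ b'
      rw [hag i hi]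
      exact ho2 b' hb' i
  have hV : Fintype.card {x // x ∈ Q} = Q.card := Fintype.card_coe Q
  obtain ⟨G, hG, hfr⟩ := hF {x // x ∈ Q} {S | ∃ γ ∈ L, S = {x : {x // x ∈ Q} | (x : ℝ × ℝ) ∈ γ}} _ BB o hagree
    (by rw [hV, hBBc]; exact hLs) (by
      intro b hb e he
      obtain ⟨γ, hγ, hb'⟩ := hBBm b hb
      exact ⟨_, ⟨γ, hγ, rfl⟩, fun i _ => (hbl' γ (hLC hγ) b hb').1 (ho2 b hb i)⟩)
  rw [hV] at hfr
  have hbad := bad_count k s C L hC hLC Q η hη0.le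
      (fun γ hγ => (not_le.1 (Finset.mem_filter.1 hγ).2).le) G (by
        intro z hz e he
        obtain ⟨_, ⟨γ, hγ, rfl⟩, h⟩ := hG z hz e he
        exact ⟨γ, hγ, h⟩) hno
  have h1 := hfr.trans hbad
  rw [← hNdef] at h1
  have h4 : 2 ^ s * (s : ℝ) * (η * N) = δ / 4 * N := by
    rw [hη]; field_simp
  exact final_arith s (by omega) δ η N hδ hNpos hN2 h4 h1

end

section
lemma rpow_facts (k : ℕ) (n m : ℝ) (hn : 0 < n) (hm : 0 < m) : ∃ N : ℝ, 0 < N ∧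
    N ^ (2 * k + 1) = m ^ 2 / n ∧
    n ^ (((k:ℝ) + 1) / (2 * (k:ℝ) + 1)) * m ^ ((2 * (k:ℝ)) / (2 * (k:ℝ) + 1)) = n * N ^ k := by
  have hk : (0:ℝ) < 2 * (k:ℝ) + 1 := by positivity
  refine ⟨(m ^ 2 / n) ^ (1 / (2 * (k:ℝ) + 1)), by positivity, ?_, ?_⟩
  · rw [← Real.rpow_natCast, ← Real.rpow_mul (by positivity)]
    push_cast
    rw [one_div_mul_cancel hk.ne', Real.rpow_one]
  · rw [← Real.rpow_natCast, ← Real.rpow_mul (by positivity), Real.div_rpow (by positivity) hn.le,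
      ← Real.rpow_natCast m 2, ← Real.rpow_mul hm.le]
    have e1 : ((2:ℕ):ℝ) * (1 / (2 * (k:ℝ) + 1) * k) = 2 * (k:ℝ) / (2 * (k:ℝ) + 1) := by
      push_cast; ring
    rw [e1]
    have e2 : n ^ (((k:ℝ) + 1) / (2 * (k:ℝ) + 1)) * n ^ (1 / (2 * (k:ℝ) + 1) * k) = n := by
      rw [← Real.rpow_add hn]
      have : ((k:ℝ) + 1) / (2 * (k:ℝ) + 1) + 1 / (2 * (k:ℝ) + 1) * k = 1 := by
        field_simp; ring
      rw [this, Real.rpow_one]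
    have hp : 0 < n ^ (1 / (2 * (k:ℝ) + 1) * k) := by positivity
    rw [mul_div_assoc', eq_div_iff hp.ne']
    calc _ = (n ^ (((k:ℝ) + 1) / (2 * (k:ℝ) + 1)) * n ^ (1 / (2 * (k:ℝ) + 1) * k)) *
          m ^ (2 * (k:ℝ) / (2 * (k:ℝ) + 1)) := by ring
      _ = _ := by rw [e2]

lemma cfg_mono {Q P : Finset (ℝ × ℝ)} (h : Q ⊆ P) {C : Finset (Set (ℝ × ℝ))} {s k : ℕ}
    (hc : ContainsConfig Q C s k) : ContainsConfig P C s k := by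
  obtain ⟨S, hS, r⟩ := hc
  exact ⟨S, hS.trans h, r⟩

/-- pigeonhole over the pieces -/
lemma pigeon (P : Finset (ℝ × ℝ)) (C : Finset (Set (ℝ × ℝ))) (QQ : Finset (Finset (ℝ × ℝ)))
    (bl : Set (ℝ × ℝ) → Finset (Finset (ℝ × ℝ))) (t : ℝ) (ht : 0 ≤ t)
    (h1 : ∀ Q ∈ QQ, Q ⊆ P) (h2 : ∀ Q ∈ QQ, ∀ Q' ∈ QQ, Q ≠ Q' → Disjoint Q Q')
    (h3 : ∀ γ ∈ C, ∀ b ∈ bl γ, ∃ Q ∈ QQ, b ⊆ Q)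
    (hA : t * P.card < ∑ γ ∈ C, ((bl γ).card : ℝ)) :
    ∃ Q ∈ QQ, t * Q.card < ∑ γ ∈ C, (((bl γ).filter fun b => b ⊆ Q).card : ℝ) := by
  by_contra hcon
  push Not at hcon
  have e1 : ∑ Q ∈ QQ, (Q.card : ℝ) ≤ P.card := by
    have : (QQ.biUnion id).card = ∑ Q ∈ QQ, Q.card := Finset.card_biUnion h2
    have h : (QQ.biUnion id).card ≤ P.card := Finset.card_le_card (Finset.biUnion_subset.2 h1)
    rw [this] at h
    exact_mod_cast h
  have e2 : ∑ γ ∈ C, ((bl γ).card : ℝ) ≤ ∑ γ ∈ C, ∑ Q ∈ QQ, (((bl γ).filter fun b => b ⊆ Q).card : ℝ) := by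
    refine Finset.sum_le_sum fun γ hγ => ?_
    have : bl γ ⊆ QQ.biUnion fun Q => (bl γ).filter fun b => b ⊆ Q := by
      intro b hb
      obtain ⟨Q, hQ, hbQ⟩ := h3 γ hγ b hb
      exact Finset.mem_biUnion.2 ⟨Q, hQ, Finset.mem_filter.2 ⟨hb, hbQ⟩⟩
    have := (Finset.card_le_card this).trans Finset.card_biUnion_le
    exact_mod_cast this
  rw [Finset.sum_comm] at e2
  have e3 := Finset.sum_le_sum hcon
  rw [← Finset.mul_sum] at e3
  nlinarith

lemma blocks_pow {k s : ℕ} (hs : k < s) {C : Finset (Set (ℝ × ℝ))} (hC : KIntersecting C k)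
    (bl : Set (ℝ × ℝ) → Finset (Finset (ℝ × ℝ))) (Q : Finset (ℝ × ℝ))
    (h1 : ∀ γ ∈ C, ∀ b ∈ bl γ, (b : Set (ℝ × ℝ)) ⊆ γ ∧ b.card = s)
    (h2 : ∀ γ ∈ C, ∀ b ∈ bl γ, ∀ b' ∈ bl γ, b ≠ b' → Disjoint b b')
    (h3 : ∀ γ ∈ C, ∀ b ∈ bl γ, b ⊆ Q) :
    ∑ γ ∈ C, ((bl γ).card : ℝ) ≤ 2 ^ Q.card := by
  have : (C.biUnion bl).card = ∑ γ ∈ C, (bl γ).card := by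
    refine Finset.card_biUnion ?_
    intro γ hγ γ' hγ' hne
    refine Finset.disjoint_left.2 fun b hb hb' => hne ?_
    refine (block_share hs hC bl h1 h2 hγ hγ' hb hb' b ?_ le_rfl le_rfl).1
    rw [(h1 γ hγ b hb).2]; omega
  have h : (C.biUnion bl).card ≤ (Q.powerset).card := Finset.card_le_card
    (Finset.biUnion_subset.2 fun γ hγ b hb => Finset.mem_powerset.2 (h3 γ hγ b hb))
  rw [this, Finset.card_powerset] at h
  exact_mod_cast h

lemma cost_arith (k : ℕ) (n m N D K cost : ℝ) (hn : 0 < n) (hN : 0 < N) (hD : 0 < D)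
    (hW : N ^ (2 * k + 1) = m ^ 2 / n) (hnm : n ≤ m ^ 2)
    (hcost : cost ≤ 300 * (2 * k * m ^ 2 + n + m ^ 2 / n * n) / √((D * N ^ (k + 1)) ^ 2)) :
    cost ≤ 600 * (k + 1) / D * (n * N ^ k) := by
  rw [Real.sqrt_sq (by positivity), div_mul_cancel₀ _ hn.ne'] at hcost
  refine hcost.trans ?_
  have hm : m ^ 2 = n * N ^ k * N ^ (k + 1) := by
    rw [eq_div_iff hn.ne'] at hW
    rw [← hW]; ring
  have h1 : 300 * (2 * k * m ^ 2 + n + m ^ 2) ≤ 600 * (k + 1) * m ^ 2 := by nlinarith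
  calc 300 * (2 * k * m ^ 2 + n + m ^ 2) / (D * N ^ (k + 1))
      ≤ 600 * (k + 1) * m ^ 2 / (D * N ^ (k + 1)) := by gcongr
    _ = _ := by rw [hm]; field_simp

theorem solymosi_final (k s : ℕ) (hk : 1 ≤ k) (hs : k + 1 < s)
    (ε : ℝ) (hε : 0 < ε) :
    ∃ M : ℝ, 0 < M ∧
      ∀ P : Finset (ℝ × ℝ), ∀ C : Finset (Set (ℝ × ℝ)),
        KIntersecting C k → ¬ ContainsConfig P C s k →
        M * (C.card : ℝ) ≤ (P.card : ℝ) ^ (k + 1) →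
        M ≤ (C.card : ℝ) →
        M * (P.card : ℝ) ≤ (C.card : ℝ) ^ 2 →
        (incidences P C : ℝ) <
          ε * (P.card : ℝ) ^ (((k:ℝ) + 1) / (2 * (k:ℝ) + 1)) *
            (C.card : ℝ) ^ ((2 * (k:ℝ)) / (2 * (k:ℝ) + 1)) := by
  have hs0 : (0:ℝ) < s := by exact_mod_cast (by omega : 0 < s)
  obtain ⟨D, hD1, hD⟩ : ∃ D : ℝ, 1 ≤ D ∧ 600 * (k + 1) / D ≤ ε / (4 * s) := by
    refine ⟨1 + 2400 * (k + 1) * s / ε, by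
      have : (0:ℝ) ≤ 2400 * (k + 1) * s / ε := by positivity
      linarith, ?_⟩
    rw [div_le_div_iff₀ (by positivity) (by positivity)]
    have : ε * (1 + 2400 * (k + 1) * s / ε) = ε + 2400 * (k + 1) * s := by field_simp
    rw [this]; linarith
  have hD0 : 0 < D := by linarith
  set c2 : ℝ := ε / (4 * s) with hc2
  have hc20 : 0 < c2 := by positivity
  obtain ⟨N0, hN0, hcomb⟩ := comb k s hk hs (c2 / (D ^ 2) ^ k) (by positivity)
  obtain ⟨K, hK1, hK2, hK3⟩ : ∃ K : ℝ, 1 ≤ K ∧ 1 / K ≤ c2 ∧ 2 ^ ⌈N0⌉₊ ≤ c2 * K := by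
    refine ⟨max 1 (max (1 / c2) (2 ^ ⌈N0⌉₊ / c2)), le_max_left _ _, ?_, ?_⟩
    · rw [one_div_le (by positivity) hc20]
      exact (le_max_left _ _).trans (le_max_right _ _)
    · rw [← div_le_iff₀' hc20]
      exact (le_max_right _ _).trans (le_max_right _ _)
  have hK0 : 0 < K := by linarith
  refine ⟨K ^ (2 * k + 1), by positivity, ?_⟩
  intro P C hC hno hM1 hM2 hM3
  set M : ℝ := K ^ (2 * k + 1) with hM
  have hM1' : 1 ≤ M := one_le_pow₀ hK1
  have hm : 0 < (C.card : ℝ) := by linarith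
  have hn : 0 < (P.card : ℝ) := by
    rcases Nat.eq_zero_or_pos P.card with h0 | h0
    · rw [h0] at hM1
      simp only [Nat.cast_zero, ne_eq, Nat.succ_ne_zero, not_false_eq_true, zero_pow] at hM1
      have : 0 < M * (C.card : ℝ) := by positivity
      linarith
    · exact_mod_cast h0
  obtain ⟨N, hN, hNW, hX⟩ := rpow_facts k (P.card : ℝ) (C.card : ℝ) hn hm
  rw [mul_assoc, hX]
  by_contra hcon
  rw [not_lt] at hcon
  have hNK : K ≤ N := by
    refine le_of_pow_le_pow_left₀ (n := 2 * k + 1) (by omega) hN.le ?_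
    rw [hNW, le_div_iff₀ hn]; exact hM3
  have hN1 : 1 ≤ N := hK1.trans hNK
  have hXm : K * (C.card : ℝ) ≤ P.card * N ^ k := by
    refine le_of_pow_le_pow_left₀ (n := 2 * k + 1) (by omega) (by positivity) ?_
    have e1 : ((P.card : ℝ) * N ^ k) ^ (2 * k + 1) = (P.card : ℝ) ^ (k + 1) * ((C.card : ℝ) ^ 2) ^ k := by
      rw [mul_pow, ← pow_mul, mul_comm k, pow_mul N, hNW, div_pow, mul_div_assoc']
      rw [div_eq_iff (by positivity)]
      ring
    rw [e1, mul_pow]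
    calc K ^ (2 * k + 1) * (C.card : ℝ) ^ (2 * k + 1) = (M * (C.card : ℝ)) * ((C.card : ℝ) ^ 2) ^ k := by
          rw [← hM]; ring
      _ ≤ _ := by gcongr
  obtain ⟨QQ, bl, cost, hQ, hQd, hbl, hbld, hI, hcost⟩ := pieces_exist k s (by omega) P C hC
    ((D * N ^ (k + 1)) ^ 2) ((C.card : ℝ) ^ 2 / P.card) (by
      refine one_le_pow₀ ?_
      exact one_le_mul_of_one_le_of_one_le hD1 (one_le_pow₀ hN1)) (by positivity)
  have hcost' := cost_arith k (P.card : ℝ) (C.card : ℝ) N D K cost hn hN hD0 hNW (by nlinarith) hcost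
  set X : ℝ := (P.card : ℝ) * N ^ k with hXd
  have hX0 : 0 < X := by positivity
  set A : ℝ := ∑ γ ∈ C, ((bl γ).card : ℝ) with hA
  have hcX : cost ≤ c2 * X := hcost'.trans (by gcongr)
  have hmX : (C.card : ℝ) ≤ c2 * X := by
    have : (C.card : ℝ) ≤ 1 / K * X := by
      rw [div_mul_eq_mul_div, one_mul, le_div_iff₀ hK0]; linarith
    exact this.trans (by gcongr)
  have hAX : c2 * N ^ k * P.card < A := by
    have h1 : ε * X = s * (4 * c2 * X) := by rw [hc2]; field_simp
    have h2 : 4 * c2 * X ≤ A + cost + C.card := by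
      have := hcon.trans hI
      rw [h1] at this
      exact le_of_mul_le_mul_left this hs0
    have h3 : c2 * N ^ k * P.card = c2 * X := by rw [hXd]; ring
    have h4 : 0 < c2 * X := by positivity
    rw [h3]; linarith
  obtain ⟨Q, hQQ, hAQ⟩ := pigeon P C QQ bl (c2 * N ^ k) (by positivity) (fun Q h => (hQ Q h).1) hQd
    (fun γ hγ b hb => (hbl γ hγ b hb).2.2) hAX
  have hb1 : ∀ γ ∈ C, ∀ b ∈ (bl γ).filter (fun b => b ⊆ Q), (b : Set (ℝ × ℝ)) ⊆ γ ∧ b.card = s ∧ b ⊆ Q := by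
    intro γ hγ b hb
    have hb := Finset.mem_filter.1 hb
    exact ⟨(hbl γ hγ b hb.1).1, (hbl γ hγ b hb.1).2.1, hb.2⟩
  have hb2 : ∀ γ ∈ C, ∀ b ∈ (bl γ).filter (fun b => b ⊆ Q), ∀ b' ∈ (bl γ).filter (fun b => b ⊆ Q),
      b ≠ b' → Disjoint b b' := fun γ hγ b hb b' hb' =>
    hbld γ hγ b (Finset.mem_filter.1 hb).1 b' (Finset.mem_filter.1 hb').1
  have hpow := blocks_pow (by omega : k < s) hC (fun γ => (bl γ).filter fun b => b ⊆ Q) Q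
    (fun γ hγ b hb => ⟨(hb1 γ hγ b hb).1, (hb1 γ hγ b hb).2.1⟩) hb2 (fun γ hγ b hb => (hb1 γ hγ b hb).2.2)
  have hQ1 : 1 ≤ (Q.card : ℝ) := by
    by_contra hlt
    have h0 : Q.card = 0 := by
      by_contra h0
      exact hlt (by exact_mod_cast Nat.one_le_iff_ne_zero.2 h0)
    have : ∑ γ ∈ C, (((bl γ).filter fun b => b ⊆ Q).card : ℝ) = 0 := by
      refine Finset.sum_eq_zero fun γ hγ => ?_
      rw [Nat.cast_eq_zero, Finset.card_eq_zero, Finset.eq_empty_iff_forall_notMem]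
      intro b hb
      have h := hb1 γ hγ b hb
      have := Finset.card_le_card h.2.2
      omega
    rw [this, h0] at hAQ
    simp at hAQ
  have hNk : N ≤ N ^ k := le_self_pow₀ hN1 (by omega)
  have hQN0 : N0 ≤ Q.card := by
    by_contra hlt
    rw [not_le] at hlt
    have h1 : Q.card ≤ ⌈N0⌉₊ := by
      have := hlt.trans_le (Nat.le_ceil N0)
      exact_mod_cast this.le
    have h2 : (2:ℝ) ^ Q.card ≤ 2 ^ ⌈N0⌉₊ := pow_le_pow_right₀ (by norm_num) h1
    have h3 : c2 * K ≤ c2 * N ^ k * Q.card := by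
      calc c2 * K ≤ c2 * N ^ k := by gcongr; linarith
        _ ≤ _ := le_mul_of_one_le_right (by positivity) hQ1
    linarith
  have hQN : (Q.card : ℝ) ≤ D ^ 2 * N := by
    have h := (hQ Q hQQ).2
    rw [← hNW] at h
    have h1 : (D * N ^ (k + 1)) ^ 2 = N ^ (2 * k + 1) * (D ^ 2 * N) := by ring
    rw [h1] at h
    exact le_of_mul_le_mul_left h (by positivity)
  refine hno (cfg_mono (hQ Q hQQ).1 (hcomb Q C (fun γ => (bl γ).filter fun b => b ⊆ Q) hC hb1 hb2 hQN0 ?_))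
  refine le_trans ?_ hAQ.le
  rw [pow_succ (Q.card : ℝ) k, ← mul_assoc]
  refine mul_le_mul_of_nonneg_right ?_ (by positivity)
  calc c2 / (D ^ 2) ^ k * (Q.card : ℝ) ^ k ≤ c2 / (D ^ 2) ^ k * (D ^ 2 * N) ^ k := by gcongr
    _ = c2 * N ^ k := by rw [mul_pow]; field_simp

end

theorem solymosi_type_nondiagonal (k s : ℕ) (hk : 1 ≤ k) (hs : k + 1 < s)
    (ε : ℝ) (hε : 0 < ε) :
    ∃ M : ℝ, 0 < M ∧
      ∀ P : Finset (ℝ × ℝ), ∀ C : Finset (Set (ℝ × ℝ)),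
        KIntersecting C k → ¬ ContainsConfig P C s k →
        M * (C.card : ℝ) ≤ (P.card : ℝ) ^ (k + 1) →
        M ≤ (C.card : ℝ) →
        M * (P.card : ℝ) ≤ (C.card : ℝ) ^ 2 →
        (incidences P C : ℝ) <
          ε * (P.card : ℝ) ^ (((k:ℝ) + 1) / (2 * (k:ℝ) + 1)) *
            (C.card : ℝ) ^ ((2 * (k:ℝ)) / (2 * (k:ℝ) + 1)) := by
  exact solymosi_final k s hk hs ε hε
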